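/- arXiv:1908.03801 — 2 statements merged into one kernel-verified Lean document; each statement's English description precedes it below -/
import Mathlib

section
/- Let H ≤_alg J be an algebraic extension of finitely generated free groups and let ι : J ↪ F = F_r be an embedding of J into F. Let π_ι(H) be the smallest rank of an algebraic extension of ι(H) inside F which is not contained in ι(J), with π_ι(H) = ∞ if ι(J) is a free factor of F. Then: if π_ι(H) = ∞, Φ_{ι(H),F}(N) = Φ_{H,J}(N) for all N; and if π_ι(H) < ∞, then Φ_{ι(H),F}(N) = Φ_{H,J}(N) + C·N^{1−π_ι(H)} + O(N^{−π_ι(H)}), where C is the number of algebraic extensions of ι(H) inside F of rank π_ι(H) which are not contained in ι(J); in particular, if π_ι(H) < ∞ then Φ_{ι(H),F}(N) > Φ_{H,J}(N) for every sufficiently large N. -/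
open scoped Monoid.Coprod

/-- `M` is a free factor of the subgroup `B` (with `M ≤ B`): there is a subgroup
`M' ≤ B` such that the natural map from the free product `M ∗ M'` to `B` is an
isomorphism. -/
def IsFreeFactorOf {G : Type} [Group G] (M B : Subgroup G) : Prop :=
  ∃ (M' : Subgroup G) (hM : M ≤ B) (hM' : M' ≤ B),
    Function.Bijective
      (Monoid.Coprod.lift (Subgroup.inclusion hM) (Subgroup.inclusion hM'))

/-- `B` is an algebraic extension of `H` (as subgroups of an ambient group):
`H ≤ B`, and every intermediate subgroup `H ≤ L ≤ B` which is a free factor of `B`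
equals `B`. -/
def IsAlgebraicExtensionOf {G : Type} [Group G] (H B : Subgroup G) : Prop :=
  H ≤ B ∧ ∀ L : Subgroup G, H ≤ L → IsFreeFactorOf L B → L = B

/-- The rank of a subgroup: the least cardinality of a finite generating set,
or `∞` if the subgroup is not finitely generated.  (For subgroups of free groups,
which are free, this is the rank as a free group.) -/
noncomputable def subgroupRank {G : Type} [Group G] (M : Subgroup G) : ℕ∞ :=
  ⨅ S : {S : Finset G // Subgroup.closure (S : Set G) = M}, ((S : Finset G).card : ℕ∞)

/-- `Phi m N H` is the expected number of points of `{1,…,N}` fixed simultaneously by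
all permutations in `φ(H)`, where `φ : FreeGroup (Fin m) →* S_N` is a uniformly
random homomorphism. -/
noncomputable def Phi (m N : ℕ) (H : Subgroup (FreeGroup (Fin m))) : ℚ :=
  (∑ f : Fin m → Equiv.Perm (Fin N),
      (Nat.card {x : Fin N // ∀ h ∈ H, (FreeGroup.lift f) h x = x} : ℚ)) /
    (Fintype.card (Fin m → Equiv.Perm (Fin N)))

/-- `piIota H ι` is the smallest rank of an algebraic extension of `ι(H)` inside
`FreeGroup (Fin r)` which is not contained in `ι(J)` (where `J = FreeGroup (Fin m)`),
and `∞` if there is no such algebraic extension. -/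
noncomputable def piIota {m r : ℕ} (H : Subgroup (FreeGroup (Fin m)))
    (ι : FreeGroup (Fin m) →* FreeGroup (Fin r)) : ℕ∞ :=
  ⨅ M : {M : Subgroup (FreeGroup (Fin r)) //
      IsAlgebraicExtensionOf (H.map ι) M ∧ ¬ M ≤ ι.range}, subgroupRank (M : Subgroup (FreeGroup (Fin r)))

section FreeFactor

variable {G : Type} [Group G]

theorem isFreeFactorOf_iff {M B : Subgroup G} :
    IsFreeFactorOf M B ↔ ∃ (M' : Subgroup G) (hM : M ≤ B) (hM' : M' ≤ B), M ⊔ M' = B ∧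
      ∀ (S : Type) [Group S] (f : M →* S) (f' : M' →* S), ∃ φ : B →* S,
        (∀ x (h : x ∈ M), φ ⟨x, hM h⟩ = f ⟨x, h⟩) ∧
          ∀ x (h : x ∈ M'), φ ⟨x, hM' h⟩ = f' ⟨x, h⟩ := by
  constructor
  · rintro ⟨M', hM, hM', hb⟩
    refine ⟨M', hM, hM', le_antisymm (sup_le hM hM') ?_, ?_⟩
    · intro x hx
      obtain ⟨y, hy⟩ := hb.2 ⟨x, hx⟩
      have hr : ∀ y, ((B.subtype.comp (Monoid.Coprod.lift (Subgroup.inclusion hM)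
          (Subgroup.inclusion hM'))) y) ∈ M ⊔ M' := by
        intro y
        induction y using Monoid.Coprod.induction_on with
        | inl m => simpa using Subgroup.mem_sup_left m.2
        | inr m => simpa using Subgroup.mem_sup_right m.2
        | mul a b ha hb' =>
          rw [map_mul]
          exact mul_mem ha hb'
      simpa [hy] using hr y
    · intro S _ f f'
      let e := MulEquiv.ofBijective _ hb
      have he₁ : ∀ x (h : x ∈ M), e.symm ⟨x, hM h⟩ = Monoid.Coprod.inl ⟨x, h⟩ := by
        intro x h
        rw [MulEquiv.symm_apply_eq]
        rfl
      have he₂ : ∀ x (h : x ∈ M'), e.symm ⟨x, hM' h⟩ = Monoid.Coprod.inr ⟨x, h⟩ := by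
        intro x h
        rw [MulEquiv.symm_apply_eq]
        rfl
      refine ⟨(Monoid.Coprod.lift f f').comp e.symm.toMonoidHom, fun x h => ?_, fun x h => ?_⟩
      · simp [he₁ x h]
      · simp [he₂ x h]
  · rintro ⟨M', hM, hM', hs, hu⟩
    refine ⟨M', hM, hM', ?_, ?_⟩
    · obtain ⟨φ, h₁, h₂⟩ := hu (Monoid.Coprod M M') Monoid.Coprod.inl Monoid.Coprod.inr
      have : φ.comp (Monoid.Coprod.lift (Subgroup.inclusion hM) (Subgroup.inclusion hM')) =
          MonoidHom.id _ := by
        apply Monoid.Coprod.hom_ext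
        · ext x
          exact h₁ x.1 x.2
        · ext x
          exact h₂ x.1 x.2
      exact Function.LeftInverse.injective (g := φ) fun x => DFunLike.congr_fun this x
    · have : M ⊔ M' ≤ (B.subtype.comp (Monoid.Coprod.lift (Subgroup.inclusion hM)
          (Subgroup.inclusion hM'))).range := by
        refine sup_le (fun x hx => ⟨Monoid.Coprod.inl ⟨x, hx⟩, by simp⟩)
          (fun x hx => ⟨Monoid.Coprod.inr ⟨x, hx⟩, by simp⟩)
      rintro ⟨x, hx⟩
      obtain ⟨y, hy⟩ := this (hs.symm ▸ hx)
      exact ⟨y, Subtype.ext (by simpa using hy)⟩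

theorem IsFreeFactorOf.le {M B : Subgroup G} (h : IsFreeFactorOf M B) : M ≤ B :=
  h.choose_spec.choose

theorem IsFreeFactorOf.refl (B : Subgroup G) : IsFreeFactorOf B B := by
  rw [isFreeFactorOf_iff]
  refine ⟨⊥, le_rfl, bot_le, by simp, fun S _ f f' => ⟨f, fun x h => rfl, fun x h => ?_⟩⟩
  have hx : x = 1 := by simpa using h
  subst hx
  have h₁ : (⟨1, h⟩ : (⊥ : Subgroup G)) = 1 := rfl
  rw [h₁, map_one]
  exact map_one f

theorem MonoidHom.eq_of_eq_on_sup {S : Type} [Group S] {M M' B : Subgroup G} (hM : M ≤ B)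
    (hM' : M' ≤ B) (hs : M ⊔ M' = B) (φ ψ : B →* S)
    (h₁ : ∀ x (h : x ∈ M), φ ⟨x, hM h⟩ = ψ ⟨x, hM h⟩)
    (h₂ : ∀ x (h : x ∈ M'), φ ⟨x, hM' h⟩ = ψ ⟨x, hM' h⟩) : φ = ψ := by
  have : M ⊔ M' ≤ (φ.eqLocus ψ).map B.subtype :=
    sup_le (fun x hx => ⟨⟨x, hM hx⟩, h₁ x hx, rfl⟩) (fun x hx => ⟨⟨x, hM' hx⟩, h₂ x hx, rfl⟩)
  ext ⟨x, hx⟩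
  obtain ⟨y, hy, hyx⟩ := this (hs.symm ▸ hx)
  have : y = ⟨x, hx⟩ := Subtype.ext hyx
  exact this ▸ hy

theorem IsFreeFactorOf.trans {P K L : Subgroup G} (h₁ : IsFreeFactorOf P K)
    (h₂ : IsFreeFactorOf K L) : IsFreeFactorOf P L := by
  rw [isFreeFactorOf_iff] at *
  obtain ⟨P', hP, hP', hs, hu⟩ := h₁
  obtain ⟨K', hK, hK', hs', hu'⟩ := h₂
  have hle : P' ⊔ K' ≤ L := sup_le (hP'.trans hK) hK'
  refine ⟨P' ⊔ K', hP.trans hK, hle, by rw [← sup_assoc, hs, hs'], fun S _ f f' => ?_⟩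
  obtain ⟨φ, hφ, hφ'⟩ := hu S f (f'.comp (Subgroup.inclusion le_sup_left))
  obtain ⟨χ, hχ, hχ'⟩ := hu' S φ (f'.comp (Subgroup.inclusion le_sup_right))
  refine ⟨χ, fun x h => by rw [hχ x (hP h), hφ x h], ?_⟩
  have := MonoidHom.eq_of_eq_on_sup le_sup_left le_sup_right rfl
    (χ.comp (Subgroup.inclusion hle)) f'
    (fun x h => (hχ x (hP' h)).trans (hφ' x h)) (fun x h => hχ' x h)
  exact fun x h => DFunLike.congr_fun this ⟨x, h⟩

theorem IsFreeFactorOf.map {G' : Type} [Group G'] {M B : Subgroup G} (h : IsFreeFactorOf M B)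
    (θ : G →* G') (hθ : Function.Injective θ) : IsFreeFactorOf (M.map θ) (B.map θ) := by
  rw [isFreeFactorOf_iff] at *
  obtain ⟨M', hM, hM', hs, hu⟩ := h
  refine ⟨M'.map θ, Subgroup.map_mono hM, Subgroup.map_mono hM', by rw [← Subgroup.map_sup, hs],
    fun S _ f f' => ?_⟩
  obtain ⟨φ, hφ, hφ'⟩ := hu S (f.comp (M.equivMapOfInjective θ hθ).toMonoidHom)
    (f'.comp (M'.equivMapOfInjective θ hθ).toMonoidHom)
  refine ⟨φ.comp (B.equivMapOfInjective θ hθ).symm.toMonoidHom, ?_, ?_⟩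
  · rintro _ ⟨x, hx, rfl⟩
    have : (B.equivMapOfInjective θ hθ).symm ⟨θ x, Subgroup.mem_map_of_mem θ (hM hx)⟩
        = ⟨x, hM hx⟩ := by
      rw [MulEquiv.symm_apply_eq]; rfl
    exact (congrArg φ this).trans (hφ x hx)
  · rintro _ ⟨x, hx, rfl⟩
    have : (B.equivMapOfInjective θ hθ).symm ⟨θ x, Subgroup.mem_map_of_mem θ (hM' hx)⟩
        = ⟨x, hM' hx⟩ := by
      rw [MulEquiv.symm_apply_eq]; rfl
    exact (congrArg φ this).trans (hφ' x hx)

theorem isFreeFactorOf_closure_basis {ι : Type} {B : Subgroup G} (b : FreeGroupBasis ι B)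
    (s : Set ι) : IsFreeFactorOf (Subgroup.closure ((fun i => (b i : G)) '' s)) B := by
  classical
  rw [isFreeFactorOf_iff]
  have hle : ∀ s : Set ι, Subgroup.closure ((fun i => (b i : G)) '' s) ≤ B := by
    intro s
    rw [Subgroup.closure_le]
    rintro _ ⟨i, -, rfl⟩
    exact (b i).2
  have key : ∀ (s : Set ι) (S : Type) [Group S]
      (f : Subgroup.closure ((fun i => (b i : G)) '' s) →* S) (φ : B →* S),
      (∀ i (hi : i ∈ s), φ (b i) = f ⟨b i, Subgroup.subset_closure ⟨i, hi, rfl⟩⟩) →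
      ∀ x (h : x ∈ Subgroup.closure ((fun i => (b i : G)) '' s)), φ ⟨x, hle s h⟩ = f ⟨x, h⟩ := by
    intro s S _ f φ hi x h
    induction h using Subgroup.closure_induction with
    | mem x hx =>
      obtain ⟨i, his, rfl⟩ := hx
      exact hi i his
    | one => exact (map_one φ).trans (map_one f).symm
    | mul x y hx hy hx' hy' =>
      have h₁ : (⟨x * y, hle s (mul_mem hx hy)⟩ : B) = ⟨x, hle s hx⟩ * ⟨y, hle s hy⟩ := rfl
      have h₂ : (⟨x * y, mul_mem hx hy⟩ : Subgroup.closure ((fun i => (b i : G)) '' s)) =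
        ⟨x, hx⟩ * ⟨y, hy⟩ := rfl
      rw [h₁, h₂, map_mul, map_mul, hx', hy']
    | inv x hx hx' =>
      have h₁ : (⟨x⁻¹, hle s (inv_mem hx)⟩ : B) = ⟨x, hle s hx⟩⁻¹ := rfl
      have h₂ : (⟨x⁻¹, inv_mem hx⟩ : Subgroup.closure ((fun i => (b i : G)) '' s)) =
        ⟨x, hx⟩⁻¹ := rfl
      rw [h₁, h₂, map_inv, map_inv, hx']
  refine ⟨Subgroup.closure ((fun i => (b i : G)) '' sᶜ), hle _, hle _, ?_, fun S _ f f' => ?_⟩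
  · rw [← Subgroup.closure_union, ← Set.image_union, Set.union_compl_self]
    refine le_antisymm (hle _) fun x hx => ?_
    have : ∀ w : FreeGroup ι, ((b.repr.symm w : B) : G) ∈
        Subgroup.closure ((fun i => (b i : G)) '' Set.univ) := by
      intro w
      induction w using FreeGroup.induction_on with
      | C1 => simp
      | of i => exact Subgroup.subset_closure ⟨i, trivial, rfl⟩
      | inv_of i h => simpa using h
      | mul x y hx hy => simpa using mul_mem hx hy
    simpa using this (b.repr ⟨x, hx⟩)
  · let φ : B →* S := b.lift fun i => if h : i ∈ s
      then f ⟨b i, Subgroup.subset_closure ⟨i, h, rfl⟩⟩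
      else f' ⟨b i, Subgroup.subset_closure ⟨i, h, rfl⟩⟩
    refine ⟨φ, key s S f φ fun i hi => ?_, key sᶜ S f' φ fun i hi => ?_⟩
    · simp [φ, hi]
    · have hi' : i ∉ s := hi
      simp [φ, hi']

end FreeFactor

section Rank

variable {G : Type} [Group G]

/-- The subgroup `K` is free of rank `k`. -/
def HasFreeRank (K : Subgroup G) (k : ℕ) : Prop :=
  Nonempty (FreeGroupBasis (Fin k) K)

theorem HasFreeRank.card_hom {K : Subgroup G} {k : ℕ} (h : HasFreeRank K k) (S : Type) [Group S] :
    Nat.card (K →* S) = Nat.card S ^ k := by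
  obtain ⟨b⟩ := h
  rw [← Nat.card_congr (b.lift (H := S)), Nat.card_fun, Nat.card_fin]

theorem HasFreeRank.finite_hom {K : Subgroup G} {k : ℕ} (h : HasFreeRank K k) (S : Type) [Group S]
    [Finite S] : Finite (K →* S) := by
  obtain ⟨b⟩ := h
  exact Finite.of_equiv _ (b.lift (H := S))

theorem exists_finite_subset_basis {ι : Type} {B : Subgroup G} (b : FreeGroupBasis ι B)
    {T : Set G} (hT : T.Finite) (hTB : T ⊆ B) :
    ∃ s : Set ι, s.Finite ∧ T ⊆ Subgroup.closure ((fun i => (b i : G)) '' s) := by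
  classical
  have mono : ∀ s t : Set ι, s ⊆ t → Subgroup.closure ((fun i => (b i : G)) '' s) ≤
      Subgroup.closure ((fun i => (b i : G)) '' t) :=
    fun s t h => Subgroup.closure_mono (Set.image_mono h)
  have key : ∀ w : FreeGroup ι, ∃ s : Set ι, s.Finite ∧ ((b.repr.symm w : B) : G) ∈
      Subgroup.closure ((fun i => (b i : G)) '' s) := by
    intro w
    induction w using FreeGroup.induction_on with
    | C1 => exact ⟨∅, Set.finite_empty, by simp⟩
    | of i => exact ⟨{i}, Set.finite_singleton i, Subgroup.subset_closure ⟨i, rfl, rfl⟩⟩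
    | inv_of i h => simpa using h
    | mul x y hx hy =>
      obtain ⟨s, hs, hs'⟩ := hx
      obtain ⟨t, ht, ht'⟩ := hy
      refine ⟨s ∪ t, hs.union ht, ?_⟩
      simpa using mul_mem (mono _ _ Set.subset_union_left hs')
        (mono _ _ Set.subset_union_right ht')
  have key' : ∀ x : G, ∃ s : Set ι, s.Finite ∧ (x ∈ B →
      x ∈ Subgroup.closure ((fun i => (b i : G)) '' s)) := by
    intro x
    by_cases hx : x ∈ B
    · obtain ⟨s, hs, h⟩ := key (b.repr ⟨x, hx⟩)
      exact ⟨s, hs, fun _ => by simpa using h⟩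
    · exact ⟨∅, Set.finite_empty, fun h => absurd h hx⟩
  choose s hs h using key'
  exact ⟨⋃ x ∈ T, s x, hT.biUnion fun x _ => hs x, fun x hx =>
    mono _ _ (Set.subset_biUnion_of_mem hx) (h x (hTB hx))⟩

theorem HasFreeRank.of_basis {ι : Type} {B : Subgroup G} (b : FreeGroupBasis ι B)
    (hB : B.FG) : Finite ι ∧ ∃ k, HasFreeRank B k := by
  classical
  obtain ⟨T, hT⟩ := hB
  obtain ⟨s, hs, hTs⟩ := exists_finite_subset_basis b T.finite_toSet
    (hT ▸ Subgroup.subset_closure)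
  have hBs : B ≤ Subgroup.closure ((fun i => (b i : G)) '' s) := by
    exact hT.ge.trans ((Subgroup.closure_le _).2 hTs)
  have hfin : Finite ι := by
    suffices s = Set.univ from Set.finite_univ_iff.1 (this ▸ hs)
    by_contra hne
    obtain ⟨i, hi⟩ := (Set.ne_univ_iff_exists_notMem s).1 hne
    let φ : B →* Multiplicative ℤ := b.lift fun j => if j = i then Multiplicative.ofAdd 1 else 1
    have hle : Subgroup.closure ((fun i => (b i : G)) '' s) ≤ φ.ker.map B.subtype := by
      rw [Subgroup.closure_le]
      rintro _ ⟨j, hj, rfl⟩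
      refine ⟨b j, ?_, rfl⟩
      have : j ≠ i := fun h => hi (h ▸ hj)
      simp [φ, MonoidHom.mem_ker, this]
    obtain ⟨y, hy, hyi⟩ := hle (hBs (b i).2)
    have : y = b i := Subtype.ext hyi
    subst this
    have h₁ : φ (b i) = 1 := hy
    simp [φ] at h₁
  refine ⟨hfin, ?_⟩
  have e := Finite.equivFin ι
  exact ⟨Nat.card ι, ⟨b.reindex e⟩⟩

theorem HasFreeRank.exists_of_fg [IsFreeGroup G] {K : Subgroup G} (hK : K.FG) :
    ∃ k, HasFreeRank K k :=
  (HasFreeRank.of_basis (IsFreeGroup.basis K) hK).2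

theorem closure_range_basis {ι : Type} {B : Subgroup G} (b : FreeGroupBasis ι B) :
    Subgroup.closure (Set.range fun i => (b i : G)) = B := by
  apply le_antisymm
  · rw [Subgroup.closure_le]
    rintro _ ⟨i, rfl⟩
    exact (b i).2
  · intro x hx
    obtain ⟨s, -, hs⟩ := exists_finite_subset_basis b (Set.finite_singleton x) (by simpa using hx)
    exact Subgroup.closure_mono (Set.image_subset_range _ _) (hs rfl)

theorem HasFreeRank.fg {K : Subgroup G} {k : ℕ} (h : HasFreeRank K k) : K.FG := by
  obtain ⟨b⟩ := h
  exact (Subgroup.fg_iff K).2 ⟨_, closure_range_basis b, Set.finite_range _⟩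

theorem MonoidHom.eq_of_eqOn_closure {S : Type} [Group S] {K : Subgroup G} {T : Set G}
    (hT : K = Subgroup.closure T) (φ ψ : K →* S)
    (h : ∀ x (hx : x ∈ K), x ∈ T → φ ⟨x, hx⟩ = ψ ⟨x, hx⟩) : φ = ψ := by
  have : Subgroup.closure T ≤ (φ.eqLocus ψ).map K.subtype := by
    rw [Subgroup.closure_le]
    intro x hx
    have hxK : x ∈ K := hT ▸ Subgroup.subset_closure hx
    exact ⟨⟨x, hxK⟩, h x hxK hx, rfl⟩
  ext ⟨x, hx⟩
  obtain ⟨y, hy, hyx⟩ := this (hT ▸ hx)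
  have : y = ⟨x, hx⟩ := Subtype.ext hyx
  exact this ▸ hy

theorem HasFreeRank.subgroupRank_eq {K : Subgroup G} {k : ℕ} (h : HasFreeRank K k) :
    subgroupRank K = k := by
  classical
  apply le_antisymm
  · obtain ⟨b⟩ := h
    let T : Finset G := Finset.univ.image fun i => (b i : G)
    have hT : Subgroup.closure (T : Set G) = K := by
      simpa [T] using closure_range_basis b
    refine (iInf_le _ (⟨T, hT⟩ : {S : Finset G // Subgroup.closure (S : Set G) = K})).trans ?_
    exact_mod_cast Finset.card_image_le.trans (by simp)
  · refine le_iInf fun ⟨T, hT⟩ => ?_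
    have hc := h.card_hom (Multiplicative (ZMod 2))
    have h₂ : Nat.card (Multiplicative (ZMod 2)) = 2 := by simp
    rw [h₂] at hc
    have hTK : ∀ x : T, (x : G) ∈ K := fun x => hT ▸ Subgroup.subset_closure x.2
    have hinj : Function.Injective
        (fun (φ : K →* Multiplicative (ZMod 2)) (x : T) => φ ⟨x, hTK x⟩) := by
      intro φ ψ hφ
      exact MonoidHom.eq_of_eqOn_closure hT.symm φ ψ fun x hx hxT => congrFun hφ ⟨x, hxT⟩
    have := Nat.card_le_card_of_injective _ hinj
    rw [hc, Nat.card_fun, h₂, Nat.card_eq_fintype_card, Fintype.card_coe] at this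
    exact_mod_cast (Nat.pow_le_pow_iff_right (by norm_num)).1 this

theorem HasFreeRank.eq_bot {K : Subgroup G} (h : HasFreeRank K 0) : K = ⊥ := by
  obtain ⟨b⟩ := h
  rw [← closure_range_basis b]
  simp

theorem IsFreeFactorOf.fg {M B : Subgroup G} (h : IsFreeFactorOf M B) (hB : B.FG) : M.FG := by
  rw [isFreeFactorOf_iff] at h
  obtain ⟨M', hM, hM', hs, hu⟩ := h
  obtain ⟨φ, h₁, -⟩ := hu M (MonoidHom.id M) 1
  have hφ : Function.Surjective φ := fun x => ⟨⟨x, hM x.2⟩, h₁ x x.2⟩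
  rw [← Group.fg_iff_subgroup_fg] at hB ⊢
  exact Group.fg_of_surjective hφ

theorem IsFreeFactorOf.rank [IsFreeGroup G] {M B : Subgroup G} (h : IsFreeFactorOf M B) {b : ℕ}
    (hB : HasFreeRank B b) : ∃ a, HasFreeRank M a ∧ a ≤ b ∧ (a = b → M = B) := by
  obtain ⟨a, ha⟩ := HasFreeRank.exists_of_fg (h.fg hB.fg)
  rw [isFreeFactorOf_iff] at h
  obtain ⟨M', hM, hM', hs, hu⟩ := h
  have hM'fg : M'.FG := by
    obtain ⟨φ, -, h₁⟩ := hu M' 1 (MonoidHom.id M')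
    have hφ : Function.Surjective φ := fun x => ⟨⟨x, hM' x.2⟩, h₁ x x.2⟩
    have hB := hB.fg
    rw [← Group.fg_iff_subgroup_fg] at hB ⊢
    exact Group.fg_of_surjective hφ
  obtain ⟨c, hc⟩ := HasFreeRank.exists_of_fg hM'fg
  let S := Multiplicative (ZMod 2)
  have h₂ : Nat.card S = 2 := by simp [S]
  have hbij : Function.Bijective (fun φ : B →* S =>
      ((φ.comp (Subgroup.inclusion hM), φ.comp (Subgroup.inclusion hM')) :
        (M →* S) × (M' →* S))) := by
    constructor
    · intro φ ψ hφ
      have h₁ := congrArg Prod.fst hφ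
      have h₂ := congrArg Prod.snd hφ
      exact MonoidHom.eq_of_eq_on_sup hM hM' hs φ ψ
        (fun x h => DFunLike.congr_fun h₁ ⟨x, h⟩) (fun x h => DFunLike.congr_fun h₂ ⟨x, h⟩)
    · rintro ⟨f, f'⟩
      obtain ⟨φ, h₁, h₂⟩ := hu S f f'
      exact ⟨φ, Prod.ext (MonoidHom.ext fun x => h₁ x x.2) (MonoidHom.ext fun x => h₂ x x.2)⟩
  have hcard := Nat.card_eq_of_bijective _ hbij
  rw [Nat.card_prod, hB.card_hom, ha.card_hom, hc.card_hom, h₂, ← pow_add] at hcard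
  have hbac : b = a + c := Nat.pow_right_injective le_rfl hcard
  refine ⟨a, ha, by omega, fun hab => ?_⟩
  obtain rfl : c = 0 := by omega
  rw [hc.eq_bot, sup_bot_eq] at hs
  exact hs

theorem IsAlgebraicExtensionOf.fg [IsFreeGroup G] {H B : Subgroup G} (hH : H.FG)
    (h : IsAlgebraicExtensionOf H B) : B.FG := by
  obtain ⟨T, hT⟩ := hH
  let b := IsFreeGroup.basis B
  obtain ⟨s, hs, hTs⟩ := exists_finite_subset_basis b T.finite_toSet
    ((hT ▸ Subgroup.subset_closure : (T : Set G) ⊆ H).trans h.1)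
  have hle : H ≤ Subgroup.closure ((fun i => (b i : G)) '' s) := by
    rw [← hT, Subgroup.closure_le]
    exact hTs
  have := h.2 _ hle (isFreeFactorOf_closure_basis b s)
  exact (Subgroup.fg_iff B).2 ⟨_, this, hs.image _⟩

theorem exists_algebraic_hull [IsFreeGroup G] {H J : Subgroup G} (hJ : J.FG) (hHJ : H ≤ J) :
    ∃ A, IsAlgebraicExtensionOf H A ∧ IsFreeFactorOf A J := by
  classical
  have hex : ∃ a A, HasFreeRank A a ∧ H ≤ A ∧ IsFreeFactorOf A J := by
    obtain ⟨k, hk⟩ := HasFreeRank.exists_of_fg hJ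
    exact ⟨k, J, hk, hHJ, IsFreeFactorOf.refl J⟩
  obtain ⟨A, hA, hHA, hAJ⟩ := Nat.find_spec hex
  refine ⟨A, ⟨hHA, fun L hHL hLA => ?_⟩, hAJ⟩
  obtain ⟨a, ha, hle, heq⟩ := hLA.rank hA
  exact heq (le_antisymm hle (Nat.find_min' hex ⟨L, ha, hHL, hLA.trans hAJ⟩))

end Rank

section RootedGraph

variable {α : Type}

/-- A finite connected subgraph of the Cayley graph of `FreeGroup α` containing the identity:
`W` is the vertex set, and `(u, x) ∈ E` stands for the edge from `u` to `x * u`. -/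
structure IsRootedGraph (W : Set (FreeGroup α)) (E : Set (FreeGroup α × α)) : Prop where
  finite_vertices : W.Finite
  finite_edges : E.Finite
  one_mem : 1 ∈ W
  source_mem : ∀ e ∈ E, e.1 ∈ W
  target_mem : ∀ e ∈ E, FreeGroup.of e.2 * e.1 ∈ W
  induction : ∀ p : FreeGroup α → Prop, p 1 →
    (∀ e ∈ E, (p e.1 ↔ p (FreeGroup.of e.2 * e.1))) → ∀ u ∈ W, p u

theorem IsRootedGraph.singleton : IsRootedGraph ({1} : Set (FreeGroup α)) ∅ where
  finite_vertices := Set.finite_singleton _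
  finite_edges := Set.finite_empty
  one_mem := rfl
  source_mem := by simp
  target_mem := by simp
  induction := by
    rintro p hp - u rfl
    exact hp

/-- `GraphStep` adds one edge, at least one of whose endpoints is already present. -/
inductive GraphStep : Set (FreeGroup α) × Set (FreeGroup α × α) →
    Set (FreeGroup α) × Set (FreeGroup α × α) → Prop
  | add_edge (W : Set (FreeGroup α)) (E : Set (FreeGroup α × α)) (e : FreeGroup α × α)
      (he : e.1 ∈ W ∨ FreeGroup.of e.2 * e.1 ∈ W) :
      GraphStep (W, E) (insert e.1 (insert (FreeGroup.of e.2 * e.1) W), insert e E)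

theorem GraphStep.isRootedGraph {Γ Γ' : Set (FreeGroup α) × Set (FreeGroup α × α)}
    (h : GraphStep Γ Γ') (hΓ : IsRootedGraph Γ.1 Γ.2) : IsRootedGraph Γ'.1 Γ'.2 := by
  obtain ⟨W, E, e, he⟩ := h
  refine ⟨(hΓ.finite_vertices.insert _).insert _, hΓ.finite_edges.insert _,
    Or.inr (Or.inr hΓ.one_mem), ?_, ?_, fun p hp hE => ?_⟩
  · rintro e' (rfl | he')
    · exact Or.inl rfl
    · exact Or.inr (Or.inr (hΓ.source_mem e' he'))
  · rintro e' (rfl | he')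
    · exact Or.inr (Or.inl rfl)
    · exact Or.inr (Or.inr (hΓ.target_mem e' he'))
  · have hW : ∀ u ∈ W, p u := hΓ.induction p hp fun e he => hE e (Or.inr he)
    have h₁ := hE e (Or.inl rfl)
    rintro u (rfl | rfl | hu)
    · exact he.elim (hW _) fun h => h₁.2 (hW _ h)
    · exact he.elim (fun h => h₁.1 (hW _ h)) (hW _)
    · exact hW u hu

theorem GraphStep.subset {Γ Γ' : Set (FreeGroup α) × Set (FreeGroup α × α)}
    (h : GraphStep Γ Γ') : Γ.1 ⊆ Γ'.1 := by
  obtain ⟨W, E, e, he⟩ := h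
  exact (Set.subset_insert _ _).trans (Set.subset_insert _ _)

open Relation in
theorem graphSteps_isRootedGraph {Γ Γ' : Set (FreeGroup α) × Set (FreeGroup α × α)}
    (h : ReflTransGen GraphStep Γ Γ') (hΓ : IsRootedGraph Γ.1 Γ.2) :
    IsRootedGraph Γ'.1 Γ'.2 := by
  induction h with
  | refl => exact hΓ
  | tail _ h ih => exact h.isRootedGraph ih

open Relation in
theorem graphSteps_subset {Γ Γ' : Set (FreeGroup α) × Set (FreeGroup α × α)}
    (h : ReflTransGen GraphStep Γ Γ') : Γ.1 ⊆ Γ'.1 := by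
  induction h with
  | refl => exact subset_rfl
  | tail _ h ih => exact ih.trans h.subset

open Relation in
theorem exists_graphSteps_mul_mem (w : FreeGroup α) :
    ∀ (Γ : Set (FreeGroup α) × Set (FreeGroup α × α)) (u : FreeGroup α), u ∈ Γ.1 →
      ∃ Γ', ReflTransGen GraphStep Γ Γ' ∧ w * u ∈ Γ'.1 := by
  induction w using FreeGroup.induction_on with
  | C1 => exact fun Γ u hu => ⟨Γ, .refl, by simpa using hu⟩
  | of x =>
    intro Γ u hu
    exact ⟨_, .single (.add_edge Γ.1 Γ.2 (u, x) (Or.inl hu)), Or.inr (Or.inl rfl)⟩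
  | inv_of x _ =>
    intro Γ u hu
    exact ⟨_, .single (.add_edge Γ.1 Γ.2 ((FreeGroup.of x)⁻¹ * u, x) (Or.inr (by simpa using hu))),
      Or.inl rfl⟩
  | mul x y hx hy =>
    intro Γ u hu
    obtain ⟨Γ₁, h₁, hu₁⟩ := hy Γ u hu
    obtain ⟨Γ₂, h₂, hu₂⟩ := hx Γ₁ _ hu₁
    exact ⟨Γ₂, h₁.trans h₂, by rwa [mul_assoc]⟩

open Relation in
theorem exists_graphSteps_subset {T : Set (FreeGroup α)} (hT : T.Finite)
    (Γ : Set (FreeGroup α) × Set (FreeGroup α × α)) (hΓ : 1 ∈ Γ.1) :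
    ∃ Γ', ReflTransGen GraphStep Γ Γ' ∧ T ⊆ Γ'.1 := by
  induction T, hT using Set.Finite.induction_on with
  | empty => exact ⟨Γ, .refl, Set.empty_subset _⟩
  | insert _ _ ih =>
    obtain ⟨Γ₁, h₁, hT₁⟩ := ih
    obtain ⟨Γ₂, h₂, hu⟩ := exists_graphSteps_mul_mem _ Γ₁ 1 (graphSteps_subset h₁ hΓ)
    refine ⟨Γ₂, h₁.trans h₂, Set.insert_subset (by rwa [mul_one] at hu)
      (hT₁.trans (graphSteps_subset h₂))⟩

/-- Free groups are residually finite. -/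
theorem FreeGroup.exists_hom_perm_ne_one {w : FreeGroup α} (hw : w ≠ 1) :
    ∃ (X : Type) (_ : Finite X) (φ : FreeGroup α →* Equiv.Perm X), φ w ≠ 1 := by
  classical
  obtain ⟨⟨W, E⟩, hΓ, hwW⟩ := exists_graphSteps_subset (Set.finite_singleton w)
    (({1} : Set (FreeGroup α)), (∅ : Set (FreeGroup α × α))) rfl
  have hW := graphSteps_isRootedGraph hΓ IsRootedGraph.singleton
  have := hW.finite_vertices.fintype
  let e : ∀ x : α, {u : W // FreeGroup.of x * u ∈ W} ≃ {u : W // (FreeGroup.of x)⁻¹ * u ∈ W} :=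
    fun x =>
    { toFun := fun u => ⟨⟨_, u.2⟩, by simp⟩
      invFun := fun u => ⟨⟨_, u.2⟩, by simp⟩
      left_inv := fun u => by simp
      right_inv := fun u => by simp }
  let φ : FreeGroup α →* Equiv.Perm W := FreeGroup.lift fun x => (e x).extendSubtype
  have key : ∀ u ∈ W, ((φ u ⟨1, hW.one_mem⟩ : W) : FreeGroup α) = u := by
    refine hW.induction _ (by simp) fun a ha => ?_
    have hs := hW.source_mem a ha
    have ht := hW.target_mem a ha
    have hφ : φ (FreeGroup.of a.2) ⟨a.1, hs⟩ = ⟨FreeGroup.of a.2 * a.1, ht⟩ := by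
      have := (e a.2).extendSubtype_apply_of_mem ⟨a.1, hs⟩ ht
      simpa [φ, e] using this
    rw [_root_.map_mul, Equiv.Perm.mul_apply]
    constructor
    · intro h
      rw [show φ a.1 ⟨1, hW.one_mem⟩ = ⟨a.1, hs⟩ from Subtype.ext h, hφ]
    · intro h
      have h' : φ (FreeGroup.of a.2) (φ a.1 ⟨1, hW.one_mem⟩) = ⟨FreeGroup.of a.2 * a.1, ht⟩ :=
        Subtype.ext h
      rw [← hφ] at h'
      rw [(φ (FreeGroup.of a.2)).injective h']
  refine ⟨W, inferInstance, φ, fun h => hw ?_⟩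
  have := key w (hwW rfl)
  rw [h] at this
  exact this.symm

end RootedGraph

section Hopf

variable {G : Type} [Group G]

theorem FreeGroupBasis.injective_of_surjective {X : Type} [Finite X] {n : ℕ}
    (b : FreeGroupBasis (Fin n) G) (hn : Nat.card X = n) (θ : FreeGroup X →* G)
    (hθ : Function.Surjective θ) : Function.Injective θ := by
  rw [injective_iff_map_eq_one]
  intro w hw
  by_contra hne
  obtain ⟨Y, _, φ, hφ⟩ := FreeGroup.exists_hom_perm_ne_one hne
  have hinj : Function.Injective (fun χ : G →* Equiv.Perm Y => χ.comp θ) :=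
    fun χ χ' h => (MonoidHom.cancel_right hθ).1 h
  have hfin : Finite (FreeGroup X →* Equiv.Perm Y) :=
    Finite.of_equiv (X → Equiv.Perm Y) FreeGroup.lift
  have hcard : Nat.card (G →* Equiv.Perm Y) = Nat.card (FreeGroup X →* Equiv.Perm Y) := by
    rw [← Nat.card_congr (b.lift (H := Equiv.Perm Y)),
      ← Nat.card_congr (FreeGroup.lift (α := X) (β := Equiv.Perm Y)), Nat.card_fun, Nat.card_fun,
      hn, Nat.card_fin]
  have hsurj := (Nat.bijective_iff_injective_and_card _).2 ⟨hinj, hcard⟩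
  obtain ⟨χ, rfl⟩ := hsurj.2 φ
  exact hφ (by simp [hw])

theorem HasFreeRank.rank_sup_closure {P Q : Subgroup G} {p q : ℕ} (hP : HasFreeRank P p)
    (hQ : HasFreeRank Q q) {k : ℕ} (s : Fin k → G)
    (hs : Q = P ⊔ Subgroup.closure (Set.range s)) :
    q ≤ p + k ∧ (q = p + k → IsFreeFactorOf P Q) := by
  obtain ⟨b⟩ := hP
  have hPQ : P ≤ Q := hs ▸ le_sup_left
  have hsQ : Subgroup.closure (Set.range s) ≤ Q := by
    conv_rhs => rw [hs]
    exact le_sup_right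
  have hsc : ∀ i, s i ∈ Subgroup.closure (Set.range s) :=
    fun i => Subgroup.subset_closure ⟨i, rfl⟩
  let t : Fin p ⊕ Fin k → Q := Sum.elim (fun i => ⟨b i, hPQ (b i).2⟩) fun i => ⟨s i, hsQ (hsc i)⟩
  have hext : ∀ (S : Type) [Group S] (φ ψ : Q →* S), (∀ i, φ (t i) = ψ (t i)) → φ = ψ := by
    intro S _ φ ψ h
    refine MonoidHom.eq_of_eq_on_sup hPQ hsQ hs.symm φ ψ ?_ ?_
    · have := MonoidHom.eq_of_eqOn_closure (closure_range_basis b).symm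
        (φ.comp (Subgroup.inclusion hPQ)) (ψ.comp (Subgroup.inclusion hPQ)) (by
          rintro _ hx ⟨i, rfl⟩
          exact h (.inl i))
      exact fun x hx => DFunLike.congr_fun this ⟨x, hx⟩
    · have := MonoidHom.eq_of_eqOn_closure rfl
        (φ.comp (Subgroup.inclusion hsQ)) (ψ.comp (Subgroup.inclusion hsQ)) (by
          rintro _ hx ⟨i, rfl⟩
          exact h (.inr i))
      exact fun x hx => DFunLike.congr_fun this ⟨x, hx⟩
  constructor
  · have hinj : Function.Injective (fun (φ : Q →* Multiplicative (ZMod 2)) i => φ (t i)) :=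
      fun φ ψ h => hext _ φ ψ (congrFun h)
    have h₂ : Nat.card (Multiplicative (ZMod 2)) = 2 := by simp
    have := Nat.card_le_card_of_injective _ hinj
    rw [hQ.card_hom, Nat.card_fun, h₂, Nat.card_sum, Nat.card_fin, Nat.card_fin] at this
    exact (Nat.pow_le_pow_iff_right (by norm_num)).1 this
  · intro hq
    obtain ⟨c⟩ := hQ
    let θ : FreeGroup (Fin p ⊕ Fin k) →* Q := FreeGroup.lift t
    have hθs : Function.Surjective θ := by
      have hle : P ⊔ Subgroup.closure (Set.range s) ≤ θ.range.map Q.subtype := by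
        refine sup_le ?_ ?_
        · conv_lhs => rw [← closure_range_basis b]
          rw [Subgroup.closure_le]
          rintro _ ⟨i, rfl⟩
          exact ⟨t (.inl i), ⟨FreeGroup.of (.inl i), by simp [θ]⟩, rfl⟩
        · rw [Subgroup.closure_le]
          rintro _ ⟨i, rfl⟩
          exact ⟨t (.inr i), ⟨FreeGroup.of (.inr i), by simp [θ]⟩, rfl⟩
      rintro ⟨x, hx⟩
      obtain ⟨y, ⟨w, rfl⟩, hy⟩ := hle (hs ▸ hx)
      exact ⟨w, Subtype.ext hy⟩
    have hθ : Function.Bijective θ :=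
      ⟨c.injective_of_surjective (by simp [hq]) θ hθs, hθs⟩
    rw [isFreeFactorOf_iff]
    refine ⟨Subgroup.closure (Set.range s), hPQ, hsQ, hs.symm, fun S _ f f' => ?_⟩
    let e := MulEquiv.ofBijective θ hθ
    let φ : Q →* S := (FreeGroup.lift (Sum.elim (fun i => f (b i))
      fun i => f' ⟨s i, hsc i⟩)).comp e.symm.toMonoidHom
    have he : ∀ i, e.symm (t i) = FreeGroup.of i := by
      intro i
      rw [MulEquiv.symm_apply_eq]
      simp [e, θ]
    refine ⟨φ, ?_, ?_⟩
    · have := MonoidHom.eq_of_eqOn_closure (closure_range_basis b).symm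
        (φ.comp (Subgroup.inclusion hPQ)) f (by
          rintro _ hx ⟨i, rfl⟩
          have : φ (t (.inl i)) = f (b i) := by simp [φ, he]
          exact this)
      exact fun x hx => DFunLike.congr_fun this ⟨x, hx⟩
    · have := MonoidHom.eq_of_eqOn_closure rfl
        (φ.comp (Subgroup.inclusion hsQ)) f' (by
          rintro _ hx ⟨i, rfl⟩
          have : φ (t (.inr i)) = f' ⟨s i, hsc i⟩ := by simp [φ, he]
          exact this)
      exact fun x hx => DFunLike.congr_fun this ⟨x, hx⟩

end Hopf

section Transport

variable {α : Type}

/-- The subgroup generated by the elements of `Q` of the form `u⁻¹ * v` with `u v ∈ W`. -/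
def spannedBy (W : Set (FreeGroup α)) (Q : Subgroup (FreeGroup α)) : Subgroup (FreeGroup α) :=
  Subgroup.closure {g | g ∈ Q ∧ ∃ u ∈ W, ∃ v ∈ W, g = u⁻¹ * v}

/-- The image of the vertex set `W` in the Schreier graph of `Q`. -/
def vertexImage (W : Set (FreeGroup α)) (Q : Subgroup (FreeGroup α)) : Set (FreeGroup α ⧸ Q) :=
  (fun u : FreeGroup α => (u : FreeGroup α ⧸ Q)) '' W

/-- The image of the edge set `E` in the Schreier graph of `Q`. -/
def edgeImage (E : Set (FreeGroup α × α)) (Q : Subgroup (FreeGroup α)) :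
    Set ((FreeGroup α ⧸ Q) × α) :=
  (fun e : FreeGroup α × α => ((e.1 : FreeGroup α ⧸ Q), e.2)) '' E

theorem spannedBy_le (W : Set (FreeGroup α)) (Q : Subgroup (FreeGroup α)) : spannedBy W Q ≤ Q :=
  (Subgroup.closure_le _).2 fun _ h => h.1

theorem exists_transport {S : Type} [Group S] (Q : Subgroup (FreeGroup α))
    (τ : FreeGroup α ⧸ Q → α → S) : ∃ T : FreeGroup α → S, T 1 = 1 ∧
      (∀ (x : α) (u : FreeGroup α),
        T (FreeGroup.of x * u) = τ (u : FreeGroup α ⧸ Q) x * T u) ∧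
      ∀ u, ∀ q ∈ Q, T (u * q) = T u * T q := by
  let a : α → Equiv.Perm ((FreeGroup α ⧸ Q) × S) := fun x =>
    { toFun := fun z => (FreeGroup.of x • z.1, τ z.1 x * z.2)
      invFun := fun z => ((FreeGroup.of x)⁻¹ • z.1, (τ ((FreeGroup.of x)⁻¹ • z.1) x)⁻¹ * z.2)
      left_inv := fun z => by simp
      right_inv := fun z => by simp }
  let φ := FreeGroup.lift a
  have hof : ∀ x z, φ (FreeGroup.of x) z = (FreeGroup.of x • z.1, τ z.1 x * z.2) := by
    intro x z
    simp [φ, a]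
  have hfst : ∀ g z, (φ g z).1 = g • z.1 := by
    intro g
    induction g using FreeGroup.induction_on with
    | C1 => simp
    | of x => intro z; rw [hof]
    | inv_of x h =>
      intro z
      rw [eq_inv_smul_iff, ← h, map_inv, ← Equiv.Perm.mul_apply, mul_inv_cancel, Equiv.Perm.one_apply]
    | mul x y hx hy =>
      intro z
      rw [map_mul, Equiv.Perm.mul_apply, hx, hy, mul_smul]
  have hsnd : ∀ g p s, (φ g (p, s)).2 = (φ g (p, 1)).2 * s := by
    intro g
    induction g using FreeGroup.induction_on with
    | C1 => simp
    | of x => intro p s; simp [hof]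
    | inv_of x _ =>
      intro p s
      have : φ (FreeGroup.of x)⁻¹ = (a x)⁻¹ := by simp [φ]
      rw [this]
      simp [a, Equiv.Perm.inv_def]
    | mul x y hx hy =>
      intro p s
      rw [map_mul, Equiv.Perm.mul_apply, Equiv.Perm.mul_apply]
      have h₁ := hx (φ y (p, s)).1 (φ y (p, s)).2
      have h₂ := hx (φ y (p, 1)).1 (φ y (p, 1)).2
      have h₃ : (φ y (p, s)).1 = (φ y (p, 1)).1 := by rw [hfst, hfst]
      rw [Prod.mk.eta] at h₁ h₂
      rw [h₁, h₂, h₃, hy p s, mul_assoc]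
  refine ⟨fun g => (φ g (((1 : FreeGroup α) : FreeGroup α ⧸ Q), 1)).2, by simp, ?_, ?_⟩
  · intro x u
    simp only [map_mul, Equiv.Perm.mul_apply, hof, hfst]
    simp
  · intro u q hq
    simp only [map_mul, Equiv.Perm.mul_apply]
    have h₁ : (φ q (((1 : FreeGroup α) : FreeGroup α ⧸ Q), 1)).1 =
        ((1 : FreeGroup α) : FreeGroup α ⧸ Q) := by
      rw [hfst]
      simpa [QuotientGroup.eq] using hq
    have h₂ := hsnd u (φ q (((1 : FreeGroup α) : FreeGroup α ⧸ Q), 1)).1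
      (φ q (((1 : FreeGroup α) : FreeGroup α ⧸ Q), 1)).2
    rw [Prod.mk.eta, h₁] at h₂
    exact h₂

variable {S : Type} [Group S]

open Classical in
/-- A labelling of the edges in the image of `E`, extended trivially to the Schreier graph. -/
noncomputable def extendLabelling {E : Set (FreeGroup α × α)} {Q : Subgroup (FreeGroup α)}
    (σ : edgeImage E Q → S) (p : FreeGroup α ⧸ Q) (x : α) : S :=
  if h : (p, x) ∈ edgeImage E Q then σ ⟨(p, x), h⟩ else 1

/-- Parallel transport along the path from the base point labelled by a group element. -/
noncomputable def transport {E : Set (FreeGroup α × α)} {Q : Subgroup (FreeGroup α)}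
    (σ : edgeImage E Q → S) : FreeGroup α → S :=
  (exists_transport Q (extendLabelling σ)).choose

variable {E : Set (FreeGroup α × α)} {Q : Subgroup (FreeGroup α)} {W : Set (FreeGroup α)}

@[simp] theorem transport_one (σ : edgeImage E Q → S) : transport σ 1 = 1 :=
  (exists_transport Q (extendLabelling σ)).choose_spec.1

theorem transport_of_mul (σ : edgeImage E Q → S) {x : α} {u : FreeGroup α}
    (h : ((u : FreeGroup α ⧸ Q), x) ∈ edgeImage E Q) :
    transport σ (FreeGroup.of x * u) = σ ⟨((u : FreeGroup α ⧸ Q), x), h⟩ * transport σ u := by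
  have := (exists_transport Q (extendLabelling σ)).choose_spec.2.1 x u
  rwa [extendLabelling, dif_pos h] at this

theorem transport_mul (σ : edgeImage E Q → S) (u : FreeGroup α) {q : FreeGroup α} (hq : q ∈ Q) :
    transport σ (u * q) = transport σ u * transport σ q :=
  (exists_transport Q (extendLabelling σ)).choose_spec.2.2 u q hq

theorem transport_inv_mul (σ : edgeImage E Q → S) {u v : FreeGroup α} (h : u⁻¹ * v ∈ Q) :
    transport σ (u⁻¹ * v) = (transport σ u)⁻¹ * transport σ v := by
  rw [eq_inv_mul_iff_mul_eq, ← transport_mul σ u h, mul_inv_cancel_left]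

/-- The holonomy homomorphism of an edge labelling, conjugated by `s`. -/
noncomputable def holonomy (σ : edgeImage E Q → S) (s : S) : Q →* S where
  toFun q := s * transport σ q * s⁻¹
  map_one' := by simp
  map_mul' a b := by simp [transport_mul σ a b.2]

open Classical in
/-- A representative of a coset, in `W` whenever possible and trivial for the trivial coset. -/
noncomputable def cosetRep (W : Set (FreeGroup α)) (p : FreeGroup α ⧸ Q) : FreeGroup α :=
  if p = ((1 : FreeGroup α) : FreeGroup α ⧸ Q) then 1
  else if h : p ∈ vertexImage W Q then h.choose else p.out

theorem mk_cosetRep (p : FreeGroup α ⧸ Q) : ((cosetRep W p : FreeGroup α) : FreeGroup α ⧸ Q) = p := by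
  unfold cosetRep
  split_ifs with h h'
  · exact h.symm
  · exact h'.choose_spec.2
  · exact Quotient.out_eq' p

theorem cosetRep_one : cosetRep W ((1 : FreeGroup α) : FreeGroup α ⧸ Q) = 1 := by
  simp [cosetRep]

theorem cosetRep_mem (h1 : 1 ∈ W) {p : FreeGroup α ⧸ Q} (hp : p ∈ vertexImage W Q) :
    cosetRep W p ∈ W := by
  unfold cosetRep
  split_ifs with h
  · exact h1
  · exact hp.choose_spec.1

theorem IsRootedGraph.bijective_holonomy (hΓ : IsRootedGraph W E) (hQ : spannedBy W Q = Q) :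
    Function.Bijective (fun z : (edgeImage E Q → S) × S =>
      ((holonomy z.1 z.2, fun p => z.2 * (transport z.1 (cosetRep W p.1))⁻¹) :
        (Q →* S) × (vertexImage W Q → S))) := by
  constructor
  · rintro ⟨σ, s⟩ ⟨σ', s'⟩ h
    have hp : ∀ p ∈ vertexImage W Q, s * (transport σ (cosetRep W p))⁻¹ =
        s' * (transport σ' (cosetRep W p))⁻¹ :=
      fun p hp => congrFun (congrArg Prod.snd h) ⟨p, hp⟩
    have hs : s = s' := by
      have := hp _ ⟨1, hΓ.one_mem, rfl⟩
      simpa [cosetRep_one] using this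
    subst hs
    have hq : ∀ q ∈ Q, transport σ q = transport σ' q := by
      intro q hq
      have := DFunLike.congr_fun (congrArg Prod.fst h) ⟨q, hq⟩
      simpa [holonomy] using this
    have hp : ∀ p ∈ vertexImage W Q, transport σ (cosetRep W p) =
        transport σ' (cosetRep W p) := fun p h => by simpa using hp p h
    refine Prod.ext (funext ?_) rfl
    rintro ⟨_, ⟨u, x⟩, he, rfl⟩
    set p : FreeGroup α ⧸ Q := QuotientGroup.mk u
    have hpV : p ∈ vertexImage W Q := ⟨u, hΓ.source_mem _ he, rfl⟩
    have hE : (((cosetRep W p : FreeGroup α) : FreeGroup α ⧸ Q), x) ∈ edgeImage E Q := by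
      rw [mk_cosetRep]
      exact ⟨_, he, rfl⟩
    let p' : FreeGroup α ⧸ Q := ((FreeGroup.of x * u : FreeGroup α) : FreeGroup α ⧸ Q)
    have hpV' : p' ∈ vertexImage W Q := ⟨_, hΓ.target_mem _ he, rfl⟩
    have hpp' : (cosetRep W p')⁻¹ * (FreeGroup.of x * cosetRep W p) ∈ Q := by
      rw [← QuotientGroup.eq, mk_cosetRep]
      have h₁ : u⁻¹ * cosetRep W p ∈ Q := by
        rw [← QuotientGroup.eq, mk_cosetRep]
      rw [QuotientGroup.eq]
      simpa [mul_assoc] using h₁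
    have key : ∀ σ : edgeImage E Q → S, σ ⟨(p, x), ⟨(u, x), he, rfl⟩⟩ * transport σ (cosetRep W p) =
        transport σ (cosetRep W p') *
          transport σ ((cosetRep W p')⁻¹ * (FreeGroup.of x * cosetRep W p)) := by
      intro σ
      rw [← transport_mul σ _ hpp', mul_inv_cancel_left, transport_of_mul σ hE]
      congr 3
      simp [mk_cosetRep]
    have h₁ := key σ
    rw [hp _ hpV, hp _ hpV', hq _ hpp', ← key σ'] at h₁
    exact mul_right_cancel h₁
  · classical
    rintro ⟨ψ, g⟩
    let g' : FreeGroup α ⧸ Q → S := fun p => if h : p ∈ vertexImage W Q then g ⟨p, h⟩ else 1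
    have hmem : ∀ u : FreeGroup α, (cosetRep W (u : FreeGroup α ⧸ Q))⁻¹ * u ∈ Q := by
      intro u
      rw [← QuotientGroup.eq, mk_cosetRep]
    let Ψ : FreeGroup α → S := fun q => if h : q ∈ Q then ψ ⟨q, h⟩ else 1
    have hΨ : ∀ q (h : q ∈ Q), Ψ q = ψ ⟨q, h⟩ := fun q h => dif_pos h
    have hΨ1 : Ψ 1 = 1 := by
      rw [hΨ 1 Q.one_mem]
      exact map_one ψ
    have hΨm : ∀ a ∈ Q, ∀ b ∈ Q, Ψ (a * b) = Ψ a * Ψ b := by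
      intro a ha b hb
      rw [hΨ a ha, hΨ b hb, hΨ _ (Q.mul_mem ha hb), ← map_mul]
      rfl
    let o : FreeGroup α ⧸ Q := ((1 : FreeGroup α) : FreeGroup α ⧸ Q)
    let L : FreeGroup α → S := fun u =>
      (g' (u : FreeGroup α ⧸ Q))⁻¹ * Ψ ((cosetRep W (u : FreeGroup α ⧸ Q))⁻¹ * u) * g' o
    let σ : edgeImage E Q → S := fun e =>
      L (FreeGroup.of e.1.2 * cosetRep W e.1.1) * (L (cosetRep W e.1.1))⁻¹
    have hL : ∀ (x : α) (u : FreeGroup α), L (FreeGroup.of x * u) =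
        L (FreeGroup.of x * cosetRep W (u : FreeGroup α ⧸ Q)) *
          (L (cosetRep W (u : FreeGroup α ⧸ Q)))⁻¹ * L u := by
      intro x u
      have h₁ : ((FreeGroup.of x * u : FreeGroup α) : FreeGroup α ⧸ Q) =
          ((FreeGroup.of x * cosetRep W (u : FreeGroup α ⧸ Q) : FreeGroup α) :
            FreeGroup α ⧸ Q) := by
        have := hmem u
        rw [QuotientGroup.eq]
        rw [← Subgroup.inv_mem_iff] at this
        simpa [mul_assoc] using this
      have h₂ : ((cosetRep W (u : FreeGroup α ⧸ Q) : FreeGroup α) : FreeGroup α ⧸ Q) =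
        (u : FreeGroup α ⧸ Q) := mk_cosetRep _
      have h₃ := hΨm _ (hmem (FreeGroup.of x * cosetRep W (u : FreeGroup α ⧸ Q))) _ (hmem u)
      rw [← h₁, mul_assoc, mul_assoc, mul_inv_cancel_left] at h₃
      simp only [L, h₃, h₂, ← h₁, inv_mul_cancel, hΨ1]
      group
    have hT : ∀ u ∈ W, transport σ u = L u := by
      refine hΓ.induction _ ?_ ?_
      · simp [L, o, cosetRep_one, hΨ1]
      · rintro ⟨u, x⟩ he
        have hE : ((u : FreeGroup α ⧸ Q), x) ∈ edgeImage E Q := ⟨_, he, rfl⟩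
        rw [transport_of_mul σ hE, hL x u]
        exact (mul_right_inj _).symm
    refine ⟨(σ, g' o), Prod.ext ?_ (funext ?_)⟩
    · refine MonoidHom.eq_of_eqOn_closure hQ.symm _ _ ?_
      rintro _ hx ⟨-, u, hu, v, hv, rfl⟩
      have huv : (v : FreeGroup α ⧸ Q) = (u : FreeGroup α ⧸ Q) := by
        rw [eq_comm, QuotientGroup.eq]
        exact hx
      have h₁ := hΨm _ (hmem u) _ hx
      rw [mul_assoc, mul_inv_cancel_left] at h₁
      have h₂ : holonomy σ (g' o) ⟨u⁻¹ * v, hx⟩ =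
          g' o * transport σ (u⁻¹ * v) * (g' o)⁻¹ := rfl
      change holonomy σ (g' o) ⟨u⁻¹ * v, hx⟩ = ψ ⟨u⁻¹ * v, hx⟩
      rw [h₂, transport_inv_mul σ hx, hT u hu, hT v hv, ← hΨ]
      simp only [L, h₁, huv]
      group
    · rintro ⟨p, hp⟩
      have h₁ := hT _ (cosetRep_mem hΓ.one_mem hp)
      simp only [h₁, L, mk_cosetRep, inv_mul_cancel, hΨ1]
      have h₂ : g' p = g ⟨p, hp⟩ := dif_pos hp
      rw [← h₂]
      group

theorem IsRootedGraph.finite_vertexImage (hΓ : IsRootedGraph W E) (Q : Subgroup (FreeGroup α)) :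
    Finite (vertexImage W Q) :=
  (hΓ.finite_vertices.image _).to_subtype

theorem IsRootedGraph.finite_edgeImage (hΓ : IsRootedGraph W E) (Q : Subgroup (FreeGroup α)) :
    Finite (edgeImage E Q) :=
  (hΓ.finite_edges.image _).to_subtype

theorem IsRootedGraph.card_hom_mul (hΓ : IsRootedGraph W E) (hQ : spannedBy W Q = Q) :
    Nat.card (Q →* S) * Nat.card S ^ Nat.card (vertexImage W Q) =
      Nat.card S ^ Nat.card (edgeImage E Q) * Nat.card S := by
  have := hΓ.finite_vertexImage Q
  have := hΓ.finite_edgeImage Q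
  have h := Nat.card_eq_of_bijective _ (hΓ.bijective_holonomy (S := S) hQ)
  rw [Nat.card_prod, Nat.card_prod, Nat.card_fun, Nat.card_fun] at h
  exact h.symm

theorem IsRootedGraph.rank_add_card (hΓ : IsRootedGraph W E) (hQ : spannedBy W Q = Q) {k : ℕ}
    (hk : HasFreeRank Q k) :
    k + Nat.card (vertexImage W Q) = Nat.card (edgeImage E Q) + 1 := by
  have h := hΓ.card_hom_mul (S := Multiplicative (ZMod 2)) hQ
  have h₂ : Nat.card (Multiplicative (ZMod 2)) = 2 := by simp
  rw [hk.card_hom, h₂, ← pow_add, ← pow_succ] at h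
  exact Nat.pow_right_injective le_rfl h

end Transport

section Growth

theorem Set.ncard_image_eq_ncard_image {A B C : Type} {W : Set A} {f : A → B} {g : A → C}
    (h : ∀ u ∈ W, ∀ v ∈ W, f u = f v ↔ g u = g v) : (f '' W).ncard = (g '' W).ncard := by
  have h₁ : Prod.fst '' ((fun u => (f u, g u)) '' W) = f '' W := by rw [Set.image_image]
  have h₂ : Prod.snd '' ((fun u => (f u, g u)) '' W) = g '' W := by rw [Set.image_image]
  have hf : Set.InjOn Prod.fst ((fun u => (f u, g u)) '' W) := by
    rintro _ ⟨u, hu, rfl⟩ _ ⟨v, hv, rfl⟩ huv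
    exact Prod.ext huv ((h u hu v hv).1 huv)
  have hg : Set.InjOn Prod.snd ((fun u => (f u, g u)) '' W) := by
    rintro _ ⟨u, hu, rfl⟩ _ ⟨v, hv, rfl⟩ huv
    exact Prod.ext ((h u hu v hv).2 huv) huv
  rw [← h₁, ← h₂, hf.ncard_image, hg.ncard_image]

variable {α : Type} {W : Set (FreeGroup α)} {E : Set (FreeGroup α × α)}
  {B : Subgroup (FreeGroup α)}

theorem mem_spannedBy_iff {u v : FreeGroup α} (hu : u ∈ W) (hv : v ∈ W) :
    u⁻¹ * v ∈ spannedBy W B ↔ u⁻¹ * v ∈ B :=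
  ⟨fun h => spannedBy_le W B h, fun h => Subgroup.subset_closure ⟨h, u, hu, v, hv, rfl⟩⟩

theorem spannedBy_mono_right {B' : Subgroup (FreeGroup α)} (h : B ≤ B') :
    spannedBy W B ≤ spannedBy W B' :=
  Subgroup.closure_mono fun _ hg => ⟨h hg.1, hg.2⟩

theorem spannedBy_mono_left {W' : Set (FreeGroup α)} (h : W ⊆ W') :
    spannedBy W B ≤ spannedBy W' B :=
  Subgroup.closure_mono fun _ ⟨hg, u, hu, v, hv, he⟩ => ⟨hg, u, h hu, v, h hv, he⟩

theorem spannedBy_spannedBy : spannedBy W (spannedBy W B) = spannedBy W B := by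
  refine le_antisymm (spannedBy_le _ _) ((Subgroup.closure_le _).2 ?_)
  rintro _ ⟨hg, u, hu, v, hv, rfl⟩
  exact Subgroup.subset_closure ⟨(mem_spannedBy_iff hu hv).2 hg, u, hu, v, hv, rfl⟩

theorem spannedBy_sup {Q Q' : Subgroup (FreeGroup α)} (hQ : spannedBy W Q = Q)
    (hQ' : spannedBy W Q' = Q') : spannedBy W (Q ⊔ Q') = Q ⊔ Q' :=
  le_antisymm (spannedBy_le _ _) (sup_le
    (hQ.symm.le.trans (spannedBy_mono_right le_sup_left))
    (hQ'.symm.le.trans (spannedBy_mono_right le_sup_right)))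

theorem spannedBy_fg (hW : W.Finite) : (spannedBy W B).FG := by
  refine (Subgroup.fg_iff _).2 ⟨_, rfl, ?_⟩
  refine ((hW.prod hW).image fun p => p.1⁻¹ * p.2).subset ?_
  rintro _ ⟨-, u, hu, v, hv, rfl⟩
  exact ⟨(u, v), ⟨hu, hv⟩, rfl⟩

theorem le_spannedBy {H : Subgroup (FreeGroup α)} {T : Set (FreeGroup α)}
    (hT : Subgroup.closure T = H) (h1 : 1 ∈ W) (hTW : T ⊆ W) (hHB : H ≤ B) :
    H ≤ spannedBy W B := by
  rw [← hT, Subgroup.closure_le]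
  intro t ht
  exact Subgroup.subset_closure ⟨hHB (hT ▸ Subgroup.subset_closure ht), 1, h1, t, hTW ht, by simp⟩

theorem card_vertexImage_spannedBy :
    Nat.card (vertexImage W (spannedBy W B)) = Nat.card (vertexImage W B) := by
  rw [Nat.card_coe_set_eq, Nat.card_coe_set_eq]
  refine Set.ncard_image_eq_ncard_image fun u hu v hv => ?_
  rw [QuotientGroup.eq, QuotientGroup.eq, mem_spannedBy_iff hu hv]

theorem IsRootedGraph.card_edgeImage_spannedBy (hΓ : IsRootedGraph W E) :
    Nat.card (edgeImage E (spannedBy W B)) = Nat.card (edgeImage E B) := by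
  rw [Nat.card_coe_set_eq, Nat.card_coe_set_eq]
  refine Set.ncard_image_eq_ncard_image fun u hu v hv => ?_
  rw [Prod.mk.injEq, Prod.mk.injEq, QuotientGroup.eq, QuotientGroup.eq,
    mem_spannedBy_iff (hΓ.source_mem u hu) (hΓ.source_mem v hv)]

theorem IsRootedGraph.rank_spannedBy (hΓ : IsRootedGraph W E) {k : ℕ}
    (hk : HasFreeRank (spannedBy W B) k) :
    k + (vertexImage W B).ncard = (edgeImage E B).ncard + 1 := by
  have := hΓ.rank_add_card spannedBy_spannedBy hk
  rwa [card_vertexImage_spannedBy, hΓ.card_edgeImage_spannedBy] at this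

theorem spannedBy_insert {v w : FreeGroup α} (hv : v ∈ W) (hw : v⁻¹ * w ∈ B) :
    spannedBy (insert w W) B = spannedBy W B ⊔ Subgroup.closure {v⁻¹ * w} := by
  apply le_antisymm
  · rw [spannedBy, Subgroup.closure_le]
    have hc : v⁻¹ * w ∈ spannedBy W B ⊔ Subgroup.closure {v⁻¹ * w} :=
      (le_sup_right : _ ≤ spannedBy W B ⊔ _) (Subgroup.subset_closure rfl)
    have key : ∀ u ∈ W, w⁻¹ * u ∈ B → w⁻¹ * u ∈ spannedBy W B ⊔ Subgroup.closure {v⁻¹ * w} := by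
      intro u hu h
      have h₁ : v⁻¹ * u ∈ spannedBy W B := by
        rw [mem_spannedBy_iff hv hu]
        simpa [mul_assoc] using B.mul_mem hw h
      have h₂ := (spannedBy W B ⊔ Subgroup.closure {v⁻¹ * w}).mul_mem
        (Subgroup.inv_mem _ hc) (le_sup_left (a := spannedBy W B) h₁)
      simpa [mul_assoc] using h₂
    rintro _ ⟨hg, u, hu, u', hu', rfl⟩
    rcases hu with rfl | hu <;> rcases hu' with rfl | hu'
    · simp
    · exact key u' hu' hg
    · have := Subgroup.inv_mem _ (key u hu (by simpa using B.inv_mem hg))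
      simpa using this
    · exact le_sup_left (a := spannedBy W B) ((mem_spannedBy_iff hu hu').2 hg)
  · refine sup_le (spannedBy_mono_left (Set.subset_insert _ _)) ?_
    rw [Subgroup.closure_le]
    rintro _ rfl
    exact Subgroup.subset_closure ⟨hw, v, Or.inr hv, w, Or.inl rfl, rfl⟩

theorem spannedBy_insert_of_forall_not_mem {w : FreeGroup α} (hw : ∀ v ∈ W, v⁻¹ * w ∉ B) :
    spannedBy (insert w W) B = spannedBy W B := by
  refine le_antisymm ?_ (spannedBy_mono_left (Set.subset_insert _ _))
  rw [spannedBy, Subgroup.closure_le]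
  rintro _ ⟨hg, u, hu, u', hu', rfl⟩
  rcases hu with rfl | hu <;> rcases hu' with rfl | hu'
  · simp
  · exact absurd (by simpa using B.inv_mem hg) (hw u' hu')
  · exact absurd hg (hw u hu)
  · exact (mem_spannedBy_iff hu hu').2 hg

theorem GraphStep.isFreeFactorOf {Γ Γ' : Set (FreeGroup α) × Set (FreeGroup α × α)}
    (h : GraphStep Γ Γ') (hΓ : IsRootedGraph Γ.1 Γ.2) :
    IsFreeFactorOf (spannedBy Γ.1 B) (spannedBy Γ'.1 B) := by
  have hΓ' := h.isRootedGraph hΓ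
  obtain ⟨W, E, e, he⟩ := h
  obtain ⟨w, hw⟩ : ∃ w, insert e.1 (insert (FreeGroup.of e.2 * e.1) W) = insert w W := by
    rcases he with he | he
    · exact ⟨FreeGroup.of e.2 * e.1, Set.insert_eq_of_mem (Or.inr he)⟩
    · exact ⟨e.1, by rw [Set.insert_eq_of_mem he]⟩
  simp only [hw] at hΓ hΓ' ⊢
  by_cases hwW : w ∈ W
  · rw [Set.insert_eq_of_mem hwW]
    exact IsFreeFactorOf.refl _
  by_cases hv : ∀ v ∈ W, v⁻¹ * w ∉ B
  · rw [spannedBy_insert_of_forall_not_mem hv]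
    exact IsFreeFactorOf.refl _
  push Not at hv
  obtain ⟨v, hv, hvw⟩ := hv
  by_cases hE : ((e.1 : FreeGroup α ⧸ B), e.2) ∈ edgeImage E B
  · have hP : spannedBy (insert w W) B = spannedBy W B := by
      obtain ⟨e', he', hee'⟩ := hE
      rw [Prod.mk.injEq, QuotientGroup.eq] at hee'
      have hs' := hΓ.source_mem e' he'
      have ht' := hΓ.target_mem e' he'
      rw [hee'.2] at ht'
      have key : ∀ a ∈ W, ∀ b ∈ W, a⁻¹ * w ∈ B → (∀ c ∈ W, a⁻¹ * w = b⁻¹ * c →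
          spannedBy (insert w W) B = spannedBy W B) := by
        intro a ha b hb h c hc hac
        rw [spannedBy_insert ha h, sup_eq_left, Subgroup.closure_le]
        rintro _ rfl
        rw [hac] at h ⊢
        exact (mem_spannedBy_iff hb hc).2 h
      have hs : e.1 ∈ insert w W := hw ▸ Or.inl rfl
      have ht : FreeGroup.of e.2 * e.1 ∈ insert w W := hw ▸ Or.inr (Or.inl rfl)
      have heq : (FreeGroup.of e.2 * e'.1)⁻¹ * (FreeGroup.of e.2 * e.1) = e'.1⁻¹ * e.1 := by group
      rcases hs with hs | hs <;> rcases ht with ht | ht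
      · exact absurd (he.elim (fun h => hs ▸ h) fun h => by rwa [ht] at h) hwW
      · exact key _ hs' _ ht' (by rw [← hs]; exact hee'.1) _ ht (by rw [heq, ← hs])
      · exact key _ ht' _ hs' (by rw [← ht, heq]; exact hee'.1) _ hs (by rw [← ht, heq])
      · have : w ∈ insert e.1 (insert (FreeGroup.of e.2 * e.1) W) := hw ▸ Set.mem_insert _ _
        rcases this with h | h | h
        · exact absurd (by rwa [h]) hwW
        · exact absurd (by rwa [h]) hwW
        · exact absurd h hwW
    rw [hP]
    exact IsFreeFactorOf.refl _
  · obtain ⟨p, hp⟩ := HasFreeRank.exists_of_fg (spannedBy_fg (B := B) hΓ.finite_vertices)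
    obtain ⟨q, hq⟩ := HasFreeRank.exists_of_fg (spannedBy_fg (B := B) hΓ'.finite_vertices)
    have h₁ := hΓ.rank_spannedBy hp
    have h₂ := hΓ'.rank_spannedBy hq
    have hV : vertexImage (insert w W) B = vertexImage W B := by
      rw [vertexImage, Set.image_insert_eq, Set.insert_eq_of_mem]
      · rfl
      · exact ⟨v, hv, QuotientGroup.eq.2 hvw⟩
    have hE' : edgeImage (insert e E) B = insert ((e.1 : FreeGroup α ⧸ B), e.2) (edgeImage E B) :=
      Set.image_insert_eq
    rw [hV, hE', Set.ncard_insert_of_notMem hE (hΓ.finite_edges.image _)] at h₂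
    refine (hp.rank_sup_closure hq (fun _ : Fin 1 => v⁻¹ * w) ?_).2 (by omega)
    rw [spannedBy_insert hv hvw, Set.range_const]

open Relation in
theorem graphSteps_isFreeFactorOf {Γ Γ' : Set (FreeGroup α) × Set (FreeGroup α × α)}
    (h : ReflTransGen GraphStep Γ Γ') (hΓ : IsRootedGraph Γ.1 Γ.2) :
    IsFreeFactorOf (spannedBy Γ.1 B) (spannedBy Γ'.1 B) := by
  induction h with
  | refl => exact IsFreeFactorOf.refl _
  | tail h₁ h₂ ih => exact ih.trans (h₂.isFreeFactorOf (graphSteps_isRootedGraph h₁ hΓ))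

/-- In a finitely generated subgroup, the part spanned by a rooted graph is a free factor. -/
theorem IsRootedGraph.isFreeFactorOf_spannedBy (hΓ : IsRootedGraph W E) (hB : B.FG) :
    IsFreeFactorOf (spannedBy W B) B := by
  obtain ⟨T, hT⟩ := hB
  obtain ⟨Γ', h, hTΓ'⟩ := exists_graphSteps_subset T.finite_toSet (W, E) hΓ.one_mem
  have h₁ := graphSteps_isFreeFactorOf (B := B) h hΓ
  rwa [le_antisymm (spannedBy_le _ _)
    (le_spannedBy hT (graphSteps_isRootedGraph h hΓ).one_mem hTΓ' le_rfl)] at h₁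

theorem IsAlgebraicExtensionOf.spannedBy_eq {H : Subgroup (FreeGroup α)}
    (h : IsAlgebraicExtensionOf H B) {T : Set (FreeGroup α)} (hTf : T.Finite)
    (hT : Subgroup.closure T = H) (hΓ : IsRootedGraph W E) (hTW : T ⊆ W) :
    spannedBy W B = B :=
  h.2 _ (le_spannedBy hT hΓ.one_mem hTW h.1)
    (hΓ.isFreeFactorOf_spannedBy (h.fg ((Subgroup.fg_iff _).2 ⟨T, hT, hTf⟩)))

theorem finite_setOf_spannedBy_eq (hW : W.Finite) :
    {Q : Subgroup (FreeGroup α) | spannedBy W Q = Q}.Finite := by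
  have hf : ((fun p : FreeGroup α × FreeGroup α => p.1⁻¹ * p.2) '' (W ×ˢ W)).Finite :=
    (hW.prod hW).image _
  refine (hf.finite_subsets.image Subgroup.closure).subset fun Q hQ => ?_
  refine ⟨_, ?_, hQ⟩
  rintro _ ⟨-, u, hu, v, hv, rfl⟩
  exact ⟨(u, v), ⟨hu, hv⟩, rfl⟩

end Growth

section FreeFactorContainment

theorem IsRootedGraph.map {X Z : Type} {W : Set (FreeGroup X)} {E : Set (FreeGroup X × X)}
    (hΓ : IsRootedGraph W E) (j : X → Z) :
    IsRootedGraph (FreeGroup.map j '' W) ((fun e => (FreeGroup.map j e.1, j e.2)) '' E) where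
  finite_vertices := hΓ.finite_vertices.image _
  finite_edges := hΓ.finite_edges.image _
  one_mem := ⟨1, hΓ.one_mem, map_one _⟩
  source_mem := by
    rintro _ ⟨e, he, rfl⟩
    exact ⟨_, hΓ.source_mem e he, rfl⟩
  target_mem := by
    rintro _ ⟨e, he, rfl⟩
    exact ⟨_, hΓ.target_mem e he, by simp⟩
  induction := by
    rintro p hp hE _ ⟨u, hu, rfl⟩
    refine hΓ.induction (fun u => p (FreeGroup.map j u)) (by simpa using hp) (fun e he => ?_) u hu
    simpa using hE _ ⟨e, he, rfl⟩

variable {G : Type} [Group G]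

theorem IsFreeFactorOf.exists_hom [IsFreeGroup G] {A J : Subgroup G} (h : IsFreeFactorOf A J) :
    ∃ (X Y : Type) (θ : FreeGroup (X ⊕ Y) →* G), Function.Injective θ ∧ θ.range = J ∧
      (θ.comp (FreeGroup.map Sum.inl)).range = A := by
  rw [isFreeFactorOf_iff] at h
  obtain ⟨A', hA, hA', hs, hu⟩ := h
  let b := IsFreeGroup.basis A
  let b' := IsFreeGroup.basis A'
  let θ : FreeGroup (IsFreeGroup.Generators A ⊕ IsFreeGroup.Generators A') →* G :=
    FreeGroup.lift (Sum.elim (fun i => (b i : G)) fun i => (b' i : G))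
  have hl : ∀ i, θ (FreeGroup.of (Sum.inl i)) = b i := fun i => by simp [θ]
  have hr : ∀ i, θ (FreeGroup.of (Sum.inr i)) = b' i := fun i => by simp [θ]
  have hrange : θ.range = A ⊔ A' := by
    rw [FreeGroup.range_lift_eq_closure, Set.Sum.elim_range, Subgroup.closure_union,
      closure_range_basis, closure_range_basis]
  have hrange' : (θ.comp (FreeGroup.map Sum.inl)).range = A := by
    have : θ.comp (FreeGroup.map Sum.inl) = FreeGroup.lift fun i => (b i : G) := by
      ext i
      simp [hl]
    rw [this, FreeGroup.range_lift_eq_closure, closure_range_basis]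
  refine ⟨_, _, θ, ?_, hrange.trans hs, hrange'⟩
  obtain ⟨φ, h₁, h₂⟩ := hu _ (b.lift fun i => FreeGroup.of (Sum.inl i))
    (b'.lift fun i => FreeGroup.of (Sum.inr i))
  have hθJ : ∀ w, θ w ∈ J := fun w => hs ▸ hrange ▸ ⟨w, rfl⟩
  have hcomp : φ.comp (θ.codRestrict J hθJ) = MonoidHom.id _ := by
    ext (i | i)
    · have := h₁ (b i) (b i).2
      simp only [Subtype.coe_eta, FreeGroupBasis.lift_apply_apply, FreeGroupBasis.repr_apply_coe,
        FreeGroup.lift_apply_of] at this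
      rw [MonoidHom.comp_apply, MonoidHom.id_apply]
      exact (congrArg φ (Subtype.ext (hl i))).trans this
    · have := h₂ (b' i) (b' i).2
      simp only [Subtype.coe_eta, FreeGroupBasis.lift_apply_apply, FreeGroupBasis.repr_apply_coe,
        FreeGroup.lift_apply_of] at this
      rw [MonoidHom.comp_apply, MonoidHom.id_apply]
      exact (congrArg φ (Subtype.ext (hr i))).trans this
  intro w w' hw
  have h := DFunLike.congr_fun hcomp
  rw [← MonoidHom.id_apply _ w, ← MonoidHom.id_apply _ w', ← h, ← h]
  exact congrArg φ (Subtype.ext hw)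

/-- An algebraic extension inside `J` is contained in every free factor of `J` containing the
base. -/
theorem IsAlgebraicExtensionOf.le_of_isFreeFactorOf [IsFreeGroup G] {H A J B : Subgroup G}
    (hH : H.FG) (hA : IsFreeFactorOf A J) (hHA : H ≤ A) (hB : IsAlgebraicExtensionOf H B)
    (hBJ : B ≤ J) : B ≤ A := by
  have hBfg := hB.fg hH
  obtain ⟨X, Y, θ, hθ, hθJ, hθA⟩ := hA.exists_hom
  obtain ⟨T, hT⟩ := hH
  set ψ := θ.comp (FreeGroup.map Sum.inl) with hψ
  have hTψ : (T : Set G) ⊆ Set.range ψ := by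
    rw [← MonoidHom.coe_range, hθA]
    exact fun t ht => hHA (hT ▸ Subgroup.subset_closure ht)
  obtain ⟨T', hT'T, hT'f⟩ : ∃ T' : Set (FreeGroup X), ψ '' T' = T ∧ T'.Finite := by
    choose! f hf using hTψ
    exact ⟨f '' T, by rw [Set.image_image, Set.image_congr hf, Set.image_id'],
      T.finite_toSet.image f⟩
  obtain ⟨⟨W, E⟩, h, hTW⟩ := exists_graphSteps_subset hT'f
    (({1} : Set (FreeGroup X)), (∅ : Set (FreeGroup X × X))) rfl
  have hΓ := (graphSteps_isRootedGraph h IsRootedGraph.singleton).map (Sum.inl : X → X ⊕ Y)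
  have hB₀ : (B.comap θ).map θ = B := by
    rw [Subgroup.map_comap_eq, hθJ, inf_eq_right]
    exact hBJ
  have hB₀fg : (B.comap θ).FG := by
    rw [← hB₀, ← Group.fg_iff_subgroup_fg] at hBfg
    rw [← Group.fg_iff_subgroup_fg]
    exact Group.fg_of_surjective (f := ((B.comap θ).equivMapOfInjective θ hθ).symm.toMonoidHom)
      ((B.comap θ).equivMapOfInjective θ hθ).symm.surjective
  have hff := (hΓ.isFreeFactorOf_spannedBy hB₀fg).map θ hθ
  rw [hB₀] at hff
  have hcl : (Subgroup.closure (FreeGroup.map (Sum.inl : X → X ⊕ Y) '' T')).map θ = H := by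
    rw [MonoidHom.map_closure, ← Set.image_comp, ← hT, ← hT'T]
    rfl
  have hle := Subgroup.map_mono (f := θ) (le_spannedBy rfl hΓ.one_mem (Set.image_mono hTW)
    (Subgroup.map_le_iff_le_comap.1 (hcl.le.trans hB.1)))
  rw [hcl] at hle
  rw [← hB.2 _ hle hff, ← hθA, hψ, MonoidHom.range_comp]
  refine Subgroup.map_mono ((Subgroup.closure_le _).2 ?_)
  rintro _ ⟨-, _, ⟨u, -, rfl⟩, _, ⟨v, -, rfl⟩, rfl⟩
  exact ⟨u⁻¹ * v, by simp⟩

end FreeFactorContainment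

section FiberCounting

/-- The number of earlier indices in the same fibre of `π`. -/
noncomputable def priorCount {n : ℕ} {Y : Type} (π : Fin n → Y) (i : Fin n) : ℕ :=
  Nat.card {j : Fin n // j < i ∧ π j = π i}

variable {Y : Type} {N : ℕ}

theorem priorCount_castSucc {n : ℕ} (π : Fin (n + 1) → Y) (i : Fin n) :
    priorCount π i.castSucc = priorCount (fun j => π j.castSucc) i := by
  refine (Nat.card_congr (Equiv.ofBijective
    (fun j => ⟨j.1.castSucc, Fin.castSucc_lt_castSucc_iff.2 j.2.1, j.2.2⟩) ⟨?_, ?_⟩)).symm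
  · rintro ⟨j, hj⟩ ⟨j', hj'⟩ h
    simpa using h
  · rintro ⟨j, hj, hπ⟩
    have hne : j ≠ Fin.last n := (hj.trans (Fin.castSucc_lt_last i)).ne
    obtain ⟨j, rfl⟩ := Fin.exists_castSucc_eq.2 hne
    exact ⟨⟨j, Fin.castSucc_lt_castSucc_iff.1 hj, hπ⟩, rfl⟩

theorem priorCount_last {n : ℕ} (π : Fin (n + 1) → Y) :
    priorCount π (Fin.last n) = Nat.card {j : Fin n // π j.castSucc = π (Fin.last n)} := by
  refine (Nat.card_congr (Equiv.ofBijective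
    (fun j => ⟨j.1.castSucc, Fin.castSucc_lt_last _, j.2⟩) ⟨?_, ?_⟩)).symm
  · rintro ⟨j, hj⟩ ⟨j', hj'⟩ h
    simpa using h
  · rintro ⟨j, hj, hπ⟩
    obtain ⟨j, rfl⟩ := Fin.exists_castSucc_eq.2 hj.ne
    exact ⟨⟨j, hπ⟩, rfl⟩

theorem card_avoiding {n : ℕ} (π : Fin (n + 1) → Y) (f : Fin n → Fin N)
    (hf : ∀ i j : Fin n, π i.castSucc = π j.castSucc → f i = f j → i = j) :
    Nat.card {y : Fin N // ∀ i : Fin n, π i.castSucc = π (Fin.last n) → f i ≠ y} =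
      N - priorCount π (Fin.last n) := by
  classical
  rw [priorCount_last]
  let g : {j : Fin n // π j.castSucc = π (Fin.last n)} → Fin N := fun j => f j
  have hg : Function.Injective g := by
    rintro ⟨i, hi⟩ ⟨j, hj⟩ h
    exact Subtype.ext (hf i j (hi.trans hj.symm) h)
  have h₁ : Nat.card {y : Fin N // ∀ i : Fin n, π i.castSucc = π (Fin.last n) → f i ≠ y} =
      (Set.range g)ᶜ.ncard := by
    rw [← Nat.card_coe_set_eq]
    refine Nat.card_congr (Equiv.subtypeEquivRight fun y => ?_)
    simp [g]
  rw [h₁, Set.ncard_compl, Nat.card_fin, ← Set.image_univ, hg.injOn.ncard_image, Set.ncard_univ]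

/-- The number of functions that are injective on each fibre of `π`. -/
theorem card_injective_on_fibers : ∀ {n : ℕ} (π : Fin n → Y),
    Nat.card {f : Fin n → Fin N // ∀ i j, π i = π j → f i = f j → i = j} =
      ∏ i, (N - priorCount π i)
  | 0, π => by
    have : Unique {f : Fin 0 → Fin N // ∀ i j, π i = π j → f i = f j → i = j} :=
      { default := ⟨Fin.elim0, fun i => i.elim0⟩
        uniq := fun f => Subtype.ext (Subsingleton.elim _ _) }
    simp
  | n + 1, π => by
    classical
    rw [Fin.prod_univ_castSucc]
    simp only [priorCount_castSucc]
    rw [← card_injective_on_fibers fun j => π j.castSucc]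
    let e : {f : Fin (n + 1) → Fin N // ∀ i j, π i = π j → f i = f j → i = j} ≃
        Σ f : {f : Fin n → Fin N // ∀ i j : Fin n, π i.castSucc = π j.castSucc → f i = f j → i = j},
          {y : Fin N // ∀ i : Fin n, π i.castSucc = π (Fin.last n) → f.1 i ≠ y} :=
      { toFun := fun f => ⟨⟨fun i => f.1 i.castSucc, fun i j h h' =>
            Fin.castSucc_injective n (f.2 _ _ h h')⟩, ⟨f.1 (Fin.last n), fun i h h' =>
              (Fin.castSucc_lt_last i).ne (f.2 _ _ h h')⟩⟩
        invFun := fun z => ⟨Fin.snoc z.1.1 z.2.1, by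
          intro i j
          induction i using Fin.lastCases with
          | last =>
            induction j using Fin.lastCases with
            | last => simp
            | cast j =>
              intro h h'
              simp only [Fin.snoc_last, Fin.snoc_castSucc] at h'
              exact absurd h'.symm (z.2.2 j h.symm)
          | cast i =>
            induction j using Fin.lastCases with
            | last =>
              intro h h'
              simp only [Fin.snoc_last, Fin.snoc_castSucc] at h'
              exact absurd h' (z.2.2 i h)
            | cast j =>
              intro h h'
              simp only [Fin.snoc_castSucc] at h'
              rw [z.1.2 i j h h']⟩
        left_inv := fun f => Subtype.ext (Fin.snoc_init_self f.1)
        right_inv := by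
          rintro ⟨⟨f, hf⟩, ⟨y, hy⟩⟩
          exact Sigma.subtype_ext (Subtype.ext (funext fun i => by simp)) (by simp) }
    rw [Nat.card_congr e, Nat.card_sigma, Finset.sum_congr rfl fun f _ => card_avoiding π f.1 f.2,
      Finset.sum_const, Finset.card_univ, smul_eq_mul, Nat.card_eq_fintype_card]

/-- The number of families of permutations with prescribed values on fibrewise injective data. -/
theorem card_perm_families_mul [Finite Y] : ∀ {l : ℕ} (π : Fin l → Y) (s t : Fin l → Fin N)
    (_ : ∀ i j, π i = π j → s i = s j → i = j) (_ : ∀ i j, π i = π j → t i = t j → i = j),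
    Nat.card {σ : Y → Equiv.Perm (Fin N) // ∀ k, σ (π k) (s k) = t k} *
      ∏ k, (N - priorCount π k) = Nat.card (Equiv.Perm (Fin N)) ^ Nat.card Y
  | 0, π, s, t, _, _ => by
    rw [← Nat.card_fun]
    simp only [Finset.univ_eq_empty, Finset.prod_empty, mul_one]
    exact Nat.card_congr (Equiv.subtypeUnivEquiv fun σ k => k.elim0)
  | l + 1, π, s, t, hs, ht => by
    classical
    have hs' : ∀ i j : Fin l, π i.castSucc = π j.castSucc → s i.castSucc = s j.castSucc → i = j :=
      fun i j h h' => Fin.castSucc_injective l (hs _ _ h h')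
    have ht' : ∀ i j : Fin l, π i.castSucc = π j.castSucc → t i.castSucc = t j.castSucc → i = j :=
      fun i j h h' => Fin.castSucc_injective l (ht _ _ h h')
    rw [Fin.prod_univ_castSucc]
    simp only [priorCount_castSucc]
    rw [← card_perm_families_mul (fun j => π j.castSucc) _ _ hs' ht',
      ← card_avoiding π (fun i => t i.castSucc) ht', mul_comm (∏ _, _), ← mul_assoc,
      ← Nat.card_prod]
    congr 1
    set p := π (Fin.last l)
    have key : ∀ (σ : Y → Equiv.Perm (Fin N)) (y : Fin N),
        (∀ k : Fin l, σ (π k.castSucc) (s k.castSucc) = t k.castSucc) →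
        (∀ i : Fin l, π i.castSucc = p → t i.castSucc ≠ y) →
        ∀ k : Fin l, Function.update σ p (Equiv.swap (t (Fin.last l)) y * σ p) (π k.castSucc)
          (s k.castSucc) = t k.castSucc := by
      intro σ y hσ hy k
      by_cases hk : π k.castSucc = p
      · have h := hσ k
        rw [hk] at h ⊢
        rw [Function.update_self, Equiv.Perm.mul_apply, h, Equiv.swap_apply_of_ne_of_ne]
        · exact fun h' => (Fin.castSucc_lt_last k).ne (ht _ _ hk h')
        · exact hy k hk
      · rw [Function.update_of_ne hk]
        exact hσ k
    refine Nat.card_congr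
      { toFun := fun z => ⟨Function.update z.1.1 p
            (Equiv.swap (t (Fin.last l)) z.2.1 * z.1.1 p),
          key z.1.1 z.2.1 (fun k => z.1.2 k.castSucc) z.2.2⟩
        invFun := fun σ =>
          ⟨⟨Function.update σ.1 p (Equiv.swap (t (Fin.last l)) (σ.1 p (s (Fin.last l))) * σ.1 p),
            ?_⟩, ⟨σ.1 p (s (Fin.last l)), ?_⟩⟩
        left_inv := ?_
        right_inv := ?_ }
    · intro k
      induction k using Fin.lastCases with
      | last => simp [p]
      | cast k =>
        refine key _ _ σ.2 ?_ k
        intro i hi h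
        have := σ.2 i
        rw [hi, h] at this
        exact (Fin.castSucc_lt_last i).ne (hs _ _ hi ((σ.1 p).injective this))
    · intro i hi h
      have := σ.2 i
      rw [hi, h] at this
      exact (Fin.castSucc_lt_last i).ne (hs _ _ hi ((σ.1 p).injective this))
    · rintro ⟨⟨σ, hσ⟩, ⟨y, hy⟩⟩
      have := hσ (Fin.last l)
      ext : 2
      · simp [p, this]
      · simp [p, this]
    · rintro ⟨σ, hσ⟩
      apply Subtype.ext
      simp [← mul_assoc]

end FiberCounting

section StabilizerCounting

theorem exists_enumeration {X Y : Type} {s : Set X} (hs : s.Finite) (f : X → Y) :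
    ∃ a : Fin (Nat.card (f '' s)) → X, (∀ i, a i ∈ s) ∧ (∀ i j, f (a i) = f (a j) → i = j) ∧
      ∀ x ∈ s, ∃ i, f (a i) = f x := by
  have := (hs.image f).to_subtype
  let e := Finite.equivFin (f '' s)
  choose a ha using fun i => (e.symm i).2
  refine ⟨a, fun i => (ha i).1, fun i j h => ?_, fun x hx => ⟨e ⟨f x, x, hx, rfl⟩, ?_⟩⟩
  · rw [(ha i).2, (ha j).2] at h
    exact e.symm.injective (Subtype.ext h)
  · rw [(ha _).2, Equiv.symm_apply_apply]

variable {α : Type} {W : Set (FreeGroup α)} {E : Set (FreeGroup α × α)}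
  {P Q : Subgroup (FreeGroup α)} {N : ℕ}

/-- Actions of `Q` with a marked point whose stabilizer meets the differences of `W` in `P`. -/
noncomputable def stabilizerCount (W : Set (FreeGroup α)) (P Q : Subgroup (FreeGroup α)) (N : ℕ) : ℕ :=
  Nat.card {z : (Q →* Equiv.Perm (Fin N)) × Fin N // ∀ u ∈ W, ∀ v ∈ W,
    (u⁻¹ * v ∈ P ↔ ∃ h : u⁻¹ * v ∈ Q, z.1 ⟨u⁻¹ * v, h⟩ z.2 = z.2)}

theorem IsRootedGraph.stabilizerCount_mul (hΓ : IsRootedGraph W E) (hQ : spannedBy W Q = Q) :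
    stabilizerCount W P Q N * Nat.card (Equiv.Perm (Fin N)) ^ Nat.card (vertexImage W Q) =
      Nat.card {z : (edgeImage E Q → Equiv.Perm (Fin N)) × Fin N // ∀ u ∈ W, ∀ v ∈ W,
        (u⁻¹ * v ∈ P ↔ u⁻¹ * v ∈ Q ∧ transport z.1 u z.2 = transport z.1 v z.2)} *
        Nat.card (Equiv.Perm (Fin N)) := by
  have := hΓ.finite_vertexImage Q
  have hb := hΓ.bijective_holonomy (S := Equiv.Perm (Fin N)) hQ
  rw [← Nat.card_fun, stabilizerCount, ← Nat.card_prod, ← Nat.card_prod]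
  have key : ∀ (σ : edgeImage E Q → Equiv.Perm (Fin N)) (s : Equiv.Perm (Fin N)) (j : Fin N)
      (u v : FreeGroup α), (∃ h : u⁻¹ * v ∈ Q, holonomy σ s ⟨u⁻¹ * v, h⟩ (s j) = s j) ↔
        u⁻¹ * v ∈ Q ∧ transport σ u j = transport σ v j := by
    intro σ s j u v
    rw [← exists_prop]
    refine exists_congr fun h => ?_
    have : holonomy σ s ⟨u⁻¹ * v, h⟩ = s * ((transport σ u)⁻¹ * transport σ v) * s⁻¹ := by
      rw [← transport_inv_mul σ h]
      rfl
    rw [this]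
    simp only [Equiv.Perm.mul_apply, EmbeddingLike.apply_eq_iff_eq]
    rw [Equiv.Perm.inv_eq_iff_eq, eq_comm, (Equiv.Perm.inv_eq_iff_eq (f := s)).2 rfl]
  symm
  refine Nat.card_eq_of_bijective (fun z => (⟨(holonomy z.1.1.1 z.2, z.2 z.1.1.2),
    fun u hu v hv => (z.1.2 u hu v hv).trans (key _ _ _ u v).symm⟩,
    fun p => z.2 * (transport z.1.1.1 (cosetRep W p.1))⁻¹)) ⟨?_, ?_⟩
  · rintro ⟨⟨⟨σ, j⟩, hσ⟩, s⟩ ⟨⟨⟨σ', j'⟩, hσ'⟩, s'⟩ h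
    simp only [Prod.mk.injEq, Subtype.mk.injEq] at h
    have h' : (σ, s) = (σ', s') := hb.1 (Prod.ext h.1.1 h.2)
    simp only [Prod.mk.injEq] at h'
    obtain ⟨rfl, rfl⟩ := h'
    obtain rfl := s.injective h.1.2
    rfl
  · rintro ⟨⟨⟨ψ, i⟩, hψ⟩, g⟩
    obtain ⟨⟨σ, s⟩, h⟩ := hb.2 (ψ, g)
    simp only [Prod.mk.injEq] at h
    obtain ⟨rfl, rfl⟩ := h
    obtain ⟨j, rfl⟩ := s.surjective i
    exact ⟨(⟨(σ, j), fun u hu v hv => (hψ u hu v hv).trans (key _ _ _ u v)⟩, s), rfl⟩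

theorem IsRootedGraph.card_labelled_mul (hΓ : IsRootedGraph W E) (hPQ : P ≤ Q) {n l : ℕ}
    {a : Fin n → FreeGroup α} (haW : ∀ i, a i ∈ W)
    (ha : ∀ i j, (a i : FreeGroup α ⧸ P) = a j → i = j)
    (haW' : ∀ u ∈ W, ∃ i, (a i : FreeGroup α ⧸ P) = u)
    {c : Fin l → FreeGroup α × α} (hcE : ∀ k, c k ∈ E)
    (hc : ∀ k k', (((c k).1 : FreeGroup α ⧸ P), (c k).2) = (((c k').1 : FreeGroup α ⧸ P), (c k').2)
      → k = k')
    (hcE' : ∀ e ∈ E, ∃ k, (((c k).1 : FreeGroup α ⧸ P), (c k).2) =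
      ((e.1 : FreeGroup α ⧸ P), e.2)) :
    Nat.card {z : (edgeImage E Q → Equiv.Perm (Fin N)) × Fin N // ∀ u ∈ W, ∀ v ∈ W,
        (u⁻¹ * v ∈ P ↔ u⁻¹ * v ∈ Q ∧ transport z.1 u z.2 = transport z.1 v z.2)} *
      ∏ k, (N - priorCount (fun k => (((c k).1 : FreeGroup α ⧸ Q), (c k).2)) k) =
    Nat.card (Equiv.Perm (Fin N)) ^ Nat.card (edgeImage E Q) *
      ∏ i, (N - priorCount (fun i => (a i : FreeGroup α ⧸ Q)) i) := by
  classical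
  have := hΓ.finite_edgeImage Q
  have hne : Nonempty (Fin n) := ⟨(haW' 1 hΓ.one_mem).choose⟩
  choose! idx hidx using haW'
  have hidx_iff : ∀ u ∈ W, ∀ v ∈ W, idx u = idx v ↔ u⁻¹ * v ∈ P := by
    intro u hu v hv
    rw [← QuotientGroup.eq, ← hidx u hu, ← hidx v hv]
    exact ⟨fun h => by rw [h], ha _ _⟩
  have hPQ' : ∀ u v : FreeGroup α, (u : FreeGroup α ⧸ P) = v → (u : FreeGroup α ⧸ Q) = v := by
    intro u v h
    rw [QuotientGroup.eq] at h ⊢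
    exact hPQ h
  have hidxQ : ∀ u ∈ W, (a (idx u) : FreeGroup α ⧸ Q) = u := fun u hu => hPQ' _ _ (hidx u hu)
  let π : Fin l → edgeImage E Q := fun k => ⟨(((c k).1 : FreeGroup α ⧸ Q), (c k).2), _, hcE k, rfl⟩
  have hprior : ∀ k, priorCount (fun k => (((c k).1 : FreeGroup α ⧸ Q), (c k).2)) k =
      priorCount π k := by
    intro k
    exact Nat.card_congr (Equiv.subtypeEquivRight fun j => and_congr_right fun _ =>
      (Subtype.ext_iff (a1 := π j) (a2 := π k)).symm)
  simp only [hprior]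
  rw [← card_injective_on_fibers fun i => (a i : FreeGroup α ⧸ Q)]
  let R := {f : Fin n → Fin N // ∀ i j, (a i : FreeGroup α ⧸ Q) = a j → f i = f j → i = j}
  have hR : ∀ (f : R) (u v : FreeGroup α), u ∈ W → v ∈ W → (u : FreeGroup α ⧸ Q) = v →
      f.1 (idx u) = f.1 (idx v) → (u : FreeGroup α ⧸ P) = v := by
    intro f u v hu hv h h'
    rw [QuotientGroup.eq, ← hidx_iff u hu v hv]
    exact f.2 _ _ (by rw [hidxQ u hu, hidxQ v hv, h]) h'
  have hT : ∀ (f : R) (σ : edgeImage E Q → Equiv.Perm (Fin N)),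
      (∀ k, σ (π k) (f.1 (idx (c k).1)) = f.1 (idx (FreeGroup.of (c k).2 * (c k).1))) →
      ∀ u ∈ W, transport σ u (f.1 (idx 1)) = f.1 (idx u) := by
    intro f σ hσ
    refine hΓ.induction _ (by simp) fun e he => ?_
    obtain ⟨k, hk⟩ := hcE' e he
    rw [Prod.mk.injEq] at hk
    have h₁ : idx e.1 = idx (c k).1 := by
      rw [hidx_iff _ (hΓ.source_mem e he) _ (hΓ.source_mem _ (hcE k)), ← QuotientGroup.eq, hk.1]
    have h₂ : idx (FreeGroup.of e.2 * e.1) = idx (FreeGroup.of (c k).2 * (c k).1) := by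
      rw [hidx_iff _ (hΓ.target_mem e he) _ (hΓ.target_mem _ (hcE k)), hk.2]
      have := QuotientGroup.eq.1 hk.1.symm
      simpa [mul_assoc] using this
    have h₃ : π k = ⟨((e.1 : FreeGroup α ⧸ Q), e.2), _, he, rfl⟩ :=
      Subtype.ext (Prod.ext (hPQ' _ _ hk.1) hk.2)
    have h₄ := hσ k
    rw [h₃, ← h₁, ← h₂] at h₄
    rw [transport_of_mul σ ⟨e, he, rfl⟩, Equiv.Perm.mul_apply, ← h₄, (Equiv.injective _).eq_iff]
  let e : {z : (edgeImage E Q → Equiv.Perm (Fin N)) × Fin N // ∀ u ∈ W, ∀ v ∈ W,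
        (u⁻¹ * v ∈ P ↔ u⁻¹ * v ∈ Q ∧ transport z.1 u z.2 = transport z.1 v z.2)} ≃
      Σ f : R, {σ : edgeImage E Q → Equiv.Perm (Fin N) // ∀ k,
        σ (π k) (f.1 (idx (c k).1)) = f.1 (idx (FreeGroup.of (c k).2 * (c k).1))} :=
    { toFun := fun z => ⟨⟨fun i => transport z.1.1 (a i) z.1.2, fun i j h h' => by
          refine ha i j (QuotientGroup.eq.2 ?_)
          exact (z.2 _ (haW i) _ (haW j)).2 ⟨QuotientGroup.eq.1 h, h'⟩⟩, ⟨z.1.1, fun k => by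
          have hu : ∀ u ∈ W, transport z.1.1 (a (idx u)) z.1.2 = transport z.1.1 u z.1.2 :=
            fun u hu => ((z.2 _ (haW _) u hu).1 (QuotientGroup.eq.1 (hidx u hu))).2
          simp only [hu _ (hΓ.source_mem _ (hcE k)), hu _ (hΓ.target_mem _ (hcE k))]
          rw [transport_of_mul z.1.1 ⟨_, hcE k, rfl⟩]
          rfl⟩⟩
      invFun := fun z => ⟨(z.2.1, z.1.1 (idx 1)), fun u hu v hv => by
        simp only [hT z.1 z.2.1 z.2.2 u hu, hT z.1 z.2.1 z.2.2 v hv]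
        constructor
        · intro h
          exact ⟨hPQ h, by rw [(hidx_iff u hu v hv).2 h]⟩
        · rintro ⟨h, h'⟩
          exact QuotientGroup.eq.1 (hR z.1 u v hu hv (QuotientGroup.eq.2 h) h')⟩
      left_inv := by
        rintro ⟨⟨σ, j⟩, hσ⟩
        refine Subtype.ext (Prod.ext rfl ?_)
        have := ((hσ _ (haW _) 1 hΓ.one_mem).1 (QuotientGroup.eq.1 (hidx 1 hΓ.one_mem))).2
        simpa using this
      right_inv := by
        rintro ⟨f, σ, hσ⟩
        refine Sigma.subtype_ext (Subtype.ext (funext fun i => ?_)) rfl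
        have h : idx (a i) = i := ha _ _ (hidx _ (haW i))
        have := hT f σ hσ (a i) (haW i)
        rw [h] at this
        exact this }
  rw [Nat.card_congr e, Nat.card_sigma, Finset.sum_mul, Finset.sum_congr rfl, Finset.sum_const,
    Finset.card_univ, smul_eq_mul, mul_comm, Nat.card_eq_fintype_card (α := R)]
  intro f _
  have hlab : ∀ k k', π k = π k' → ((c k).1 : FreeGroup α ⧸ Q) = (c k').1 ∧ (c k).2 = (c k').2 :=
    fun k k' h => Prod.mk.injEq _ _ _ _ ▸ congrArg Subtype.val h
  refine card_perm_families_mul π _ _ (fun k k' h h' => ?_) fun k k' h h' => ?_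
  · obtain ⟨h₁, h₂⟩ := hlab k k' h
    exact hc k k' (Prod.ext (hR f _ _ (hΓ.source_mem _ (hcE k)) (hΓ.source_mem _ (hcE k')) h₁ h')
      h₂)
  · obtain ⟨h₁, h₂⟩ := hlab k k' h
    have h₃ := hR f _ _ (hΓ.target_mem _ (hcE k)) (hΓ.target_mem _ (hcE k')) (by
      rw [QuotientGroup.eq] at h₁ ⊢
      simpa [h₂, mul_assoc] using h₁) h'
    refine hc k k' (Prod.ext ?_ h₂)
    rw [QuotientGroup.eq] at h₃ ⊢
    simpa [h₂, mul_assoc] using h₃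

theorem IsRootedGraph.stabilizerCount_mul_prod (hΓ : IsRootedGraph W E) (hPQ : P ≤ Q)
    (hQ : spannedBy W Q = Q) {n l : ℕ}
    {a : Fin n → FreeGroup α} (haW : ∀ i, a i ∈ W)
    (ha : ∀ i j, (a i : FreeGroup α ⧸ P) = a j → i = j)
    (haW' : ∀ u ∈ W, ∃ i, (a i : FreeGroup α ⧸ P) = u)
    {c : Fin l → FreeGroup α × α} (hcE : ∀ k, c k ∈ E)
    (hc : ∀ k k', (((c k).1 : FreeGroup α ⧸ P), (c k).2) = (((c k').1 : FreeGroup α ⧸ P), (c k').2)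
      → k = k')
    (hcE' : ∀ e ∈ E, ∃ k, (((c k).1 : FreeGroup α ⧸ P), (c k).2) =
      ((e.1 : FreeGroup α ⧸ P), e.2)) :
    stabilizerCount W P Q N *
      ∏ k, (N - priorCount (fun k => (((c k).1 : FreeGroup α ⧸ Q), (c k).2)) k) =
    Nat.card (Q →* Equiv.Perm (Fin N)) *
      ∏ i, (N - priorCount (fun i => (a i : FreeGroup α ⧸ Q)) i) := by
  have h₁ := hΓ.stabilizerCount_mul (P := P) (N := N) hQ
  have h₂ := hΓ.card_labelled_mul (N := N) hPQ haW ha haW' hcE hc hcE'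
  have h₃ := hΓ.card_hom_mul (S := Equiv.Perm (Fin N)) hQ
  have hpos : 0 < Nat.card (Equiv.Perm (Fin N)) ^ Nat.card (vertexImage W Q) :=
    pow_pos Nat.card_pos _
  refine Nat.eq_of_mul_eq_mul_right hpos ?_
  rw [mul_right_comm, h₁, mul_right_comm, h₂, mul_right_comm, ← h₃, mul_right_comm]

end StabilizerCounting

section DecayingSums

open Filter Asymptotics

open scoped Classical in
theorem exists_sum_le_eq {I A : Type} [Fintype I] [PartialOrder I] [AddCommGroup A] (g : I → A) :
    ∃ C : I → A, ∀ q, g q = ∑ p with p ≤ q, C p := by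
  let C : I → A := wellFounded_lt.fix fun q rec => g q - ∑ p : {p : I // p < q}, rec p.1 p.2
  refine ⟨C, fun q => ?_⟩
  have hC : C q = g q - ∑ p : {p : I // p < q}, C p := wellFounded_lt.fix_eq _ q
  have : (Finset.univ.filter fun p => p ≤ q) = insert q (Finset.univ.filter fun p => p < q) := by
    ext p
    simp [le_iff_eq_or_lt]
  rw [this, Finset.sum_insert (by simp), hC,
    ← Finset.sum_subtype (Finset.univ.filter fun p => p < q) (fun p => by simp) C, sub_add_cancel]

open scoped Classical in
theorem sum_le_eq_add_sum_lt {I A : Type} [Fintype I] [PartialOrder I] [AddCommMonoid A]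
    (C : I → A) (q : I) : ∑ p with p ≤ q, C p = C q + ∑ p with p < q, C p := by
  have : (Finset.univ.filter fun p => p ≤ q) = insert q (Finset.univ.filter fun p => p < q) := by
    ext p
    simp [le_iff_eq_or_lt]
  rw [this, Finset.sum_insert (by simp)]

variable {I : Type} [Fintype I] [SemilatticeSup I] {ρ : I → ℕ}

open scoped Classical in
/-- `g q` is a sum over `p ≤ q` of terms `C p = O(N ^ (-ρ p))`. -/
def HasDecay (ρ : I → ℕ) (g : I → ℕ → ℝ) : Prop :=
  ∃ C : I → ℕ → ℝ, (∀ᶠ N in atTop, ∀ q, g q N = ∑ p with p ≤ q, C p N) ∧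
    ∀ p, C p =O[atTop] fun N => ((N : ℝ)⁻¹) ^ ρ p

theorem isBigO_inv_pow {k l : ℕ} (h : k ≤ l) :
    (fun N : ℕ => ((N : ℝ)⁻¹) ^ l) =O[atTop] fun N => ((N : ℝ)⁻¹) ^ k := by
  refine IsBigO.of_bound 1 (Eventually.of_forall fun N => ?_)
  have h0 : (0 : ℝ) ≤ (N : ℝ)⁻¹ := by positivity
  rw [one_mul, Real.norm_of_nonneg (by positivity), Real.norm_of_nonneg (by positivity)]
  exact pow_le_pow_of_le_one h0 (Nat.cast_inv_le_one N) h

theorem HasDecay.congr {g g' : I → ℕ → ℝ} (hg : HasDecay ρ g)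
    (h : ∀ᶠ N in atTop, ∀ q, g q N = g' q N) : HasDecay ρ g' := by
  obtain ⟨C, h₁, h₂⟩ := hg
  refine ⟨C, ?_, h₂⟩
  filter_upwards [h, h₁] with N h h₁ q
  rw [← h, h₁]

theorem HasDecay.add {g g' : I → ℕ → ℝ} (hg : HasDecay ρ g) (hg' : HasDecay ρ g') :
    HasDecay ρ fun q N => g q N + g' q N := by
  obtain ⟨C, h₁, h₂⟩ := hg
  obtain ⟨C', h₁', h₂'⟩ := hg'
  refine ⟨fun p N => C p N + C' p N, ?_, fun p => (h₂ p).add (h₂' p)⟩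
  filter_upwards [h₁, h₁'] with N h h' q
  rw [h, h', Finset.sum_add_distrib]

open scoped Classical in
theorem HasDecay.single {c : I} {f : ℕ → ℝ} (hf : f =O[atTop] fun N => ((N : ℝ)⁻¹) ^ ρ c) :
    HasDecay ρ fun q N => if c ≤ q then f N else 0 := by
  refine ⟨fun p N => if c = p then f N else 0, Eventually.of_forall fun N q => ?_, fun p => ?_⟩
  · simp [Finset.sum_ite_eq]
  · by_cases h : c = p
    · subst h
      simpa using hf
    · simpa [h] using isBigO_zero _ _

open scoped Classical in
theorem HasDecay.mul (hsup : ∀ p q, ρ (p ⊔ q) ≤ ρ p + ρ q) {g g' : I → ℕ → ℝ}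
    (hg : HasDecay ρ g) (hg' : HasDecay ρ g') : HasDecay ρ fun q N => g q N * g' q N := by
  obtain ⟨C, h₁, h₂⟩ := hg
  obtain ⟨C', h₁', h₂'⟩ := hg'
  refine ⟨fun p N => ∑ z : I × I with z.1 ⊔ z.2 = p, C z.1 N * C' z.2 N, ?_, fun p => ?_⟩
  · filter_upwards [h₁, h₁'] with N h h' q
    rw [h, h', Finset.sum_mul_sum, ← Finset.sum_product',
      ← Finset.sum_fiberwise_of_maps_to (t := Finset.univ.filter fun p => p ≤ q)
        (g := fun z : I × I => z.1 ⊔ z.2)]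
    · refine Finset.sum_congr rfl fun p hp => Finset.sum_congr ?_ fun _ _ => rfl
      ext z
      simp only [Finset.mem_filter, Finset.mem_product, Finset.mem_univ, true_and] at hp ⊢
      refine ⟨And.right, fun h => ⟨?_, h⟩⟩
      rw [← h] at hp
      exact sup_le_iff.1 hp
    · intro z hz
      simpa using hz
  · refine IsBigO.fun_sum fun z hz => ?_
    refine ((h₂ z.1).mul (h₂' z.2)).trans ?_
    simp only [← pow_add]
    refine isBigO_inv_pow ?_
    rw [← (Finset.mem_filter.1 hz).2]
    exact hsup _ _

theorem HasDecay.of_isBigO {K : ℕ} (hK : ∀ p, ρ p ≤ K) {g : I → ℕ → ℝ}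
    (hg : ∀ q, g q =O[atTop] fun N => ((N : ℝ)⁻¹) ^ K) : HasDecay ρ g := by
  classical
  obtain ⟨C, hC⟩ := exists_sum_le_eq g
  refine ⟨C, Eventually.of_forall fun N q => ?_, fun p => ?_⟩
  · rw [hC q, Finset.sum_apply]
  · refine IsBigO.trans ?_ (isBigO_inv_pow (hK p))
    induction p using WellFoundedLT.induction with
    | ind p ih =>
      have h : C p = fun N => g p N - ∑ x with x < p, C x N := by
        funext N
        have := congrFun (hC p) N
        rw [Finset.sum_apply, sum_le_eq_add_sum_lt] at this
        rw [this, add_sub_cancel_right]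
      rw [h]
      exact (hg p).sub (IsBigO.fun_sum fun x hx => ih x (Finset.mem_filter.1 hx).2)

variable [OrderBot I]

theorem HasDecay.const (h0 : ρ ⊥ = 0) (c : ℝ) : HasDecay ρ fun _ _ => c := by
  have := HasDecay.single (ρ := ρ) (c := ⊥) (f := fun _ => c)
    (by simpa [h0] using isBigO_const_const c (one_ne_zero' ℝ) (atTop : Filter ℕ))
  simpa using this

theorem HasDecay.finset_sum {κ : Type} (h0 : ρ ⊥ = 0) (s : Finset κ) {g : κ → I → ℕ → ℝ}
    (hg : ∀ i ∈ s, HasDecay ρ (g i)) : HasDecay ρ fun q N => ∑ i ∈ s, g i q N := by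
  classical
  induction s using Finset.induction_on with
  | empty => simpa using HasDecay.const h0 0
  | insert i s hi ih =>
    simp only [Finset.sum_insert hi]
    exact (hg i (Finset.mem_insert_self i s)).add
      (ih fun j hj => hg j (Finset.mem_insert_of_mem hj))

theorem HasDecay.finset_prod {κ : Type} (h0 : ρ ⊥ = 0) (hsup : ∀ p q, ρ (p ⊔ q) ≤ ρ p + ρ q)
    (s : Finset κ) {g : κ → I → ℕ → ℝ} (hg : ∀ i ∈ s, HasDecay ρ (g i)) :
    HasDecay ρ fun q N => ∏ i ∈ s, g i q N := by
  classical
  induction s using Finset.induction_on with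
  | empty => simpa using HasDecay.const h0 1
  | insert i s hi ih =>
    simp only [Finset.prod_insert hi]
    exact (hg i (Finset.mem_insert_self i s)).mul hsup
      (ih fun j hj => hg j (Finset.mem_insert_of_mem hj))

theorem HasDecay.inv_one_sub (h0 : ρ ⊥ = 0) (hsup : ∀ p q, ρ (p ⊔ q) ≤ ρ p + ρ q)
    {t : I → ℕ → ℝ} (ht : HasDecay ρ t) (ht' : ∀ q, t q =O[atTop] fun N => (N : ℝ)⁻¹) :
    HasDecay ρ fun q N => (1 - t q N)⁻¹ := by
  obtain ⟨K, hK⟩ : ∃ K, ∀ p, ρ p ≤ K :=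
    ⟨∑ p, ρ p, fun p => Finset.single_le_sum (fun _ _ => Nat.zero_le _) (Finset.mem_univ p)⟩
  have hlim : ∀ q, Tendsto (t q) atTop (nhds 0) := fun q =>
    (ht' q).trans_tendsto tendsto_inv_atTop_nhds_zero_nat
  have hlim' : ∀ q, Tendsto (fun N => (1 - t q N)⁻¹) atTop (nhds 1) := fun q => by
    simpa using ((tendsto_const_nhds (x := (1 : ℝ))).sub (hlim q)).inv₀ (by simp)
  have hne : ∀ᶠ N in atTop, ∀ q, 1 - t q N ≠ 0 := by
    refine eventually_all.2 fun q => ?_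
    filter_upwards [(hlim q).eventually_ne (zero_ne_one)] with N h h'
    exact h (sub_eq_zero.1 h').symm
  have hpow : ∀ k : ℕ, HasDecay ρ fun q N => t q N ^ k := by
    intro k
    have := HasDecay.finset_prod h0 hsup (Finset.range k) (g := fun _ => t) fun _ _ => ht
    simpa using this
  have hrem : HasDecay ρ fun q N => t q N ^ K * (1 - t q N)⁻¹ := by
    refine HasDecay.of_isBigO hK fun q => ?_
    simpa using ((ht' q).pow K).mul ((hlim' q).isBigO_one ℝ)
  refine ((HasDecay.finset_sum h0 (Finset.range K) fun k _ => hpow k).add hrem).congr ?_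
  filter_upwards [hne] with N h q
  have := geom_sum_mul_neg (t q N) K
  refine eq_inv_of_mul_eq_one_left ?_
  rw [add_mul, this, mul_assoc, inv_mul_cancel₀ (h q)]
  ring

end DecayingSums

section RelativeRank

variable {G : Type} [Group G] {P Q Q' : Subgroup G}

/-- The least number of elements that generate `Q` together with `P`. -/
noncomputable def relativeRank (P Q : Subgroup G) : ℕ :=
  sInf {k | ∃ s : Fin k → G, Q = P ⊔ Subgroup.closure (Set.range s)}

theorem relativeRank_le {k : ℕ} (s : Fin k → G) (h : Q = P ⊔ Subgroup.closure (Set.range s)) :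
    relativeRank P Q ≤ k :=
  Nat.sInf_le ⟨s, h⟩

theorem exists_eq_sup_closure (hPQ : P ≤ Q) (hQ : Q.FG) :
    ∃ s : Fin (relativeRank P Q) → G, Q = P ⊔ Subgroup.closure (Set.range s) := by
  refine Nat.sInf_mem (s := {k | ∃ s : Fin k → G, Q = P ⊔ Subgroup.closure (Set.range s)}) ?_
  obtain ⟨S, hS, hfin⟩ := (Subgroup.fg_iff Q).1 hQ
  have := hfin.to_subtype
  refine ⟨Nat.card S, fun i => ((Finite.equivFin S).symm i : S), ?_⟩
  have : Set.range (fun i => (((Finite.equivFin S).symm i : S) : G)) = S := by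
    rw [← Function.comp_def, EquivLike.range_comp Subtype.val, Subtype.range_val]
  rw [this, hS, sup_eq_right.2 hPQ]

theorem relativeRank_self : relativeRank P P = 0 :=
  Nat.le_zero.1 (relativeRank_le Fin.elim0 (by simp))

theorem relativeRank_sup_closure_singleton (g : G) :
    relativeRank P (P ⊔ Subgroup.closure {g}) ≤ 1 :=
  relativeRank_le (fun _ => g) (by rw [Set.range_const])

theorem relativeRank_sup_le (hPQ : P ≤ Q) (hQ : Q.FG) (hPQ' : P ≤ Q') (hQ' : Q'.FG) :
    relativeRank P (Q ⊔ Q') ≤ relativeRank P Q + relativeRank P Q' := by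
  obtain ⟨s, hs⟩ := exists_eq_sup_closure hPQ hQ
  obtain ⟨s', hs'⟩ := exists_eq_sup_closure hPQ' hQ'
  refine relativeRank_le (Fin.append s s') ?_
  have h : Set.range (Fin.append s s') = Set.range s ∪ Set.range s' := by
    ext g
    simp only [Set.mem_range, Set.mem_union]
    constructor
    · rintro ⟨i, rfl⟩
      induction i using Fin.addCases with
      | left i => exact Or.inl ⟨i, by simp⟩
      | right i => exact Or.inr ⟨i, by simp⟩
    · rintro (⟨i, rfl⟩ | ⟨i, rfl⟩)
      · exact ⟨Fin.castAdd _ i, by simp⟩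
      · exact ⟨Fin.natAdd _ i, by simp⟩
  rw [h, Subgroup.closure_union, sup_sup_distrib_left, ← hs, ← hs']

end RelativeRank

section StabilizerAsymptotics

open Filter Asymptotics

theorem priorCount_le {n : ℕ} {Y : Type} (π : Fin n → Y) (i : Fin n) : priorCount π i ≤ n := by
  refine (Nat.card_le_card_of_injective _ Subtype.val_injective).trans ?_
  simp

theorem priorCount_eq_zero {n : ℕ} {Y : Type} {π : Fin n → Y} (hπ : Function.Injective π)
    (i : Fin n) : priorCount π i = 0 := by
  have : IsEmpty {j : Fin n // j < i ∧ π j = π i} := ⟨fun j => j.2.1.ne (hπ j.2.2)⟩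
  exact Nat.card_of_isEmpty

theorem priorCount_div_isBigO {n : ℕ} {Y : Type} (π : Fin n → Y) (i : Fin n) :
    (fun N : ℕ => (priorCount π i : ℝ) / N) =O[atTop] fun N => (N : ℝ)⁻¹ := by
  simp only [div_eq_mul_inv]
  exact isBigO_const_mul_self _ _ _

variable {I : Type} [Fintype I] [SemilatticeSup I] [OrderBot I] {ρ : I → ℕ}

theorem HasDecay.priorCount_div (h0 : ρ ⊥ = 0) {n : ℕ} {Y : I → Type} (π : ∀ q, Fin n → Y q)
    (hπ : ∀ i j, (∃ c, ρ c ≤ 1 ∧ ∀ q, π q j = π q i ↔ c ≤ q) ∨ ∀ q, π q j ≠ π q i) (i : Fin n) :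
    HasDecay ρ fun q N => (priorCount (π q) i : ℝ) / N := by
  classical
  have h : ∀ q (N : ℕ), (priorCount (π q) i : ℝ) / N =
      ∑ j with j < i, if π q j = π q i then (N : ℝ)⁻¹ else 0 := by
    intro q N
    rw [← Finset.sum_filter, Finset.filter_filter, Finset.sum_const, nsmul_eq_mul, priorCount,
      Nat.card_eq_fintype_card, Fintype.card_subtype, div_eq_mul_inv]
  simp only [h]
  refine HasDecay.finset_sum h0 _ fun j _ => ?_
  rcases hπ i j with ⟨c, hc, hq⟩ | hq
  · simp only [hq]
    refine HasDecay.single (IsBigO.trans ?_ (isBigO_inv_pow hc))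
    simpa using isBigO_refl _ _
  · simpa [hq] using HasDecay.const h0 0

variable {α : Type} {W : Set (FreeGroup α)} {E : Set (FreeGroup α × α)}
  {P : Subgroup (FreeGroup α)}

/-- The finitely many subgroups that are spanned by a finite set of vertices. -/
noncomputable def spannedSubgroups (hW : W.Finite) : Finset (Subgroup (FreeGroup α)) :=
  (finite_setOf_spannedBy_eq hW).toFinset

theorem mem_spannedSubgroups {hW : W.Finite} {Q : Subgroup (FreeGroup α)} :
    Q ∈ spannedSubgroups hW ↔ spannedBy W Q = Q := by
  simp [spannedSubgroups]

theorem IsRootedGraph.stabilizerCount_div (hΓ : IsRootedGraph W E) {Q : Subgroup (FreeGroup α)}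
    (hPQ : P ≤ Q) (hQ : spannedBy W Q = Q) {n l N : ℕ}
    {a : Fin n → FreeGroup α} (haW : ∀ i, a i ∈ W)
    (ha : ∀ i j, (a i : FreeGroup α ⧸ P) = a j → i = j)
    (haW' : ∀ u ∈ W, ∃ i, (a i : FreeGroup α ⧸ P) = u)
    {c : Fin l → FreeGroup α × α} (hcE : ∀ k, c k ∈ E)
    (hc : ∀ k k', (((c k).1 : FreeGroup α ⧸ P), (c k).2) = (((c k').1 : FreeGroup α ⧸ P), (c k').2)
      → k = k')
    (hcE' : ∀ e ∈ E, ∃ k, (((c k).1 : FreeGroup α ⧸ P), (c k).2) =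
      ((e.1 : FreeGroup α ⧸ P), e.2)) (hn : n < N) (hl : l < N) {p : ℕ} (hp : p + n = l + 1) :
    (stabilizerCount W P Q N : ℝ) / Nat.card (Q →* Equiv.Perm (Fin N)) = (N : ℝ) ^ (1 - p : ℤ) *
      ((∏ i, (1 - (priorCount (fun i => (a i : FreeGroup α ⧸ Q)) i : ℝ) / N)) *
        ∏ k, (1 - (priorCount (fun k => (((c k).1 : FreeGroup α ⧸ Q), (c k).2)) k : ℝ) / N)⁻¹) := by
  have hN : (N : ℝ) ≠ 0 := by
    have : 0 < N := by omega
    positivity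
  have hcast : ∀ {n : ℕ} {Y : Type} (π : Fin n → Y), n < N →
      ((∏ i, (N - priorCount π i) : ℕ) : ℝ) = N ^ n * ∏ i, (1 - (priorCount π i : ℝ) / N) := by
    intro n Y π hn
    have : ∀ i, ((N - priorCount π i : ℕ) : ℝ) = N * (1 - (priorCount π i : ℝ) / N) := by
      intro i
      rw [Nat.cast_sub ((priorCount_le π i).trans hn.le)]
      field_simp
    rw [Nat.cast_prod, Finset.prod_congr rfl fun i _ => this i, Finset.prod_mul_distrib]
    simp
  have h := hΓ.stabilizerCount_mul_prod (N := N) hPQ hQ haW ha haW' hcE hc hcE'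
  have h' := congrArg (Nat.cast : ℕ → ℝ) h
  rw [Nat.cast_mul, Nat.cast_mul, hcast _ hn, hcast _ hl] at h'
  have hfin : Finite (Q →* Equiv.Perm (Fin N)) := by
    obtain ⟨k, hk⟩ := HasFreeRank.exists_of_fg (hQ ▸ spannedBy_fg hΓ.finite_vertices : Q.FG)
    exact hk.finite_hom _
  have hcard : (Nat.card (Q →* Equiv.Perm (Fin N)) : ℝ) ≠ 0 :=
    Nat.cast_ne_zero.2 Nat.card_pos.ne'
  have hprod : ∏ k, (1 - (priorCount (fun k => (((c k).1 : FreeGroup α ⧸ Q), (c k).2)) k : ℝ) / N)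
      ≠ 0 := by
    refine Finset.prod_ne_zero_iff.2 fun k _ => ?_
    have h₁ : (priorCount (fun k => (((c k).1 : FreeGroup α ⧸ Q), (c k).2)) k : ℝ) < N :=
      Nat.cast_lt.2 ((priorCount_le _ k).trans_lt hl)
    rw [sub_ne_zero]
    intro h₂
    rw [eq_div_iff hN, one_mul] at h₂
    exact h₁.ne h₂.symm
  have hpow : (N : ℝ) ^ (1 - p : ℤ) * (N : ℝ) ^ l = (N : ℝ) ^ n := by
    rw [← zpow_natCast, ← zpow_natCast, ← zpow_add₀ hN]
    congr 1
    omega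
  rw [Finset.prod_inv_distrib, div_eq_iff hcard]
  refine mul_right_cancel₀ (mul_ne_zero (pow_ne_zero l hN) hprod) (h'.trans ?_)
  rw [← hpow]
  generalize ∏ k, (1 - (priorCount (fun k => (((c k).1 : FreeGroup α ⧸ Q), (c k).2)) k : ℝ) / N) = y
    at hprod ⊢
  generalize ∏ i, (1 - (priorCount (fun i => (a i : FreeGroup α ⧸ Q)) i : ℝ) / N) = x
  field_simp

open scoped Classical in
/-- The expansion of the expected number of points with stabilizer of type `P`. -/
theorem IsRootedGraph.exists_stabilizerCount_expansion (hΓ : IsRootedGraph W E)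
    (hP : spannedBy W P = P) {p : ℕ} (hp : HasFreeRank P p) :
    ∃ C : Subgroup (FreeGroup α) → ℕ → ℝ,
      (∀ᶠ N in atTop, ∀ Q, P ≤ Q → spannedBy W Q = Q →
        (stabilizerCount W P Q N : ℝ) / Nat.card (Q →* Equiv.Perm (Fin N)) =
          ∑ R ∈ spannedSubgroups hΓ.finite_vertices with P ≤ R ∧ R ≤ Q, C R N) ∧
      (∀ R, C R =O[atTop] fun N => (N : ℝ) ^ (1 - p - relativeRank P R : ℤ)) ∧
      ∀ᶠ N in atTop, C P N = (N : ℝ) ^ (1 - p : ℤ) := by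
  let I := {Q : Subgroup (FreeGroup α) // P ≤ Q ∧ spannedBy W Q = Q}
  have hfin : Finite I :=
    ((finite_setOf_spannedBy_eq hΓ.finite_vertices).subset fun Q h => h.2).to_subtype
  let _ : Fintype I := Fintype.ofFinite I
  let _ : SemilatticeSup I := Subtype.semilatticeSup fun Q Q' h h' =>
    ⟨h.1.trans le_sup_left, spannedBy_sup h.2 h'.2⟩
  let _ : OrderBot I := { bot := ⟨P, le_rfl, hP⟩, bot_le := fun Q => Q.2.1 }
  have hfg : ∀ Q : I, (Q : Subgroup (FreeGroup α)).FG := fun Q =>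
    Q.2.2 ▸ spannedBy_fg hΓ.finite_vertices
  let ρ : I → ℕ := fun Q => relativeRank P Q
  have h0 : ρ ⊥ = 0 := relativeRank_self
  have hsup : ∀ Q Q', ρ (Q ⊔ Q') ≤ ρ Q + ρ Q' := fun Q Q' =>
    relativeRank_sup_le Q.2.1 (hfg Q) Q'.2.1 (hfg Q')
  obtain ⟨a, haW, ha, haW'⟩ := exists_enumeration hΓ.finite_vertices
    fun u : FreeGroup α => (u : FreeGroup α ⧸ P)
  obtain ⟨c, hcE, hc, hcE'⟩ := exists_enumeration hΓ.finite_edges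
    fun e : FreeGroup α × α => ((e.1 : FreeGroup α ⧸ P), e.2)
  have hrank := hΓ.rank_add_card hP hp
  have hjoin : ∀ u ∈ W, ∀ v ∈ W, ∃ C : I, ρ C ≤ 1 ∧ ∀ Q : I,
      (u : FreeGroup α ⧸ (Q : Subgroup (FreeGroup α))) = v ↔ C ≤ Q := by
    intro u hu v hv
    have h : spannedBy W (Subgroup.closure {u⁻¹ * v}) = Subgroup.closure {u⁻¹ * v} := by
      refine le_antisymm (spannedBy_le _ _) ((Subgroup.closure_le _).2 ?_)
      rintro _ rfl
      exact (mem_spannedBy_iff hu hv).2 (Subgroup.subset_closure rfl)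
    refine ⟨⟨P ⊔ Subgroup.closure {u⁻¹ * v}, le_sup_left, spannedBy_sup hP h⟩,
      relativeRank_sup_closure_singleton _, fun Q => ?_⟩
    rw [QuotientGroup.eq, ← Subtype.coe_le_coe]
    simp [Q.2.1]
  have hdecay : HasDecay ρ fun Q N =>
      (∏ i, (1 - (priorCount (fun i => (a i : FreeGroup α ⧸ (Q : Subgroup (FreeGroup α)))) i : ℝ)
        / N)) *
        ∏ k, (1 - (priorCount (fun k => (((c k).1 : FreeGroup α ⧸ (Q : Subgroup (FreeGroup α))),
          (c k).2)) k : ℝ) / N)⁻¹ := by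
    refine HasDecay.mul hsup (HasDecay.finset_prod h0 hsup _ fun i _ => ?_)
      (HasDecay.finset_prod h0 hsup _ fun k _ => ?_)
    · have h := HasDecay.priorCount_div (ρ := ρ) h0
        (fun (Q : I) i => (a i : FreeGroup α ⧸ (Q : Subgroup (FreeGroup α))))
        (fun i j => Or.inl (hjoin _ (haW j) _ (haW i))) i
      simpa [sub_eq_add_neg] using (HasDecay.const h0 1).add ((HasDecay.const h0 (-1)).mul hsup h)
    · refine HasDecay.inv_one_sub h0 hsup ?_ fun Q => priorCount_div_isBigO _ _
      refine HasDecay.priorCount_div (ρ := ρ) h0 (fun (Q : I) k =>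
        (((c k).1 : FreeGroup α ⧸ (Q : Subgroup (FreeGroup α))), (c k).2)) (fun k k' => ?_) k
      by_cases h : (c k').2 = (c k).2
      · obtain ⟨C, hC, hC'⟩ :=
          hjoin _ (hΓ.source_mem _ (hcE k')) _ (hΓ.source_mem _ (hcE k))
        exact Or.inl ⟨C, hC, fun Q => by rw [← hC', Prod.mk.injEq, and_iff_left h]⟩
      · exact Or.inr fun Q h' => h (Prod.mk.injEq _ _ _ _ ▸ h').2
  obtain ⟨C, hC, hC'⟩ := hdecay
  refine ⟨fun R N => if h : P ≤ R ∧ spannedBy W R = R then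
    (N : ℝ) ^ (1 - p : ℤ) * C ⟨R, h⟩ N else 0, ?_, fun R => ?_, ?_⟩
  · filter_upwards [hC, eventually_gt_atTop (Nat.card (vertexImage W P)),
      eventually_gt_atTop (Nat.card (edgeImage E P))] with N hN hn hl Q hPQ hQ
    rw [hΓ.stabilizerCount_div hPQ hQ haW ha haW' hcE hc hcE' hn hl hrank, hN ⟨Q, hPQ, hQ⟩,
      Finset.mul_sum, Finset.sum_filter, ← Finset.filter_filter, Finset.sum_filter,
      Finset.sum_subtype _ (p := fun R => P ≤ R ∧ spannedBy W R = R)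
        (fun R => by rw [Finset.mem_filter, mem_spannedSubgroups, and_comm])]
    refine Finset.sum_congr rfl fun R _ => ?_
    rw [dif_pos R.2]
    rfl
  · by_cases h : P ≤ R ∧ spannedBy W R = R
    · simp only [dif_pos h]
      refine ((isBigO_refl (fun N : ℕ => (N : ℝ) ^ (1 - p : ℤ)) atTop).mul
        (hC' ⟨R, h⟩)).congr' (EventuallyEq.rfl) ?_
      filter_upwards [eventually_ne_atTop 0] with N hN
      rw [inv_pow, ← zpow_natCast, ← zpow_neg, ← zpow_add₀ (Nat.cast_ne_zero.2 hN)]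
      rfl
    · simpa [dif_neg h] using isBigO_zero _ _
  · filter_upwards [hC] with N hN
    have h := hN ⊥
    have hone : ∀ i, priorCount (fun i => (a i : FreeGroup α ⧸
        ((⊥ : I) : Subgroup (FreeGroup α)))) i = 0 := fun i => priorCount_eq_zero (fun i j => ha i j) i
    have hone' : ∀ k, priorCount (fun k => (((c k).1 : FreeGroup α ⧸
        ((⊥ : I) : Subgroup (FreeGroup α))), (c k).2)) k = 0 :=
      fun k => priorCount_eq_zero (fun k k' => hc k k') k
    have hbot : (Finset.univ.filter fun R : I => R ≤ ⊥) = {⊥} := by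
      ext R
      simp
    rw [hbot, Finset.sum_singleton] at h
    simp only [hone, hone'] at h
    rw [dif_pos ⟨le_rfl, hP⟩]
    have h' : (1 : ℝ) = C ⊥ N := by simpa using h
    exact (congrArg _ h'.symm).trans (mul_one _)

end StabilizerAsymptotics

section FixedPointMean

variable {G : Type} [Group G]

/-- The number of pairs of an action of `K` on `Fin N` and a point fixed by `H`. -/
noncomputable def fixedCount (H K : Subgroup G) (N : ℕ) : ℕ :=
  Nat.card {z : (K →* Equiv.Perm (Fin N)) × Fin N // ∀ k : K, (k : G) ∈ H → z.1 k z.2 = z.2}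

/-- The expected number of points fixed by `H` in a random action of `K` on `Fin N`. -/
noncomputable def fixedMean (H K : Subgroup G) (N : ℕ) : ℝ :=
  (fixedCount H K N : ℝ) / Nat.card (K →* Equiv.Perm (Fin N))

theorem Phi_eq_fixedMean {m : ℕ} (N : ℕ) (H : Subgroup (FreeGroup (Fin m)))
    {ι : FreeGroup (Fin m) →* G} (hι : Function.Injective ι) :
    (Phi m N H : ℝ) = fixedMean (H.map ι) ι.range N := by
  let e : (Fin m → Equiv.Perm (Fin N)) ≃ (ι.range →* Equiv.Perm (Fin N)) :=
    FreeGroup.lift.trans (MonoidHom.ofInjective hι).monoidHomCongrLeftEquiv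
  have he : ∀ f x, e f ⟨ι x, x, rfl⟩ = FreeGroup.lift f x := by
    intro f x
    have : (MonoidHom.ofInjective hι).symm ⟨ι x, x, rfl⟩ = x :=
      (MonoidHom.ofInjective hι).symm_apply_apply x
    exact congrArg (FreeGroup.lift f) this
  have h₁ : fixedCount (H.map ι) ι.range N = ∑ f : Fin m → Equiv.Perm (Fin N),
      Nat.card {x : Fin N // ∀ h ∈ H, (FreeGroup.lift f) h x = x} := by
    rw [← Nat.card_sigma, fixedCount]
    refine Nat.card_congr (Equiv.symm ?_)
    refine (Equiv.subtypeProdEquivSigmaSubtype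
      fun (f : Fin m → Equiv.Perm (Fin N)) (x : Fin N) =>
        ∀ h ∈ H, (FreeGroup.lift f) h x = x).symm.trans
      (Equiv.subtypeEquiv (Equiv.prodCongr e (Equiv.refl _)) ?_)
    rintro ⟨f, x⟩
    constructor
    · rintro h ⟨_, y, rfl⟩ ⟨y', hy', hyy'⟩
      obtain rfl := hι hyy'
      simpa [he] using h y' hy'
    · intro h y hy
      simpa [he] using h ⟨ι y, y, rfl⟩ ⟨y, hy, rfl⟩
  rw [fixedMean, h₁, Phi, ← Nat.card_congr e, Nat.card_eq_fintype_card]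
  push_cast
  rfl

theorem IsFreeFactorOf.fixedMean_eq [IsFreeGroup G] {A J H : Subgroup G} (hA : IsFreeFactorOf A J)
    (hJ : J.FG) (hHA : H ≤ A) (N : ℕ) : fixedMean H A N = fixedMean H J N := by
  obtain ⟨k, hk⟩ := HasFreeRank.exists_of_fg hJ
  have hfin := hk.finite_hom (Equiv.Perm (Fin N))
  rw [isFreeFactorOf_iff] at hA
  obtain ⟨A', hAJ, hA'J, hs, hu⟩ := hA
  let e : (J →* Equiv.Perm (Fin N)) ≃ (A →* Equiv.Perm (Fin N)) × (A' →* Equiv.Perm (Fin N)) :=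
    Equiv.ofBijective (fun φ => (φ.comp (Subgroup.inclusion hAJ), φ.comp (Subgroup.inclusion hA'J)))
      ⟨fun φ ψ h => MonoidHom.eq_of_eq_on_sup hAJ hA'J hs φ ψ
          (fun x hx => DFunLike.congr_fun (congrArg Prod.fst h) ⟨x, hx⟩)
          (fun x hx => DFunLike.congr_fun (congrArg Prod.snd h) ⟨x, hx⟩), fun p => by
        obtain ⟨φ, h₁, h₂⟩ := hu _ p.1 p.2
        exact ⟨φ, Prod.ext (MonoidHom.ext fun x => h₁ x x.2) (MonoidHom.ext fun x => h₂ x x.2)⟩⟩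
  have h₁ : Nat.card (J →* Equiv.Perm (Fin N)) =
      Nat.card (A →* Equiv.Perm (Fin N)) * Nat.card (A' →* Equiv.Perm (Fin N)) := by
    rw [← Nat.card_prod, Nat.card_congr e]
  have h₂ : fixedCount H J N = fixedCount H A N * Nat.card (A' →* Equiv.Perm (Fin N)) := by
    rw [fixedCount, fixedCount, ← Nat.card_prod]
    refine Nat.card_congr
      { toFun := fun z => (⟨((e z.1.1).1, z.1.2), fun k hk => z.2 ⟨k, hAJ k.2⟩ hk⟩, (e z.1.1).2)
        invFun := fun z => ⟨(e.symm (z.1.1.1, z.2), z.1.1.2), ?_⟩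
        left_inv := ?_
        right_inv := ?_ }
    · intro k hk
      have h := z.1.2 ⟨k, hHA hk⟩ hk
      have h' : e (e.symm (z.1.1.1, z.2)) = (z.1.1.1, z.2) := e.apply_symm_apply _
      have h'' := DFunLike.congr_fun (congrArg Prod.fst h') ⟨k, hHA hk⟩
      rw [← h''] at h
      exact h
    · rintro ⟨⟨φ, i⟩, h⟩
      simp
    · rintro ⟨⟨⟨φ, i⟩, h⟩, ψ⟩
      simp
  have hpos : Nat.card (A' →* Equiv.Perm (Fin N)) ≠ 0 := by
    intro h
    rw [h, mul_zero] at h₁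
    exact Nat.card_pos.ne' h₁
  rw [fixedMean, fixedMean, h₁, h₂]
  push_cast
  rw [mul_div_mul_right _ _ (Nat.cast_ne_zero.2 hpos)]

end FixedPointMean

section StabilizerDecomposition

variable {α : Type} {W : Set (FreeGroup α)} {E : Set (FreeGroup α × α)}
  {H Q : Subgroup (FreeGroup α)}

/-- The stabilizer in `Q` of a point. -/
def pointStabilizer {N : ℕ} (z : (Q →* Equiv.Perm (Fin N)) × Fin N) : Subgroup (FreeGroup α) where
  carrier := {g | ∃ h : g ∈ Q, z.1 ⟨g, h⟩ z.2 = z.2}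
  one_mem' := ⟨Q.one_mem, by
    rw [show (⟨1, Q.one_mem⟩ : Q) = 1 from rfl, map_one, Equiv.Perm.one_apply]⟩
  mul_mem' := by
    rintro g g' ⟨h, hg⟩ ⟨h', hg'⟩
    refine ⟨Q.mul_mem h h', ?_⟩
    rw [show (⟨g * g', Q.mul_mem h h'⟩ : Q) = ⟨g, h⟩ * ⟨g', h'⟩ from rfl, map_mul,
      Equiv.Perm.mul_apply, hg', hg]
  inv_mem' := by
    rintro g ⟨h, hg⟩
    refine ⟨Q.inv_mem h, ?_⟩
    rw [show (⟨g⁻¹, Q.inv_mem h⟩ : Q) = ⟨g, h⟩⁻¹ from rfl, map_inv, Equiv.Perm.inv_eq_iff_eq, hg]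

open scoped Classical in
theorem fixedCount_eq_sum {T : Set (FreeGroup α)} (hT : Subgroup.closure T = H)
    (hW : W.Finite) (h1 : 1 ∈ W) (hTW : T ⊆ W) (hHQ : H ≤ Q) (hQ : spannedBy W Q = Q) (N : ℕ) :
    fixedCount H Q N =
      ∑ P ∈ spannedSubgroups hW with H ≤ P ∧ P ≤ Q, stabilizerCount W P Q N := by
  have hfin : Finite (Q →* Equiv.Perm (Fin N)) := by
    obtain ⟨k, hk⟩ := HasFreeRank.exists_of_fg (hQ ▸ spannedBy_fg hW : Q.FG)
    exact hk.finite_hom _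
  let _ := Fintype.ofFinite (Q →* Equiv.Perm (Fin N))
  have hfix : ∀ z : (Q →* Equiv.Perm (Fin N)) × Fin N,
      (∀ k : Q, (k : FreeGroup α) ∈ H → z.1 k z.2 = z.2) ↔ H ≤ spannedBy W (pointStabilizer z) := by
    intro z
    constructor
    · exact fun h => le_spannedBy hT h1 hTW fun g hg => ⟨hHQ hg, h ⟨g, hHQ hg⟩ hg⟩
    · exact fun h k hk => (spannedBy_le _ _ (h hk)).2
  rw [fixedCount, Nat.card_eq_fintype_card, Fintype.card_subtype,
    Finset.card_eq_sum_card_fiberwise (f := fun z => spannedBy W (pointStabilizer z))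
      (t := (spannedSubgroups hW).filter fun P => H ≤ P ∧ P ≤ Q)]
  · refine Finset.sum_congr rfl fun P hP => ?_
    rw [Finset.mem_filter, mem_spannedSubgroups] at hP
    rw [stabilizerCount, Nat.card_eq_fintype_card, Fintype.card_subtype, Finset.filter_filter]
    congr 1
    ext z
    simp only [Finset.mem_filter, Finset.mem_univ, true_and, hfix]
    constructor
    · rintro ⟨-, rfl⟩ u hu v hv
      exact mem_spannedBy_iff hu hv
    · intro h
      have : spannedBy W (pointStabilizer z) = P := by
        rw [← hP.1, spannedBy, spannedBy]
        congr 1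
        ext g
        refine and_congr_left ?_
        rintro ⟨u, hu, v, hv, rfl⟩
        exact (h u hu v hv).symm
      exact ⟨this ▸ hP.2.1, this⟩
  · intro z hz
    simp only [Finset.coe_filter, Finset.mem_univ, true_and, Set.mem_ofPred_eq, hfix] at hz ⊢
    exact ⟨mem_spannedSubgroups.2 spannedBy_spannedBy, hz,
      (spannedBy_le _ _).trans fun g hg => hg.1⟩

end StabilizerDecomposition

section Expansion

open Filter Asymptotics

open scoped Classical in
theorem eq_of_sum_le_eq {I A : Type} [Fintype I] [PartialOrder I] [AddCommGroup A] {C C' : I → A}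
    (h : ∀ q, ∑ p with p ≤ q, C p = ∑ p with p ≤ q, C' p) : C = C' := by
  funext q
  induction q using WellFoundedLT.induction with
  | ind q ih =>
    have hq := h q
    rwa [sum_le_eq_add_sum_lt, sum_le_eq_add_sum_lt,
      Finset.sum_congr rfl fun p hp => ih p (Finset.mem_filter.1 hp).2, add_left_inj] at hq

variable {α : Type} {W : Set (FreeGroup α)} {E : Set (FreeGroup α × α)}
  {H : Subgroup (FreeGroup α)} {T : Set (FreeGroup α)}

/-- The subgroups above `H` that are spanned by `W`. -/
abbrev SpannedOver (W : Set (FreeGroup α)) (H : Subgroup (FreeGroup α)) : Type :=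
  {Q : Subgroup (FreeGroup α) // H ≤ Q ∧ spannedBy W Q = Q}

open scoped Classical in
theorem sum_spannedSubgroups {A : Type} [AddCommMonoid A] (hW : W.Finite)
    [Fintype (SpannedOver W H)] (p : Subgroup (FreeGroup α) → Prop)
    (f : Subgroup (FreeGroup α) → A) :
    ∑ P ∈ spannedSubgroups hW with H ≤ P ∧ p P, f P = ∑ P : SpannedOver W H with p P.1, f P.1 := by
  refine Eq.trans (Finset.sum_congr ?_ fun _ _ => rfl)
    (Finset.sum_map (Finset.univ.filter fun P : SpannedOver W H => p P.1)
      (Function.Embedding.subtype _) f)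
  ext R
  simp only [Finset.mem_filter, mem_spannedSubgroups, Finset.mem_map, Finset.mem_univ, true_and,
    Function.Embedding.subtype_apply]
  exact ⟨fun h => ⟨⟨R, h.2.1, h.1⟩, h.2.2, rfl⟩,
    fun ⟨P, hP, h⟩ => h ▸ ⟨P.2.2, P.2.1, hP⟩⟩

open scoped Classical in
theorem IsRootedGraph.eventually_fixedMean_eq (hΓ : IsRootedGraph W E)
    (hT : Subgroup.closure T = H) (hTW : T ⊆ W) [Fintype (SpannedOver W H)]
    {D : Subgroup (FreeGroup α) → Subgroup (FreeGroup α) → ℕ → ℝ}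
    (hD : ∀ P : SpannedOver W H, ∀ᶠ N in atTop, ∀ Q, P.1 ≤ Q → spannedBy W Q = Q →
        (stabilizerCount W P.1 Q N : ℝ) / Nat.card (Q →* Equiv.Perm (Fin N)) =
          ∑ R ∈ spannedSubgroups hΓ.finite_vertices with P.1 ≤ R ∧ R ≤ Q, D P.1 R N) :
    ∀ᶠ N in atTop, ∀ Q : SpannedOver W H, fixedMean H Q N =
      ∑ R : SpannedOver W H with R ≤ Q, ∑ P : SpannedOver W H with P ≤ R, D P R N := by
  filter_upwards [eventually_all.2 hD] with N hN Q
  rw [fixedMean, fixedCount_eq_sum hT hΓ.finite_vertices hΓ.one_mem hTW Q.2.1 Q.2.2,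
    sum_spannedSubgroups, Nat.cast_sum, Finset.sum_div]
  have h : ∀ P ∈ (Finset.univ.filter fun P : SpannedOver W H => P.1 ≤ Q.1),
      (stabilizerCount W P Q N : ℝ) / Nat.card (Q →* Equiv.Perm (Fin N)) =
        ∑ R : SpannedOver W H with P ≤ R ∧ R ≤ Q, D P R N := by
    intro P hP
    rw [hN P Q (Finset.mem_filter.1 hP).2 Q.2.2]
    refine ((Finset.sum_congr ?_ fun _ _ => rfl).trans (sum_spannedSubgroups (H := H)
      hΓ.finite_vertices (fun R => P.1 ≤ R ∧ R ≤ Q.1) fun R => D P.1 R N)).trans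
      (Finset.sum_congr (by ext R; simp) fun _ _ => rfl)
    ext R
    simp only [Finset.mem_filter, and_congr_right_iff]
    exact fun _ => ⟨fun h => ⟨P.2.1.trans h.1, h⟩, fun h => h.2⟩
  rw [Finset.sum_congr rfl h]
  refine Finset.sum_comm' fun P R => ?_
  simp only [Finset.mem_filter, Finset.mem_univ, true_and]
  exact ⟨fun h => ⟨h.2.1, h.2.2⟩, fun h => ⟨h.1.trans h.2, h.1, h.2⟩⟩

theorem isBigO_zpow_of_le {a b : ℤ} (h : a ≤ b) :
    (fun N : ℕ => (N : ℝ) ^ a) =O[atTop] fun N => (N : ℝ) ^ b := by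
  refine IsBigO.of_bound 1 ?_
  filter_upwards [eventually_ge_atTop 1] with N hN
  rw [one_mul, Real.norm_of_nonneg (by positivity), Real.norm_of_nonneg (by positivity)]
  exact zpow_le_zpow_right₀ (Nat.one_le_cast.2 hN) h

theorem IsAlgebraicExtensionOf.lt_rank_add {P M : Subgroup (FreeGroup α)}
    (hM : IsAlgebraicExtensionOf H M) (hHP : H ≤ P) (hPM : P < M) {p k : ℕ}
    (hp : HasFreeRank P p) (hk : HasFreeRank M k) : k + 1 ≤ p + relativeRank P M := by
  obtain ⟨s, hs⟩ := exists_eq_sup_closure hPM.le hk.fg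
  have h := hp.rank_sup_closure hk s hs
  refine lt_of_le_of_ne h.1 fun h' => hPM.ne ?_
  exact hM.2 _ hHP (h.2 h')

open scoped Classical in
theorem IsRootedGraph.exists_fixedMean_expansion (hΓ : IsRootedGraph W E) (hTf : T.Finite)
    (hT : Subgroup.closure T = H) (hTW : T ⊆ W) :
    ∃ R : Subgroup (FreeGroup α) → ℕ → ℝ,
      (∀ K : Subgroup (FreeGroup α), K.FG → H ≤ K → ∀ N, fixedMean H K N =
        ∑ M ∈ spannedSubgroups hΓ.finite_vertices with IsAlgebraicExtensionOf H M ∧ M ≤ K, R M N) ∧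
      ∀ M, IsAlgebraicExtensionOf H M → ∀ k, HasFreeRank M k →
        (fun N => R M N - (N : ℝ) ^ (1 - k : ℤ)) =O[atTop] fun N => (N : ℝ) ^ (-k : ℤ) := by
  have hH : H.FG := (Subgroup.fg_iff H).2 ⟨T, hT, hTf⟩
  have hfin : Finite (SpannedOver W H) :=
    ((finite_setOf_spannedBy_eq hΓ.finite_vertices).subset fun Q h => h.2).to_subtype
  let _ : Fintype (SpannedOver W H) := Fintype.ofFinite _
  have hfg : ∀ Q : SpannedOver W H, (Q : Subgroup (FreeGroup α)).FG := fun Q =>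
    Q.2.2 ▸ spannedBy_fg hΓ.finite_vertices
  have halg : ∀ M, IsAlgebraicExtensionOf H M → H ≤ M ∧ spannedBy W M = M := fun M hM =>
    ⟨hM.1, hM.spannedBy_eq hTf hT hΓ hTW⟩
  obtain ⟨R, hR⟩ := exists_sum_le_eq fun (Q : SpannedOver W H) N => fixedMean H Q N
  replace hR : ∀ (Q : SpannedOver W H) N, fixedMean H Q N =
      ∑ P : SpannedOver W H with P ≤ Q, R P N := fun Q N => by
    rw [← Finset.sum_apply, ← hR Q]
  have hzero : ∀ Q : SpannedOver W H, ¬ IsAlgebraicExtensionOf H (Q : Subgroup (FreeGroup α)) →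
      R Q = 0 := by
    intro Q
    induction Q using WellFoundedLT.induction with
    | ind Q ih =>
      intro hQ
      obtain ⟨A, hHA, hAQ⟩ := exists_algebraic_hull (hfg Q) Q.2.1
      have hne : A ≠ Q := fun h => hQ (h ▸ hHA)
      funext N
      have h₁ := hAQ.fixedMean_eq (hfg Q) hHA.1 N
      rw [hR Q, hR ⟨A, halg A hHA⟩, sum_le_eq_add_sum_lt _ Q] at h₁
      have h₂ : ∑ P : SpannedOver W H with P ≤ ⟨A, halg A hHA⟩, R P N =
          ∑ P : SpannedOver W H with P < Q, R P N := by
        refine Finset.sum_subset ?_ ?_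
        · intro P hP
          simp only [Finset.mem_filter, Finset.mem_univ, true_and] at hP ⊢
          exact lt_of_le_of_lt hP (lt_of_le_of_ne hAQ.le fun h => hne (congrArg Subtype.val h))
        · intro P hP hP'
          simp only [Finset.mem_filter, Finset.mem_univ, true_and] at hP hP'
          refine congrFun (ih P hP fun h => hP' ?_) N
          exact h.le_of_isFreeFactorOf hH hAQ hHA.1 hP.le
      rw [h₂] at h₁
      simpa using h₁.symm
  refine ⟨fun M N => if h : H ≤ M ∧ spannedBy W M = M then R ⟨M, h⟩ N else 0, ?_, ?_⟩
  · intro K hK hHK N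
    obtain ⟨A, hHA, hAK⟩ := exists_algebraic_hull hK hHK
    rw [← hAK.fixedMean_eq hK hHA.1 N, hR ⟨A, halg A hHA⟩]
    have h := sum_spannedSubgroups (H := H) hΓ.finite_vertices
      (fun M => IsAlgebraicExtensionOf H M ∧ M ≤ K)
      fun M => if h : H ≤ M ∧ spannedBy W M = M then R ⟨M, h⟩ N else 0
    refine Eq.symm ((Finset.sum_congr ?_ fun _ _ => rfl).trans (h.trans ?_))
    · ext M
      simp only [Finset.mem_filter, and_congr_right_iff]
      exact fun _ => ⟨fun h => ⟨h.1.1, h⟩, fun h => h.2⟩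
    have h'' : ∀ M : SpannedOver W H,
        (if h : H ≤ M.1 ∧ spannedBy W M = M then R ⟨M, h⟩ N else 0) = R M N := fun M =>
      dif_pos M.2
    simp only [h'']
    refine Finset.sum_subset ?_ ?_
    · intro M hM
      simp only [Finset.mem_filter, Finset.mem_univ, true_and] at hM ⊢
      exact hM.1.le_of_isFreeFactorOf hH hAK hHA.1 hM.2
    · intro M hM hM'
      simp only [Finset.mem_filter, Finset.mem_univ, true_and] at hM hM'
      exact congrFun (hzero M fun h => hM' ⟨h, le_trans hM hAK.le⟩) N
  · intro M hM k hk
    choose p hp using fun Q : SpannedOver W H => HasFreeRank.exists_of_fg (hfg Q)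
    choose D hD₁ hD₂ hD₃ using fun Q : SpannedOver W H =>
      hΓ.exists_stabilizerCount_expansion Q.2.2 (hp Q)
    let D' : Subgroup (FreeGroup α) → Subgroup (FreeGroup α) → ℕ → ℝ := fun P Q N =>
      if h : H ≤ P ∧ spannedBy W P = P then D ⟨P, h⟩ Q N else 0
    have hD' : ∀ P : SpannedOver W H, D' P = D P := fun P => by
      funext Q N
      exact dif_pos P.2
    have hev := hΓ.eventually_fixedMean_eq hT hTW (D := D') fun P => by
      rw [hD']
      exact hD₁ P
    let M' : SpannedOver W H := ⟨M, halg M hM⟩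
    have hpM : p M' = k := by
      have h₁ := (hp M').subgroupRank_eq
      rw [show (M' : Subgroup (FreeGroup α)) = M from rfl, hk.subgroupRank_eq] at h₁
      exact_mod_cast h₁.symm
    have hev' : ∀ᶠ N in atTop, R M' N - (N : ℝ) ^ (1 - k : ℤ) =
        ∑ P : SpannedOver W H with P < M', D P M N := by
      filter_upwards [hev, hD₃ M'] with N hN hN'
      have h := congrFun (eq_of_sum_le_eq (C := fun Q => R Q N)
        (C' := fun Q : SpannedOver W H => ∑ P : SpannedOver W H with P ≤ Q, D' P Q N)
        fun Q => (hR Q N).symm.trans (hN Q)) M'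
      simp only [hD'] at h
      rw [h, sum_le_eq_add_sum_lt (fun P : SpannedOver W H => D P M N), ← hpM, ← hN']
      exact add_sub_cancel_left _ _
    simp only [dif_pos (halg M hM)]
    refine IsBigO.congr' ?_ (hev'.mono fun N h => h.symm) EventuallyEq.rfl
    refine IsBigO.fun_sum fun P hP => (hD₂ P M).trans (isBigO_zpow_of_le ?_)
    have := hM.lt_rank_add P.2.1 (Finset.mem_filter.1 hP).2 (hp P) hk
    omega

open scoped Classical in
theorem exists_fixedMean_expansion (hH : H.FG) :
    ∃ (𝓐 : Finset (Subgroup (FreeGroup α))) (R : Subgroup (FreeGroup α) → ℕ → ℝ),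
      (∀ M, M ∈ 𝓐 ↔ IsAlgebraicExtensionOf H M) ∧
      (∀ K : Subgroup (FreeGroup α), K.FG → H ≤ K → ∀ N, fixedMean H K N =
        ∑ M ∈ 𝓐 with M ≤ K, R M N) ∧
      ∀ M, IsAlgebraicExtensionOf H M → ∀ k, HasFreeRank M k →
        (fun N => R M N - (N : ℝ) ^ (1 - k : ℤ)) =O[atTop] fun N => (N : ℝ) ^ (-k : ℤ) := by
  obtain ⟨T, hT, hTf⟩ := (Subgroup.fg_iff H).1 hH
  obtain ⟨Γ, hstep, hTΓ⟩ := exists_graphSteps_subset hTf ({1}, ∅) rfl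
  have hΓ := graphSteps_isRootedGraph hstep IsRootedGraph.singleton
  obtain ⟨R, h₁, h₂⟩ := hΓ.exists_fixedMean_expansion hTf hT hTΓ
  refine ⟨(spannedSubgroups hΓ.finite_vertices).filter fun M => IsAlgebraicExtensionOf H M, R,
    fun M => ?_, fun K hK hHK N => ?_, h₂⟩
  · rw [Finset.mem_filter, mem_spannedSubgroups, and_iff_right_iff_imp]
    exact fun h => h.spannedBy_eq hTf hT hΓ hTΓ
  · rw [h₁ K hK hHK, Finset.filter_filter]

end Expansion

section Difference

open Filter Asymptotics

theorem fg_map {G G' : Type} [Group G] [Group G'] (f : G →* G') {H : Subgroup G} (hH : H.FG) :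
    (H.map f).FG := by
  obtain ⟨T, hT, hTf⟩ := (Subgroup.fg_iff H).1 hH
  exact (Subgroup.fg_iff _).2 ⟨f '' T, hT ▸ (MonoidHom.map_closure f T).symm, hTf.image f⟩

theorem Phi_eq_fixedMean_map {m r : ℕ} (N : ℕ) (H : Subgroup (FreeGroup (Fin m)))
    (ι : FreeGroup (Fin m) →* FreeGroup (Fin r)) :
    (Phi r N (H.map ι) : ℝ) = fixedMean (H.map ι) ⊤ N := by
  have h := Phi_eq_fixedMean N (H.map ι) (ι := MonoidHom.id (FreeGroup (Fin r)))
    Function.injective_id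
  rwa [Subgroup.map_id, MonoidHom.range_eq_top_of_surjective _ Function.surjective_id] at h

theorem exists_rat_bound {f : ℕ → ℚ} {n : ℕ}
    (h : (fun N => (f N : ℝ)) =O[atTop] fun N => (N : ℝ) ^ (-n : ℤ)) :
    ∃ c : ℚ, 0 < c ∧ ∃ N₀ : ℕ, ∀ N : ℕ, N₀ ≤ N → |f N| ≤ c * (N : ℚ) ^ (-n : ℤ) := by
  obtain ⟨C, hC⟩ := h.bound
  obtain ⟨c, hc⟩ := exists_rat_gt (max C 0)
  rw [max_lt_iff] at hc
  obtain ⟨N₀, hN₀⟩ := eventually_atTop.1 hC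
  refine ⟨c, by exact_mod_cast hc.2, N₀, fun N hN => ?_⟩
  have h₁ : |(f N : ℝ)| ≤ C * (N : ℝ) ^ (-n : ℤ) := by
    have h := hN₀ N hN
    rwa [Real.norm_eq_abs, Real.norm_of_nonneg (by positivity)] at h
  have h₂ := h₁.trans (mul_le_mul_of_nonneg_right hc.1.le (by positivity))
  rw [← Rat.cast_le (K := ℝ)]
  push_cast
  exact h₂

theorem pos_of_abs_sub_le {f : ℕ → ℚ} {C c : ℚ} {n N₀ : ℕ} (hC : 1 ≤ C)
    (h : ∀ N, N₀ ≤ N → |f N - C * (N : ℚ) ^ (1 - n : ℤ)| ≤ c * (N : ℚ) ^ (-n : ℤ)) :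
    ∃ N₁ : ℕ, ∀ N, N₁ ≤ N → 0 < f N := by
  obtain ⟨k, hk⟩ := exists_nat_gt c
  refine ⟨max N₀ (k + 1), fun N hN => ?_⟩
  have h₁ := (abs_le.1 (h N (le_trans (le_max_left _ _) hN))).1
  have hkN : k + 1 ≤ N := le_trans (le_max_right _ _) hN
  have hN0 : (0 : ℚ) < N := by exact_mod_cast (Nat.succ_pos k).trans_le hkN
  have hcN : c < N := hk.trans (by exact_mod_cast hkN)
  have hpow : (N : ℚ) ^ (1 - n : ℤ) = N * (N : ℚ) ^ (-n : ℤ) := by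
    rw [sub_eq_add_neg, zpow_add₀ hN0.ne', zpow_one]
  have hp : (0 : ℚ) < (N : ℚ) ^ (-n : ℤ) := by positivity
  rw [hpow] at h₁
  nlinarith [mul_pos hN0 hp, mul_pos (sub_pos.2 hcN) hp]

open scoped Classical in
theorem isBigO_sum_sub_card {I : Type*} (s : Finset I) (R : I → ℕ → ℝ) (k : I → ℕ) {n : ℕ}
    (hk : ∀ i ∈ s, n ≤ k i)
    (hR : ∀ i ∈ s, (fun N => R i N - (N : ℝ) ^ (1 - k i : ℤ)) =O[atTop]
      fun N => (N : ℝ) ^ (-k i : ℤ)) :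
    (fun N => ∑ i ∈ s, R i N - (s.filter fun i => k i = n).card * (N : ℝ) ^ (1 - n : ℤ)) =O[atTop]
      fun N => (N : ℝ) ^ (-n : ℤ) := by
  have h : ∀ N : ℕ, ∑ i ∈ s, R i N - (s.filter fun i => k i = n).card * (N : ℝ) ^ (1 - n : ℤ) =
      ∑ i ∈ s, (R i N - if k i = n then (N : ℝ) ^ (1 - n : ℤ) else 0) := fun N => by
    rw [Finset.sum_sub_distrib, ← Finset.sum_filter, Finset.sum_const, nsmul_eq_mul]
  simp only [h]
  refine IsBigO.fun_sum fun i hi => ?_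
  have hle := hk i hi
  split_ifs with h
  · exact h ▸ hR i hi
  · have h₁ := ((hR i hi).trans (isBigO_zpow_of_le (b := -n) (by omega))).add
      (isBigO_zpow_of_le (a := 1 - k i) (b := -n) (by omega))
    simpa using h₁

end Difference

/-- Let `H ≤_alg J` be an algebraic extension of finitely generated free groups
(`J = FreeGroup (Fin m)`, `H` finitely generated), and let `ι : J ↪ F = FreeGroup (Fin r)`
be an embedding.  If `π_ι(H) = ∞` then `Φ_{ι(H),F}(N) = Φ_{H,J}(N)` for all `N`; if
`π_ι(H) = π < ∞` then
`Φ_{ι(H),F}(N) = Φ_{H,J}(N) + C·N^{1-π} + O(N^{-π})`, where `C` is the number of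
algebraic extensions of `ι(H)` in `F` of rank `π` not contained in `ι(J)`; in
particular `Φ_{ι(H),F}(N) > Φ_{H,J}(N)` for every large enough `N`. -/
theorem Phi_of_embedded_algebraic_extension
    (m r : ℕ) (H : Subgroup (FreeGroup (Fin m))) (hHfg : H.FG)
    (halg : IsAlgebraicExtensionOf H (⊤ : Subgroup (FreeGroup (Fin m))))
    (ι : FreeGroup (Fin m) →* FreeGroup (Fin r)) (hι : Function.Injective ι) :
    (piIota H ι = ⊤ → ∀ N : ℕ, Phi r N (H.map ι) = Phi m N H) ∧
    (∀ π : ℕ, piIota H ι = (π : ℕ∞) →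
      ((∃ c : ℚ, 0 < c ∧ ∃ N₀ : ℕ, ∀ N : ℕ, N₀ ≤ N →
          |Phi r N (H.map ι) -
              (Phi m N H +
                (Nat.card {M : Subgroup (FreeGroup (Fin r)) //
                    IsAlgebraicExtensionOf (H.map ι) M ∧ ¬ M ≤ ι.range ∧
                      subgroupRank M = (π : ℕ∞)} : ℚ) * (N : ℚ) ^ ((1 : ℤ) - (π : ℤ)))| ≤
            c * (N : ℚ) ^ (-(π : ℤ))) ∧
        ∃ N₀ : ℕ, ∀ N : ℕ, N₀ ≤ N → Phi m N H < Phi r N (H.map ι))) := by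
  have hH := (fg_map ι hHfg)
  have hrange : ι.range.FG := by
    rw [MonoidHom.range_eq_map]
    exact fg_map ι (Group.FG.out (G := FreeGroup (Fin m)))
  obtain ⟨𝓐, R, h𝓐, hsum, hR⟩ := exists_fixedMean_expansion hH
  choose! k hk using fun M (hM : IsAlgebraicExtensionOf (H.map ι) M) =>
    HasFreeRank.exists_of_fg (hM.fg hH)
  classical
  set 𝓑 := 𝓐.filter fun M => ¬ M ≤ ι.range
  have h𝓑 : ∀ M, M ∈ 𝓑 ↔ IsAlgebraicExtensionOf (H.map ι) M ∧ ¬ M ≤ ι.range := fun M => by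
    rw [Finset.mem_filter, h𝓐]
  have hdiff : ∀ N, ((Phi r N (H.map ι) - Phi m N H : ℚ) : ℝ) = ∑ M ∈ 𝓑, R M N := fun N => by
    rw [Rat.cast_sub, Phi_eq_fixedMean_map, Phi_eq_fixedMean N H hι,
      hsum _ Group.FG.out le_top, hsum _ hrange (Subgroup.map_le_range ι H), sub_eq_iff_eq_add',
      Finset.filter_true_of_mem fun _ _ => le_top]
    convert (Finset.sum_filter_add_sum_filter_not 𝓐 (fun M => M ≤ ι.range) fun M => R M N).symm
  have hpi : ∀ M ∈ 𝓑, piIota H ι ≤ k M := fun M hM => by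
    rw [← (hk M ((h𝓑 M).1 hM).1).subgroupRank_eq]
    exact iInf_le (fun M : {M : Subgroup (FreeGroup (Fin r)) //
      IsAlgebraicExtensionOf (H.map ι) M ∧ ¬ M ≤ ι.range} => subgroupRank M.1) ⟨M, (h𝓑 M).1 hM⟩
  refine ⟨fun htop N => ?_, fun π hπ => ?_⟩
  · have hempty : 𝓑 = ∅ := Finset.eq_empty_of_forall_notMem fun M hM => by
      simpa [htop] using hpi M hM
    have h := hdiff N
    rw [hempty, Finset.sum_empty] at h
    exact sub_eq_zero.1 (by exact_mod_cast h)
  · have hle : ∀ M ∈ 𝓑, π ≤ k M := fun M hM => by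
      have h := hpi M hM
      rw [hπ] at h
      exact_mod_cast h
    have hcard : Nat.card {M : Subgroup (FreeGroup (Fin r)) //
        IsAlgebraicExtensionOf (H.map ι) M ∧ ¬ M ≤ ι.range ∧ subgroupRank M = (π : ℕ∞)} =
        (𝓑.filter fun M => k M = π).card := by
      refine Nat.subtype_card _ fun M => ?_
      rw [Finset.mem_filter, h𝓑, ← and_assoc]
      refine and_congr_right fun h => ?_
      rw [(hk M h.1).subgroupRank_eq, Nat.cast_inj]
    have hpos : 1 ≤ (𝓑.filter fun M => k M = π).card := by
      by_contra! h
      have hempty := Finset.card_eq_zero.1 (Nat.lt_one_iff.1 h)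
      have hlt : ((π + 1 : ℕ) : ℕ∞) ≤ piIota H ι := le_iInf fun M => by
        have hM := (h𝓑 M.1).2 M.2
        rw [(hk M.1 M.2.1).subgroupRank_eq, Nat.cast_le]
        refine lt_of_le_of_ne (hle M.1 hM) fun h' => ?_
        exact Finset.notMem_empty M.1 (hempty ▸ Finset.mem_filter.2 ⟨hM, h'.symm⟩)
      rw [hπ, Nat.cast_le] at hlt
      omega
    have hO := isBigO_sum_sub_card 𝓑 R k hle fun M hM =>
      hR M ((h𝓑 M).1 hM).1 _ (hk M ((h𝓑 M).1 hM).1)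
    obtain ⟨c, hc, N₀, hN₀⟩ := exists_rat_bound (n := π)
      (f := fun N => (Phi r N (H.map ι) - Phi m N H) -
        (𝓑.filter fun M => k M = π).card * (N : ℚ) ^ (1 - π : ℤ)) (by
      convert hO using 2 with N
      rw [Rat.cast_sub, hdiff]
      push_cast
      rfl)
    refine ⟨⟨c, hc, N₀, fun N hN => ?_⟩, ?_⟩
    · rw [hcard, ← sub_sub]
      exact hN₀ N hN
    · obtain ⟨N₁, hN₁⟩ := pos_of_abs_sub_le (by exact_mod_cast hpos) hN₀
      exact ⟨N₁, fun N hN => sub_pos.1 (hN₁ N hN)⟩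
end

section
/- Let F be a finitely generated free group, let w ∈ F and let d ∈ ℤ. If w is profinitely rigid in F, then w^d is profinitely rigid in F. -/
/-- Two elements of a group `Γ` induce the same measure on every finite group:
for every finite group `G` and every `g : G`, the number of homomorphisms
`φ : Γ →* G` with `φ w₁ = g` equals the number of homomorphisms with `φ w₂ = g`. -/
def SameMeasureOnFiniteGroups {Γ : Type} [Group Γ] (w₁ w₂ : Γ) : Prop :=
  ∀ (G : Type) [Group G] [Finite G] (g : G),
    Nat.card {φ : Γ →* G // φ w₁ = g} = Nat.card {φ : Γ →* G // φ w₂ = g}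

/-- An element `w` of a group `Γ` is profinitely rigid if every `w' : Γ` inducing the
same measure as `w` on every finite group lies in the `Aut Γ`-orbit of `w`. -/
def ProfinitelyRigid {Γ : Type} [Group Γ] (w : Γ) : Prop :=
  ∀ w' : Γ, SameMeasureOnFiniteGroups w w' → ∃ θ : MulAut Γ, θ w = w'

theorem exists_hom_perm_of_labelling {α T : Type*} [Finite T] (c : T → α × Bool) (s : Equiv.Perm T)
    (h : ∀ i, (c i).1 = (c (s i)).1 → (c i).2 = (c (s i)).2) :
    ∃ σ : FreeGroup α →* Equiv.Perm T, ∀ i, σ (FreeGroup.mk [c i]) (s i) = i := by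
  classical
  have := Fintype.ofFinite T
  have key : ∀ a : α, ∃ g : Equiv.Perm T,
      ∀ i, (c i = (a, true) → g (s i) = i) ∧ (c i = (a, false) → g i = s i) := by
    intro a
    let D : Finset T := {x | c (s⁻¹ x) = (a, true) ∨ c x = (a, false)}
    let f : T → T := fun x => if c (s⁻¹ x) = (a, true) then s⁻¹ x else s x
    have mixed : ∀ x, c x = (a, false) → c (s x) ≠ (a, true) := by
      intro x h1 h2
      have := h x
      simp [h1, h2] at this
    have hf : Set.InjOn f (D : Set T) := by
      intro x hx y hy hxy
      simp only [D, Finset.coe_filter, Finset.mem_univ, true_and, Set.mem_ofPred_eq] at hx hy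
      simp only [f] at hxy
      split_ifs at hxy with h1 h2 h2
      · exact s⁻¹.injective hxy
      · rw [hxy] at h1
        exact absurd h1 (mixed y (by tauto))
      · rw [← hxy] at h2
        exact absurd h2 (mixed x (by tauto))
      · exact s.injective hxy
    obtain ⟨g, hg⟩ := Finset.exists_equiv_extend_of_card_eq (t := Finset.univ) (by simp)
      (Finset.subset_univ _) hf
    refine ⟨g.trans (Equiv.subtypeUnivEquiv (by simp)), fun i => ⟨fun hi => ?_, fun hi => ?_⟩⟩
    · have := hg (s i) (by simp [D, hi])
      simpa [f, hi] using this
    · have := hg i (by simp [D, hi])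
      have h2 : c (s⁻¹ i) ≠ (a, true) := by
        intro h2
        have := h (s⁻¹ i)
        simp_all
      rw [show f i = s i from if_neg h2] at this
      simpa using this
  choose g hg using key
  refine ⟨FreeGroup.lift g, fun i => ?_⟩
  rcases hc : c i with ⟨a, b⟩
  cases b
  · simp only [FreeGroup.lift_mk, List.map_cons, List.map_nil, List.prod_cons, List.prod_nil,
      mul_one, cond_false]
    rw [Equiv.Perm.inv_eq_iff_eq, ((hg a i).2 hc)]
  · simpa using (hg a i).1 hc

theorem perm_zpow_apply_of_forall {T : Type*} (g : Equiv.Perm T) (f : ℤ → T)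
    (h : ∀ t, g (f (t + 1)) = f t) (j : ℤ) : (g ^ j) (f j) = f 0 := by
  induction j using Int.induction_on with
  | zero => simp
  | succ i ih => rw [zpow_add_one, Equiv.Perm.mul_apply, h, ih]
  | pred i ih =>
    rw [zpow_sub_one, Equiv.Perm.mul_apply, ← ih]
    congr 1
    rw [Equiv.Perm.inv_eq_iff_eq, ← h, sub_add_cancel]

/-- The permutation representation of a free group along a cycle labelled by the `M`-th power
of a cyclically reduced word. -/
theorem FreeGroup.IsCyclicallyReduced.exists_hom_perm {α : Type*} {L : List (α × Bool)}
    (hL : FreeGroup.IsCyclicallyReduced L) (hne : L ≠ []) {M : ℕ} (hM : M ≠ 0) :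
    ∃ σ : FreeGroup α →* Equiv.Perm (ZMod (L.length * M)),
      (∀ i ≤ L.length, ∀ j : ℤ, σ (FreeGroup.mk (L.take i)) = σ (FreeGroup.mk L) ^ j →
        L.length ∣ i) ∧
      ∀ j : ℤ, σ (FreeGroup.mk L) ^ j = 1 → (M : ℤ) ∣ j := by
  set n := L.length with hn
  have hn0 : n ≠ 0 := by simpa [hn] using hne
  have : NeZero n := ⟨hn0⟩
  have : NeZero M := ⟨hM⟩
  let κ : ZMod n → α × Bool := fun x => L[x.val]'(x.val_lt)
  let π := ZMod.castHom (dvd_mul_right n M) (ZMod n)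
  have hκ : ∀ x, (κ x).1 = (κ (x + 1)).1 → (κ x).2 = (κ (x + 1)).2 := by
    intro x
    have hx := x.val_lt
    by_cases h : x.val + 1 < n
    · have h1 : (x + 1).val = x.val + 1 := by
        rw [← ZMod.val_cast_of_lt h, Nat.cast_add, ZMod.natCast_zmod_val, Nat.cast_one]
      simp only [κ, h1]
      exact List.isChain_iff_getElem.1 hL.1 _ h
    · have h0 : x.val + 1 = n := by omega
      have h1 : x + 1 = 0 := by
        rw [← ZMod.natCast_zmod_val x, ← Nat.cast_one, ← Nat.cast_add, h0, ZMod.natCast_self]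
      have h2 := hL.2 (L[x.val]'hx) (by
        rw [Option.mem_def, List.getLast?_eq_getElem?, ← hn,
          show n - 1 = x.val by omega, List.getElem?_eq_getElem hx])
        (L[0]'(by omega)) (by rw [Option.mem_def, List.head?_eq_getElem?, List.getElem?_eq_getElem])
      simpa only [κ, h1, ZMod.val_zero] using h2
  obtain ⟨σ, hσ⟩ := exists_hom_perm_of_labelling (fun x : ZMod (n * M) => κ (π x))
    (Equiv.addRight 1) (fun i => by simpa using hκ (π i))
  have path : ∀ a : ZMod (n * M), π a = 0 → ∀ i ≤ n, σ (FreeGroup.mk (L.take i)) (a + i) = a := by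
    intro a ha i
    induction i with
    | zero => intro _; simp [← FreeGroup.one_eq_mk]
    | succ i ih =>
      intro hi
      have h1 : κ (π (a + i)) = L[i]'(by omega) := by
        simp only [κ, map_add, ha, zero_add, map_natCast]
        congr 1
        exact ZMod.val_cast_of_lt (by omega)
      have h2 := hσ (a + i)
      rw [h1] at h2
      rw [List.take_add_one, List.getElem?_eq_getElem (by omega), Option.toList_some,
        ← FreeGroup.mul_mk, _root_.map_mul, Equiv.Perm.mul_apply, Nat.cast_add, Nat.cast_one,
        ← add_assoc]
      rw [show a + i + 1 = Equiv.addRight 1 (a + (i : ZMod (n * M))) from rfl, h2, ih (by omega)]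
  have pow : ∀ j : ℤ, (σ (FreeGroup.mk L) ^ j) ((n * j : ℤ) : ZMod (n * M)) = 0 := by
    intro j
    rw [perm_zpow_apply_of_forall _ (fun t : ℤ => ((n * t : ℤ) : ZMod (n * M)))]
    · simp
    · intro t
      have := path ((n * t : ℤ) : ZMod (n * M)) (by simp [π]) n le_rfl
      rw [show L.take n = L from List.take_length] at this
      rw [mul_add, mul_one, Int.cast_add, Int.cast_natCast, this]
  refine ⟨σ, fun i hi j hj => ?_, fun j hj => ?_⟩
  · have h1 := path 0 (map_zero _) i hi
    rw [zero_add, hj, ← pow j] at h1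
    have h2 := (Equiv.injective _ h1)
    rw [← Int.cast_natCast, ZMod.intCast_eq_intCast_iff_dvd_sub] at h2
    have h3 : (n : ℤ) ∣ n * j - i := (Dvd.intro _ (by push_cast; rfl)).trans h2
    have h4 := (Int.dvd_iff_dvd_of_dvd_sub h3).1 (dvd_mul_right _ _)
    exact_mod_cast h4
  · have h1 := pow j
    rw [hj, Equiv.Perm.one_apply, ZMod.intCast_zmod_eq_zero_iff_dvd] at h1
    push_cast at h1
    exact (mul_dvd_mul_iff_left (by exact_mod_cast hn0)).1 h1

theorem FreeGroup.exists_eq_conj_isCyclicallyReduced {α : Type*} (w : FreeGroup α) :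
    ∃ c L, FreeGroup.IsCyclicallyReduced L ∧ w = c * FreeGroup.mk L * c⁻¹ := by
  classical
  refine ⟨FreeGroup.mk (FreeGroup.reduceCyclically.conjugator w.toWord),
    FreeGroup.reduceCyclically w.toWord,
    FreeGroup.reduceCyclically.isCyclicallyReduced FreeGroup.isReduced_toWord, ?_⟩
  rw [FreeGroup.inv_mk, FreeGroup.mul_mk, FreeGroup.mul_mk,
    FreeGroup.reduceCyclically.conj_conjugator_reduceCyclically, FreeGroup.mk_toWord]

/-- A nontrivial element of a free group has order divisible by `M` in some finite quotient. -/
theorem FreeGroup.exists_hom_finite_dvd {α : Type} {v : FreeGroup α} (hv : v ≠ 1) {M : ℕ}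
    (hM : M ≠ 0) :
    ∃ (G : Type) (_ : Group G) (_ : Finite G) (σ : FreeGroup α →* G),
      ∀ j : ℤ, σ (v ^ j) = 1 → (M : ℤ) ∣ j := by
  obtain ⟨c, L, hL, rfl⟩ := FreeGroup.exists_eq_conj_isCyclicallyReduced v
  have hne : L ≠ [] := by
    rintro rfl
    simp [← FreeGroup.one_eq_mk] at hv
  obtain ⟨σ, -, hσ⟩ := hL.exists_hom_perm hne hM
  have : NeZero (L.length * M) := ⟨by simp [hne, hM]⟩
  refine ⟨_, inferInstance, inferInstance, σ, fun j hj => hσ j ?_⟩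
  rw [conj_zpow, _root_.map_mul, _root_.map_mul, _root_.map_inv, conj_eq_one_iff, map_zpow] at hj
  exact hj

theorem FreeGroup.exists_hom_finite_ne_one {α : Type} {v : FreeGroup α} (hv : v ≠ 1) :
    ∃ (G : Type) (_ : Group G) (_ : Finite G) (σ : FreeGroup α →* G), σ v ≠ 1 := by
  obtain ⟨G, _, _, σ, hσ⟩ := FreeGroup.exists_hom_finite_dvd hv two_ne_zero
  refine ⟨G, _, ‹_›, σ, fun h => ?_⟩
  have := hσ 1 (by simpa using h)
  omega

theorem IsFreeGroup.isCyclic_of_isMulCommutative (H : Type*) [Group H] [IsFreeGroup H]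
    (hH : ∀ a b : H, a * b = b * a) : IsCyclic H := by
  let e := IsFreeGroup.toFreeGroup H
  have hsub : Subsingleton (IsFreeGroup.Generators H) := by
    classical
    refine ⟨fun a b => ?_⟩
    by_contra hab
    have h := hH (e.symm (FreeGroup.of a)) (e.symm (FreeGroup.of b))
    rw [← map_mul, ← map_mul, e.symm.injective.eq_iff] at h
    have h2 := congrArg FreeGroup.toWord h
    simp [FreeGroup.of, FreeGroup.toWord_mk, FreeGroup.reduce, hab, Ne.symm hab] at h2
  have : IsCyclic (FreeGroup (IsFreeGroup.Generators H)) := by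
    rcases isEmpty_or_nonempty (IsFreeGroup.Generators H) with h | ⟨⟨a⟩⟩
    · infer_instance
    · have : Unique (IsFreeGroup.Generators H) := ⟨⟨a⟩, fun _ => Subsingleton.elim _ _⟩
      infer_instance
  exact isCyclic_of_surjective e.symm e.symm.surjective

theorem FreeGroup.exists_zpow_of_commute {α : Type*} {a b : FreeGroup α} (h : Commute a b) :
    ∃ (v : FreeGroup α) (k l : ℤ), a = v ^ k ∧ b = v ^ l := by
  let H := Subgroup.closure {a, b}
  have hH : ∀ x y : H, x * y = y * x := by
    have := Subgroup.isMulCommutative_closure (k := ({a, b} : Set (FreeGroup α))) (by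
      rintro x (rfl | rfl) y (rfl | rfl)
      exacts [rfl, h, h.symm, rfl])
    exact fun x y => mul_comm' x y
  obtain ⟨⟨v, hv⟩⟩ := IsFreeGroup.isCyclic_of_isMulCommutative H hH
  obtain ⟨k, hk⟩ := hv ⟨a, Subgroup.subset_closure (by simp)⟩
  obtain ⟨l, hl⟩ := hv ⟨b, Subgroup.subset_closure (by simp)⟩
  exact ⟨v, k, l, by simpa using congrArg Subtype.val hk.symm,
    by simpa using congrArg Subtype.val hl.symm⟩

/-- If `ρ` separates the proper prefixes of a cyclically reduced word `w` from the powers of `w`,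
then `ρ` factors through a finite quotient in which centralizing `w` forces an element to map
under `ρ` into the product of the powers of `w` with the inverses of prefixes of `w`. -/
theorem FreeGroup.IsCyclicallyReduced.exists_hom_centralizer {α : Type} {L : List (α × Bool)}
    (hL : FreeGroup.IsCyclicallyReduced L) (hne : L ≠ []) {Q : Type} [Group Q] [Finite Q]
    (ρ : FreeGroup α →* Q)
    (hρ : ∀ i ≤ L.length, ∀ j : ℤ, ρ (FreeGroup.mk (L.take i)) = ρ (FreeGroup.mk L) ^ j →
      L.length ∣ i) :
    ∃ Φ : FreeGroup α →* (ℤˣ ≀ᵣ Q), (∀ x, (Φ x).right = ρ x) ∧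
      ∀ x, Commute (Φ x) (Φ (FreeGroup.mk L)) → ∃ i ≤ L.length, ∃ j : ℤ,
        ρ x = ρ (FreeGroup.mk L) ^ j * (ρ (FreeGroup.mk (L.take i)))⁻¹ := by
  classical
  have := Fintype.ofFinite Q
  obtain ⟨l₀, L', rfl⟩ := List.exists_cons_of_ne_nil hne
  let δ : Q → Q → ℤˣ := fun a q => if q = a then -1 else 1
  let Φ : FreeGroup α →* (ℤˣ ≀ᵣ Q) := FreeGroup.lift fun a =>
    ⟨if a = l₀.1 then (if l₀.2 then δ 1 else δ (ρ (FreeGroup.of a))) else 1, ρ (FreeGroup.of a)⟩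
  have hright : ∀ x, (Φ x).right = ρ x := by
    have : RegularWreathProduct.rightHom.comp Φ = ρ := by
      ext a
      simp [Φ]
    exact DFunLike.congr_fun this
  have letter_head : ∀ q, (Φ (FreeGroup.mk [l₀])).left q = δ 1 q := by
    intro q
    rcases l₀ with ⟨a, _ | _⟩ <;> simp [Φ, δ]
  have mk_true : ∀ a : α, FreeGroup.mk [(a, true)] = FreeGroup.of a := fun _ => rfl
  have mk_false : ∀ a : α, FreeGroup.mk [(a, false)] = (FreeGroup.of a)⁻¹ := fun _ => rfl
  have letter : ∀ l q, (Φ (FreeGroup.mk [l])).left q ≠ 1 → (l = l₀ ∧ q = 1) ∨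
      (l = (l₀.1, !l₀.2) ∧ q = ρ (FreeGroup.mk [l])) := by
    rintro ⟨b, _ | _⟩ q <;> rcases l₀ with ⟨a, _ | _⟩ <;> by_cases hab : b = a <;>
      simp [mk_true, mk_false, Φ, δ, hab, mul_eq_one_iff_eq_inv']
  have cons : ∀ l K q, (Φ (FreeGroup.mk (l :: K))).left q =
      (Φ (FreeGroup.mk [l])).left q *
        (Φ (FreeGroup.mk K)).left ((ρ (FreeGroup.mk [l]))⁻¹ * q) := by
    intro l K q
    rw [← List.singleton_append, ← FreeGroup.mul_mk, _root_.map_mul,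
      RegularWreathProduct.mul_left, Pi.mul_apply, hright]
  have mk_cons : ∀ l K, ρ (FreeGroup.mk (l :: K)) = ρ (FreeGroup.mk [l]) * ρ (FreeGroup.mk K) := by
    intro l K
    rw [← List.singleton_append, ← FreeGroup.mul_mk, _root_.map_mul]
  have support : ∀ (K : List (α × Bool)) q, (Φ (FreeGroup.mk K)).left q ≠ 1 →
      ∃ (i : ℕ) (hi : i < K.length), (K[i] = l₀ ∧ q = ρ (FreeGroup.mk (K.take i))) ∨
        (K[i] = (l₀.1, !l₀.2) ∧ q = ρ (FreeGroup.mk (K.take (i + 1)))) := by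
    intro K
    induction K with
    | nil => intro q h; simp [← FreeGroup.one_eq_mk] at h
    | cons l K ih =>
      intro q h
      rw [cons] at h
      by_cases h1 : (Φ (FreeGroup.mk [l])).left q = 1
      · rw [h1, one_mul] at h
        obtain ⟨i, hi, h2⟩ := ih _ h
        refine ⟨i + 1, by simpa using hi, ?_⟩
        simpa only [inv_mul_eq_iff_eq_mul, List.getElem_cons_succ, List.take_succ_cons,
          mk_cons l (K.take _)] using h2
      · refine ⟨0, by simp, ?_⟩
        simpa [← FreeGroup.one_eq_mk] using letter l q h1
  set W : Finset Q := {q | q ∈ Subgroup.zpowers (ρ (FreeGroup.mk (l₀ :: L')))} with hW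
  have memW : ∀ {q}, q ∈ W ↔ ∃ j : ℤ, ρ (FreeGroup.mk (l₀ :: L')) ^ j = q := by
    simp [hW, Subgroup.mem_zpowers_iff]
  set w := FreeGroup.mk (l₀ :: L') with hw
  have prod_W : ∏ q ∈ W, (Φ w).left q = -1 := by
    have tail : ∀ q ∈ W, (Φ (FreeGroup.mk L')).left ((ρ (FreeGroup.mk [l₀]))⁻¹ * q) = 1 := by
      intro q hq
      obtain ⟨j, rfl⟩ := memW.1 hq
      by_contra h
      obtain ⟨i, hi, ⟨-, h⟩ | ⟨h', h⟩⟩ := support _ _ h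
      · rw [inv_mul_eq_iff_eq_mul, ← mk_cons, ← List.take_succ_cons] at h
        have := Nat.le_of_dvd (by omega) (hρ (i + 1) (by simp; omega) j h.symm)
        simp at this
        omega
      · rw [inv_mul_eq_iff_eq_mul, ← mk_cons, ← List.take_succ_cons] at h
        have := Nat.le_of_dvd (by omega) (hρ (i + 1 + 1) (by simp; omega) j h.symm)
        simp at this
        have h3 := hL.2 L'[i] (by
          rw [Option.mem_def, List.getLast?_eq_getElem?]
          simp [show L'.length = i + 1 by omega]) l₀ (by simp)
        simp [h'] at h3
    rw [Finset.prod_congr rfl (g := δ 1) (fun q hq => by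
      rw [hw, cons, tail q hq, letter_head, mul_one])]
    have h1 : (1 : Q) ∈ W := memW.2 ⟨0, by simp⟩
    simp [δ, Finset.prod_ite_eq', h1]
  refine ⟨Φ, hright, fun x hx => ?_⟩
  have hcomm : ∀ q, (Φ x).left q * (Φ w).left ((ρ x)⁻¹ * q) =
      (Φ w).left q * (Φ x).left ((ρ w)⁻¹ * q) := by
    intro q
    have := congrFun (congrArg RegularWreathProduct.left hx.eq) q
    simpa [hright] using this
  have hprod := Finset.prod_congr (rfl : W = W) fun q _ => hcomm q
  have hshift : ∏ q ∈ W, (Φ x).left ((ρ w)⁻¹ * q) = ∏ q ∈ W, (Φ x).left q := by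
    refine Finset.prod_equiv (Equiv.mulLeft (ρ w)⁻¹) (fun q => ?_) (fun q _ => rfl)
    rw [hW, Finset.mem_filter_univ, Finset.mem_filter_univ, Equiv.coe_mulLeft,
      Subgroup.mul_mem_cancel_left _ (inv_mem (Subgroup.mem_zpowers _))]
  rw [Finset.prod_mul_distrib, Finset.prod_mul_distrib, hshift, prod_W, mul_comm,
    mul_left_inj] at hprod
  obtain ⟨q, hq, hne1⟩ := Finset.exists_ne_one_of_prod_ne_one
    (by rw [hprod]; decide : ∏ q ∈ W, (Φ w).left ((ρ x)⁻¹ * q) ≠ 1)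
  obtain ⟨j, rfl⟩ := memW.1 hq
  have : ∃ i ≤ (l₀ :: L').length, (ρ x)⁻¹ * ρ w ^ j = ρ (FreeGroup.mk ((l₀ :: L').take i)) := by
    obtain ⟨i, hi, ⟨-, h⟩ | ⟨-, h⟩⟩ := support _ _ hne1
    exacts [⟨i, hi.le, h⟩, ⟨i + 1, hi, h⟩]
  obtain ⟨i, hi, h⟩ := this
  exact ⟨i, hi, j, by rw [← h]; group⟩

theorem FreeGroup.IsCyclicallyReduced.exists_hom_zpow_root {α : Type} {L : List (α × Bool)}
    (hL : FreeGroup.IsCyclicallyReduced L) (hne : L ≠ []) (hw : FreeGroup.mk L ≠ 1) {d : ℤ}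
    (hd : d ≠ 0) {G : Type} [Group G] [Finite G] (ψ : FreeGroup α →* G) :
    ∃ (Q : Type) (_ : Group Q) (_ : Finite Q) (Φ : FreeGroup α →* Q),
      ∀ x, Φ (x ^ d) = Φ (FreeGroup.mk L) → ∃ u, u ^ d = FreeGroup.mk L ∧ ψ x = ψ u := by
  set w := FreeGroup.mk L with hw_def
  set n := L.length
  let p : ℕ → FreeGroup α := fun i => FreeGroup.mk (L.take i)
  have hM : d.natAbs * Nat.card G ≠ 0 := mul_ne_zero (by simpa using hd) Nat.card_pos.ne'
  have separate : ∀ i : Fin (n + 1), ∃ (H : Type) (_ : Group H) (_ : Finite H)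
      (σ : FreeGroup α →* H), σ (p i) * σ w = σ w * σ (p i) → ∃ (v : FreeGroup α) (k l : ℤ),
        p i = v ^ k ∧ w = v ^ l ∧
          ∀ j : ℤ, σ (v ^ j) = 1 → ((d.natAbs * Nat.card G : ℕ) : ℤ) ∣ j := by
    intro i
    by_cases hc : Commute (p i) w
    · obtain ⟨v, k, l, hk, hl⟩ := FreeGroup.exists_zpow_of_commute hc
      have hv : v ≠ 1 := by
        rintro rfl
        exact hw (by simpa using hl)
      obtain ⟨H, _, hH, σ, hσ⟩ := FreeGroup.exists_hom_finite_dvd hv hM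
      exact ⟨H, _, hH, σ, fun _ => ⟨v, k, l, hk, hl, hσ⟩⟩
    · obtain ⟨H, _, hH, σ, hσ⟩ := FreeGroup.exists_hom_finite_ne_one
        (mt commutatorElement_eq_one_iff_commute.1 hc)
      refine ⟨H, _, hH, σ, fun h => absurd ?_ hσ⟩
      rw [map_commutatorElement, commutatorElement_eq_one_iff_mul_comm, h]
  choose H hgrp hfin σ hσ using separate
  obtain ⟨τ, hτ, -⟩ := hL.exists_hom_perm hne one_ne_zero
  have : NeZero (L.length * 1) := ⟨by simpa using hne⟩
  let ρ : FreeGroup α →* G × Equiv.Perm (ZMod (L.length * 1)) × (∀ i, H i) :=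
    ψ.prod (τ.prod (MonoidHom.pi σ))
  obtain ⟨Φ, hright, hΦ⟩ := hL.exists_hom_centralizer hne ρ (fun i hi j hj => hτ i hi j (by
    simpa [ρ] using congrArg (fun z => z.2.1) hj))
  refine ⟨_, inferInstance, inferInstance, Φ, fun x hx => ?_⟩
  obtain ⟨i, hi, j, hij⟩ := hΦ x (by
    rw [← hx, _root_.map_zpow]
    exact Commute.self_zpow _ _)
  have hxd : ρ (x ^ d) = ρ w := by rw [← hright, ← hright, hx]
  have hxz : ρ x = ρ (w ^ j * (p i)⁻¹) := by
    rw [hij, _root_.map_mul, _root_.map_zpow, _root_.map_inv]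
  have hcomm : Commute (ρ (p i)) (ρ w) := by
    have h1 : Commute (ρ x) (ρ w) := by
      rw [← hxd, _root_.map_zpow]
      exact Commute.self_zpow _ _
    have h2 : ρ (p i) = (ρ x)⁻¹ * ρ w ^ j := by
      rw [hxz]
      simp
    rw [h2]
    exact h1.inv_left.mul_left ((Commute.refl _).zpow_left j)
  let i' : Fin (n + 1) := ⟨i, Nat.lt_succ_of_le hi⟩
  obtain ⟨v, k, l, hk, hl, hv⟩ := hσ i' (by
    exact congrArg (fun z => z.2.2 i') hcomm.eq)
  have hz : w ^ j * (p i)⁻¹ = v ^ (l * j - k) := by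
    rw [hl, show p i = v ^ k from hk, ← zpow_mul, ← zpow_neg, ← zpow_add, sub_eq_add_neg]
  rw [hz] at hxz
  have hdvd : ((d.natAbs * Nat.card G : ℕ) : ℤ) ∣ (l * j - k) * d - l := by
    refine hv _ ?_
    have h : ρ (v ^ ((l * j - k) * d - l)) = 1 := by
      rw [zpow_sub, zpow_mul, _root_.map_mul, _root_.map_zpow ρ _ d, ← hxz, ← _root_.map_zpow, hxd,
        ← hl, _root_.map_inv, mul_inv_cancel]
    exact congrArg (fun z => z.2.2 i') h
  obtain ⟨m, rfl⟩ : d ∣ l := by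
    have h1 : d ∣ ((d.natAbs * Nat.card G : ℕ) : ℤ) :=
      Int.dvd_natCast.2 (Dvd.intro _ rfl)
    exact (Int.dvd_iff_dvd_of_dvd_sub (h1.trans hdvd)).1 (Dvd.intro_left _ rfl)
  refine ⟨v ^ m, by rw [hl, ← zpow_mul, mul_comm], ?_⟩
  have hcard : (Nat.card G : ℤ) ∣ (d * m * j - k) - m := by
    have h1 : d * Nat.card G ∣ d * ((d * m * j - k) - m) := by
      refine dvd_trans ?_ (dvd_trans hdvd (dvd_of_eq (by ring)))
      rw [Nat.cast_mul]
      exact mul_dvd_mul_right Int.dvd_natAbs_self _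
    exact (mul_dvd_mul_iff_left hd).1 h1
  have h1 : ψ x = ψ (v ^ (d * m * j - k)) := by simpa [ρ] using congrArg Prod.fst hxz
  obtain ⟨t, ht⟩ := hcard
  rw [h1, ← sub_add_cancel (d * m * j - k) m, ht, zpow_add, _root_.map_mul, zpow_mul, _root_.map_zpow,
    zpow_natCast, _root_.map_pow, pow_card_eq_one', one_zpow, one_mul]

/-- Approximate `d`-th roots of `w ≠ 1` in a large finite quotient of a free group are, in a given
finite quotient, images of `d`-th roots of `w`. -/
theorem FreeGroup.exists_hom_zpow_root {α : Type} {w : FreeGroup α} (hw : w ≠ 1) {d : ℤ}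
    (hd : d ≠ 0) {G : Type} [Group G] [Finite G] (ψ : FreeGroup α →* G) :
    ∃ (Q : Type) (_ : Group Q) (_ : Finite Q) (Φ : FreeGroup α →* Q),
      ∀ x, Φ (x ^ d) = Φ w → ∃ u, u ^ d = w ∧ ψ x = ψ u := by
  obtain ⟨c, L, hL, rfl⟩ := FreeGroup.exists_eq_conj_isCyclicallyReduced w
  have hw' : FreeGroup.mk L ≠ 1 := by simpa [conj_eq_one_iff] using hw
  have hne : L ≠ [] := by
    rintro rfl
    exact hw' FreeGroup.one_eq_mk.symm
  obtain ⟨Q, _, hQ, Φ, hΦ⟩ := hL.exists_hom_zpow_root hne hw' hd ψ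
  refine ⟨Q, _, hQ, Φ, fun x hx => ?_⟩
  obtain ⟨u, hu, hxu⟩ := hΦ (c⁻¹ * x * c⁻¹⁻¹) (by
    rw [conj_zpow, _root_.map_mul, _root_.map_mul, hx]
    simp [mul_assoc])
  refine ⟨c * u * c⁻¹, by rw [conj_zpow, hu], ?_⟩
  rw [_root_.map_mul, _root_.map_mul, ← hxu]
  simp [mul_assoc]

instance FreeGroup.finite_monoidHom {α G : Type*} [Finite α] [Group G] [Finite G] :
    Finite (FreeGroup α →* G) :=
  Finite.of_equiv _ FreeGroup.lift

section Epimorphisms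

variable {Γ : Type} [Group Γ]

/-- Homomorphisms with prescribed range correspond to epimorphisms onto it. -/
def MonoidHom.equivSurjectiveOfRange {G : Type} [Group G] (w : Γ) (S : Subgroup G) (g : S) :
    {φ : Γ →* G // φ w = g ∧ φ.range = S} ≃
      {φ : Γ →* S // φ w = g ∧ Function.Surjective φ} where
  toFun φ := ⟨φ.1.codRestrict S fun x => φ.2.2.le ⟨x, rfl⟩, Subtype.ext φ.2.1, by
    rintro ⟨y, hy⟩
    obtain ⟨x, rfl⟩ := φ.2.2.ge hy
    exact ⟨x, rfl⟩⟩
  invFun φ := ⟨S.subtype.comp φ.1, congrArg Subtype.val φ.2.1, by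
    rw [MonoidHom.range_comp, MonoidHom.range_eq_top.2 φ.2.2, ← MonoidHom.range_eq_map,
      Subgroup.range_subtype]⟩
  left_inv _ := rfl
  right_inv _ := rfl

theorem SameMeasureOnFiniteGroups.card_surjective_eq
    (hfin : ∀ (G : Type) [Group G] [Finite G], Finite (Γ →* G)) {w₁ w₂ : Γ}
    (h : SameMeasureOnFiniteGroups w₁ w₂) (n : ℕ) :
    ∀ (G : Type) [Group G] [Finite G], Nat.card G = n → ∀ g : G,
      Nat.card {φ : Γ →* G // φ w₁ = g ∧ Function.Surjective φ} =
        Nat.card {φ : Γ →* G // φ w₂ = g ∧ Function.Surjective φ} := by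
  classical
  induction n using Nat.strong_induction_on with
  | _ n ih =>
    intro G _ _ hn g
    have := Fintype.ofFinite (Subgroup G)
    have := hfin G
    have decomp : ∀ w : Γ, Nat.card {φ : Γ →* G // φ w = g} =
        ∑ S : Subgroup G, Nat.card {φ : Γ →* G // φ w = g ∧ φ.range = S} := by
      intro w
      rw [← Nat.card_sigma]
      exact Nat.card_congr
        { toFun := fun φ => ⟨φ.1.range, φ.1, φ.2, rfl⟩
          invFun := fun x => ⟨x.2.1, x.2.2.1⟩
          left_inv := fun _ => rfl
          right_inv := by rintro ⟨_, _, _, rfl⟩; rfl }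
    have proper : ∀ S : Subgroup G, S ≠ ⊤ →
        Nat.card {φ : Γ →* G // φ w₁ = g ∧ φ.range = S} =
          Nat.card {φ : Γ →* G // φ w₂ = g ∧ φ.range = S} := by
      intro S hS
      by_cases hg : g ∈ S
      · rw [Nat.card_congr (MonoidHom.equivSurjectiveOfRange w₁ S ⟨g, hg⟩),
          Nat.card_congr (MonoidHom.equivSurjectiveOfRange w₂ S ⟨g, hg⟩)]
        refine ih (Nat.card S) ?_ S rfl _
        rw [← hn]
        exact lt_of_le_of_ne (Subgroup.card_le_card_group S)
          (fun hc => hS ((Subgroup.card_eq_iff_eq_top S).1 hc))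
      · have empty : ∀ w : Γ, IsEmpty {φ : Γ →* G // φ w = g ∧ φ.range = S} := fun w =>
          ⟨fun φ => hg (φ.2.2.le ⟨w, φ.2.1⟩)⟩
        have := empty w₁
        have := empty w₂
        simp
    have total := h G g
    rw [decomp, decomp, ← Finset.add_sum_erase _ _ (Finset.mem_univ ⊤),
      ← Finset.add_sum_erase _ _ (Finset.mem_univ (⊤ : Subgroup G)),
      Finset.sum_congr rfl (fun S hS => proper S (Finset.ne_of_mem_erase hS)),
      Nat.add_right_cancel_iff] at total
    simpa only [MonoidHom.range_eq_top] using total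

theorem SameMeasureOnFiniteGroups.exists_surjective
    (hfin : ∀ (G : Type) [Group G] [Finite G], Finite (Γ →* G)) {w₁ w₂ : Γ}
    (h : SameMeasureOnFiniteGroups w₁ w₂) {G : Type} [Group G] [Finite G] (τ : Γ →* G)
    (hτ : Function.Surjective τ) :
    ∃ φ : Γ →* G, φ w₁ = τ w₂ ∧ Function.Surjective φ := by
  have : Nonempty {φ : Γ →* G // φ w₂ = τ w₂ ∧ Function.Surjective φ} := ⟨τ, rfl, hτ⟩
  have h1 := h.card_surjective_eq hfin _ G rfl (τ w₂)
  have := hfin G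
  obtain ⟨φ, hφ⟩ := (Nat.card_pos_iff.1 (h1.trans_gt Nat.card_pos)).1
  exact ⟨φ, hφ⟩

theorem SameMeasureOnFiniteGroups.symm {w₁ w₂ : Γ} (h : SameMeasureOnFiniteGroups w₁ w₂) :
    SameMeasureOnFiniteGroups w₂ w₁ := fun G _ _ g => (h G g).symm

end Epimorphisms

theorem SameMeasureOnFiniteGroups.eq_one {r : ℕ} {w : FreeGroup (Fin r)}
    (h : SameMeasureOnFiniteGroups w 1) : w = 1 := by
  by_contra hw
  obtain ⟨G, _, _, σ, hσ⟩ := FreeGroup.exists_hom_finite_ne_one hw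
  have : IsEmpty {φ : FreeGroup (Fin r) →* G // φ 1 = σ w} :=
    ⟨fun φ => hσ (by rw [← φ.2, map_one])⟩
  have : Nonempty {φ : FreeGroup (Fin r) →* G // φ w = σ w} := ⟨σ, rfl⟩
  have h1 := h G (σ w)
  exact Nat.card_pos.ne' (h1.trans Nat.card_of_isEmpty)

theorem SameMeasureOnFiniteGroups.card_eq_of_zpow {r : ℕ} {w w' : FreeGroup (Fin r)} {d : ℤ}
    (hd : d ≠ 0) (hw' : w' ≠ 1) (h : SameMeasureOnFiniteGroups (w ^ d) w')
    (G : Type) [Group G] [Finite G] :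
    ∃ u, u ^ d = w' ∧ ∀ g : G, Nat.card {φ : FreeGroup (Fin r) →* G // φ w = g} =
      Nat.card {φ : FreeGroup (Fin r) →* G // φ u = g} := by
  let ψ : FreeGroup (Fin r) →* ((FreeGroup (Fin r) →* G) → G) := MonoidHom.pi id
  obtain ⟨Q, _, _, Φ, hΦ⟩ := FreeGroup.exists_hom_zpow_root hw' hd ψ
  let τ := (ψ.prod Φ).rangeRestrict
  have hτ : Function.Surjective τ := MonoidHom.rangeRestrict_surjective _
  obtain ⟨φ, hφ, hsurj⟩ := h.exists_surjective (fun _ _ _ => inferInstance) τ hτ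
  choose a ha using fun i => hτ (φ (FreeGroup.of i))
  let e : FreeGroup (Fin r) →* FreeGroup (Fin r) := FreeGroup.lift a
  have he : ∀ x, τ (e x) = φ x := by
    refine DFunLike.congr_fun (?_ : τ.comp e = φ)
    refine FreeGroup.ext_hom _ _ fun i => ?_
    simp [e, ha]
  have hker : ∀ x y, τ x = τ y → ψ x = ψ y ∧ Φ x = Φ y := fun x y hxy =>
    Prod.ext_iff.1 (congrArg Subtype.val hxy)
  obtain ⟨u, hu, hwu⟩ := hΦ (e w) (hker _ _ (by rw [← map_zpow, he, hφ])).2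
  refine ⟨u, hu, fun g => Nat.card_congr (Equiv.symm ?_)⟩
  have hinj : Function.Injective fun χ : FreeGroup (Fin r) →* G => χ.comp e := by
    intro χ₁ χ₂ hχ
    ext i
    obtain ⟨y, hy⟩ := hsurj (τ (FreeGroup.of i))
    have h1 : ∀ χ : FreeGroup (Fin r) →* G, χ (FreeGroup.of i) = χ (e y) := fun χ =>
      congrFun (hker _ _ (by rw [he, hy])).1 χ
    rw [h1, h1]
    exact DFunLike.congr_fun hχ y
  refine (Equiv.ofBijective _ (Finite.injective_iff_bijective.1 hinj)).subtypeEquiv fun χ => ?_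
  have h1 : χ (e w) = χ u := congrFun hwu χ
  simp [h1]

/-- In a finitely generated free group, if `w` is profinitely rigid then so is `w ^ d`
for every integer `d`. -/
theorem profinitelyRigid_zpow (r : ℕ) (w : FreeGroup (Fin r)) (d : ℤ)
    (h : ProfinitelyRigid w) : ProfinitelyRigid (w ^ d) := by
  intro w' hw'
  by_cases h1 : w' = 1
  · subst h1
    exact ⟨1, by rw [hw'.eq_one, map_one]⟩
  have hd : d ≠ 0 := by
    rintro rfl
    rw [zpow_zero] at hw'
    exact h1 hw'.symm.eq_one
  obtain ⟨u, hu, -⟩ := hw'.card_eq_of_zpow hd h1 Unit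
  obtain ⟨θ, hθ⟩ := h u fun G _ _ g => by
    obtain ⟨u', hu', hcard⟩ := hw'.card_eq_of_zpow hd h1 G
    rw [zpow_left_injective hd (hu.trans hu'.symm)]
    exact hcard g
  exact ⟨θ, by rw [map_zpow, hθ, hu]⟩
end
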